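/- arXiv:1501.06198 — 9 statements merged into one kernel-verified Lean document; each statement's English description precedes it below -/
import Mathlib

section
/- For every i ∈ {1,…,n} and every u ∈ ℝ one has ‖d_i(u)‖ = ‖d_i(0)‖; that is, the Euclidean norm of the vector d_i(u) is independent of the flexion parameter u. -/
open scoped RealInnerProductSpace BigOperators

/-- The norm of the vector `d i u` is independent of the flexion
parameter `u` for the flexible cross-polytopes of the simplest type in `Sⁿ`. -/
theorem norm_d_const (n : ℕ) (hn : 2 ≤ n)
    (nv : Fin n → EuclideanSpace ℝ (Fin (n + 1)))
    (m : EuclideanSpace ℝ (Fin (n + 1)))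
    (hnv_indep : LinearIndependent ℝ nv)
    (hnv_unit : ∀ i, ‖nv i‖ = 1)
    (hm_unit : ‖m‖ = 1)
    (hm_orth : ∀ i, ⟪m, nv i⟫ = 0)
    (lam : Fin n → ℝ)
    (hlam_ne : ∀ i, lam i ≠ 0)
    (hlam : ∀ i j : Fin n, i ≠ j → lam i ≠ lam j ∧ lam i ≠ -lam j)
    (h : Fin n → Fin n → ℝ)
    (hhdiag : ∀ i, h i i = 1)
    (hhoff : ∀ i j : Fin n, i ≠ j →
      h i j = 2 * lam i * (lam i * ⟪nv i, nv j⟫ - lam j) / ((lam i) ^ 2 - (lam j) ^ 2))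
    (c : Fin n → EuclideanSpace ℝ (Fin (n + 1)))
    (hc_mem : ∀ i, c i ∈ Submodule.span ℝ (Set.range nv))
    (hc_dual : ∀ i j : Fin n, ⟪c i, nv j⟫ = if i = j then 1 else 0)
    (d : Fin n → ℝ → EuclideanSpace ℝ (Fin (n + 1)))
    (hd : ∀ (i : Fin n) (u : ℝ), d i u = (∑ j, h i j • c j)
      - ((2 * (lam i) ^ 2 * u ^ 2) / ((lam i) ^ 2 * u ^ 2 + 1)) • nv i
      + ((2 * lam i * u) / ((lam i) ^ 2 * u ^ 2 + 1)) • m) :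
    ∀ (i : Fin n) (u : ℝ), ‖d i u‖ = ‖d i 0‖ := by
  have hmc (j : Fin n) : ⟪c j, m⟫ = 0 := by
    have hle : Submodule.span ℝ (Set.range nv) ≤ (ℝ ∙ m)ᗮ := by
      rw [Submodule.span_le]
      rintro _ ⟨k, rfl⟩
      exact Submodule.mem_orthogonal_singleton_iff_inner_right.2 (hm_orth k)
    exact Submodule.mem_orthogonal_singleton_iff_inner_left.1 (hle (hc_mem j))
  intro i u
  set w := ∑ j, h i j • c j with hw
  have hwn : ⟪w, nv i⟫ = 1 := by
    simp [hw, sum_inner, inner_smul_left, hc_dual, hhdiag]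
  have hwm : ⟪w, m⟫ = 0 := by
    simp [hw, sum_inner, inner_smul_left, hmc]
  have hnm : ⟪nv i, m⟫ = 0 := by rw [real_inner_comm, hm_orth]
  have hsq (a b : ℝ) : ‖w - a • nv i + b • m‖ ^ 2 = ‖w‖ ^ 2 - 2 * a + a ^ 2 + b ^ 2 := by
    rw [norm_add_sq_real, norm_sub_sq_real, inner_sub_left]
    simp only [inner_smul_left, inner_smul_right, hwn, hwm, hnm, norm_smul, hnv_unit, hm_unit,
      mul_pow, Real.norm_eq_abs, sq_abs]
    simp
  have hpos : (lam i) ^ 2 * u ^ 2 + 1 ≠ 0 := by positivity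
  have hd_zero : d i 0 = w := by simp [hd, hw]
  rw [← sq_eq_sq₀ (norm_nonneg _) (norm_nonneg _), hd_zero, hd, hsq]
  field_simp
  ring
end

section
/- For all i ≠ j in {1,…,n} and all u ∈ ℝ one has ⟨d_i(u), d_j(u)⟩ = ⟨d_i(0), d_j(0)⟩ and ⟨c_i, d_j(u)⟩ = ⟨c_i, d_j(0)⟩. (Together with the constancy of the norms ‖d_i(u)‖, this says that all edge lengths of the spherical cross-polytope with vertex pairs ±c_i/‖c_i‖ and ±d_i(u)/‖d_i(u)‖ remain constant during the flexion.) -/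
open scoped RealInnerProductSpace BigOperators

/-- The tangent half-angle identity that cancels the `u`-dependence of `⟪d i u, d j u⟫`. -/
lemma flexion_identity {a b : ℝ} (hab : a ^ 2 - b ^ 2 ≠ 0) (g u : ℝ) :
    (2 * b ^ 2 * u ^ 2) / (b ^ 2 * u ^ 2 + 1) * (2 * a * (a * g - b) / (a ^ 2 - b ^ 2))
      + (2 * a ^ 2 * u ^ 2) / (a ^ 2 * u ^ 2 + 1) * (2 * b * (b * g - a) / (b ^ 2 - a ^ 2))
      = (2 * a ^ 2 * u ^ 2) / (a ^ 2 * u ^ 2 + 1) * ((2 * b ^ 2 * u ^ 2) / (b ^ 2 * u ^ 2 + 1)) * g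
        + (2 * a * u) / (a ^ 2 * u ^ 2 + 1) * ((2 * b * u) / (b ^ 2 * u ^ 2 + 1)) := by
  have ha : a ^ 2 * u ^ 2 + 1 ≠ 0 := by positivity
  have hb : b ^ 2 * u ^ 2 + 1 ≠ 0 := by positivity
  rw [← neg_sub (a ^ 2) (b ^ 2), div_neg]
  field_simp
  ring

/-- All pairwise inner products between the vectors `c i` and `d j u`
(for `i ≠ j`) are independent of the flexion parameter `u`; together with the
constancy of the norms `‖d i u‖`, this says all edge lengths of the spherical
cross-polytope are constant during the flexion. -/
theorem inner_const_of_ne (n : ℕ) (hn : 2 ≤ n)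
    (nv : Fin n → EuclideanSpace ℝ (Fin (n + 1)))
    (m : EuclideanSpace ℝ (Fin (n + 1)))
    (hnv_indep : LinearIndependent ℝ nv)
    (hnv_unit : ∀ i, ‖nv i‖ = 1)
    (hm_unit : ‖m‖ = 1)
    (hm_orth : ∀ i, ⟪m, nv i⟫ = 0)
    (lam : Fin n → ℝ)
    (hlam_ne : ∀ i, lam i ≠ 0)
    (hlam : ∀ i j : Fin n, i ≠ j → lam i ≠ lam j ∧ lam i ≠ -lam j)
    (h : Fin n → Fin n → ℝ)
    (hhdiag : ∀ i, h i i = 1)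
    (hhoff : ∀ i j : Fin n, i ≠ j →
      h i j = 2 * lam i * (lam i * ⟪nv i, nv j⟫ - lam j) / ((lam i) ^ 2 - (lam j) ^ 2))
    (c : Fin n → EuclideanSpace ℝ (Fin (n + 1)))
    (hc_mem : ∀ i, c i ∈ Submodule.span ℝ (Set.range nv))
    (hc_dual : ∀ i j : Fin n, ⟪c i, nv j⟫ = if i = j then 1 else 0)
    (d : Fin n → ℝ → EuclideanSpace ℝ (Fin (n + 1)))
    (hd : ∀ (i : Fin n) (u : ℝ), d i u = (∑ j, h i j • c j)
      - ((2 * (lam i) ^ 2 * u ^ 2) / ((lam i) ^ 2 * u ^ 2 + 1)) • nv i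
      + ((2 * lam i * u) / ((lam i) ^ 2 * u ^ 2 + 1)) • m)
    :
    ∀ i j : Fin n, i ≠ j → ∀ u : ℝ,
      ⟪d i u, d j u⟫ = ⟪d i 0, d j 0⟫ ∧ ⟪c i, d j u⟫ = ⟪c i, d j 0⟫ := by
  have hmc : ∀ i, ⟪m, c i⟫ = 0 := fun i => by
    have hle : Submodule.span ℝ (Set.range nv) ≤ (ℝ ∙ m)ᗮ := by
      rw [Submodule.span_le]
      rintro _ ⟨k, rfl⟩
      exact Submodule.mem_orthogonal_singleton_iff_inner_right.mpr (hm_orth k)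
    exact Submodule.mem_orthogonal_singleton_iff_inner_right.mp (hle (hc_mem i))
  have hd_zero : ∀ i, d i 0 = ∑ j, h i j • c j := fun i => by simp [hd]
  have hinner : ∀ i j, ⟪d i 0, nv j⟫ = h i j := fun i j => by
    simp [hd_zero, sum_inner, real_inner_smul_left, hc_dual]
  have hm_zero : ∀ i, ⟪m, d i 0⟫ = 0 := fun i => by
    simp [hd_zero, inner_sum, real_inner_smul_right, hmc]
  have hmm : ⟪m, m⟫ = 1 := by rw [real_inner_self_eq_norm_sq, hm_unit, one_pow]
  intro i j hij u
  have hsq : lam i ^ 2 - lam j ^ 2 ≠ 0 := by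
    rw [sub_ne_zero, Ne, sq_eq_sq_iff_eq_or_eq_neg, not_or]
    exact hlam i j hij
  have key := flexion_identity hsq ⟪nv i, nv j⟫ u
  have hji := hhoff j i hij.symm
  rw [real_inner_comm] at hji
  rw [← hhoff i j hij, ← hji] at key
  rw [hd i u, hd j u, ← hd_zero i, ← hd_zero j]
  constructor
  · simp only [inner_add_left, inner_add_right, inner_sub_left, inner_sub_right,
      real_inner_smul_left, real_inner_smul_right, hm_zero, hm_orth, hmm, hinner,
      real_inner_comm m (d i 0), real_inner_comm m (nv i),
      real_inner_comm (d j 0) (nv i)]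
    linear_combination -key
  · simp only [inner_add_right, inner_sub_right, real_inner_smul_right, hc_dual, if_neg hij,
      real_inner_comm m (c i), hmc]
    ring
end

section
/- For all i ≠ j in {1,…,n}, the functions u ↦ ‖p_j − q_i(u)‖ and u ↦ ‖q_i(u) − q_j(u)‖ are constant on ℝ; that is, all edge lengths of the Euclidean cross-polytope with vertices p_1, …, p_n, q_1(u), …, q_n(u) (where p_i and q_i are the pairs of opposite vertices, not joined by an edge) remain constant during the deformation. -/
open scoped RealInnerProductSpace BigOperators

section Deformation

variable {E : Type*} [NormedAddCommGroup E] [InnerProductSpace ℝ E]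

/-- The inner product of `v` with a normalized weighted sum of points all of which except `p i` have
the same inner product `t` with `v`. -/
lemma inner_normalized_sum_of_eq_off {ι : Type*} [Fintype ι] [DecidableEq ι]
    (v : E) (p : ι → E) (w : ι → ℝ) (hw : ∑ k, w k ≠ 0) (i : ι) (t a : ℝ)
    (hv : ∀ k, ⟪v, p k⟫ = t + if k = i then a else 0) :
    ⟪v, (∑ k, w k)⁻¹ • ∑ k, w k • p k⟫ = t + (∑ k, w k)⁻¹ * (w i * a) := by
  simp only [inner_smul_right, inner_sum, hv, mul_add, Finset.sum_add_distrib, mul_ite, mul_zero,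
    Finset.sum_ite_eq', Finset.mem_univ, if_true, ← Finset.sum_mul]
  field_simp

/-- Squared length of `x - y` when `x` and `y` are displaced in the directions of unit vectors
`e`, `f` and of a unit vector `m` orthogonal to `e`, `f` and `x - y`. -/
lemma norm_sq_displaced_sub (x y e f m : E) (he : ‖e‖ = 1) (hf : ‖f‖ = 1) (hm : ‖m‖ = 1)
    (hme : ⟪m, e⟫ = 0) (hmf : ⟪m, f⟫ = 0) (hxy : ⟪m, x - y⟫ = 0) (r s a b c d : ℝ) :
    ‖(x + r • (b • m - a • e)) - (y + s • (d • m - c • f))‖ ^ 2 =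
      ‖x - y‖ ^ 2 - 2 * r * a * ⟪e, x - y⟫ + 2 * s * c * ⟪f, x - y⟫
        + r ^ 2 * (a ^ 2 + b ^ 2) + s ^ 2 * (c ^ 2 + d ^ 2)
        - 2 * r * s * (a * c * ⟪e, f⟫ + b * d) := by
  have hsplit : (x + r • (b • m - a • e)) - (y + s • (d • m - c • f)) =
      (x - y) + ((r * b - s * d) • m - (r * a) • e + (s * c) • f) := by module
  rw [hsplit]
  generalize x - y = z at *
  have hee : ⟪e, e⟫ = 1 := by simp [he]
  have hff : ⟪f, f⟫ = 1 := by simp [hf]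
  have hmm : ⟪m, m⟫ = 1 := by simp [hm]
  rw [← real_inner_self_eq_norm_sq, ← real_inner_self_eq_norm_sq]
  simp only [inner_add_left, inner_add_right, inner_sub_left, inner_sub_right, inner_smul_left,
    inner_smul_right, conj_trivial, real_inner_comm m e, real_inner_comm m f, real_inner_comm m z,
    real_inner_comm e z, real_inner_comm f z, real_inner_comm e f, hme, hmf, hxy, hee, hff, hmm]
  ring

end Deformation

/-- The coefficients of the deformation satisfy `a² + b² = 2 a`. -/
lemma deformation_coeff_sq (l u : ℝ) :
    (2 * l ^ 2 * u ^ 2 / (l ^ 2 * u ^ 2 + 1)) ^ 2 + (2 * l * u / (l ^ 2 * u ^ 2 + 1)) ^ 2 =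
      2 * (2 * l ^ 2 * u ^ 2 / (l ^ 2 * u ^ 2 + 1)) := by
  have : l ^ 2 * u ^ 2 + 1 ≠ 0 := by positivity
  field_simp

/-- The relation between the deformation coefficients of two different vertices. -/
lemma deformation_coeff_mul (x y g u : ℝ) (hxy : x ^ 2 - y ^ 2 ≠ 0) :
    (2 * x ^ 2 * u ^ 2 / (x ^ 2 * u ^ 2 + 1)) * (2 * y ^ 2 * u ^ 2 / (y ^ 2 * u ^ 2 + 1)) * g
      + (2 * x * u / (x ^ 2 * u ^ 2 + 1)) * (2 * y * u / (y ^ 2 * u ^ 2 + 1)) =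
    (2 * x ^ 2 * u ^ 2 / (x ^ 2 * u ^ 2 + 1)) * (2 * y * (y * g - x) / (y ^ 2 - x ^ 2))
      + (2 * y ^ 2 * u ^ 2 / (y ^ 2 * u ^ 2 + 1)) * (2 * x * (x * g - y) / (x ^ 2 - y ^ 2)) := by
  have h1 : x ^ 2 * u ^ 2 + 1 ≠ 0 := by positivity
  have h2 : y ^ 2 * u ^ 2 + 1 ≠ 0 := by positivity
  rw [← neg_sub (x ^ 2) (y ^ 2), div_neg]
  field_simp
  ring

/-- All edge lengths of the Euclidean cross-polytope of the simplest type
with opposite vertex pairs `p i`, `q i u` remain constant during the deformation. -/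
theorem euclidean_edge_lengths_const (n : ℕ) (hn : 2 ≤ n)
    (nv : Fin n → EuclideanSpace ℝ (Fin n))
    (m : EuclideanSpace ℝ (Fin n))
    (hnv_unit : ∀ i, ‖nv i‖ = 1)
    (hm_unit : ‖m‖ = 1)
    (hm_orth : ∀ i, ⟪m, nv i⟫ = 0)
    (lam : Fin n → ℝ)
    (hlam_ne : ∀ i, lam i ≠ 0)
    (hlam : ∀ i j : Fin n, i ≠ j → lam i ≠ lam j ∧ lam i ≠ -lam j)
    (h : Fin n → Fin n → ℝ)
    (hhdiag : ∀ i, h i i = 1)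
    (hhoff : ∀ i j : Fin n, i ≠ j →
      h i j = 2 * lam i * (lam i * ⟪nv i, nv j⟫ - lam j) / ((lam i) ^ 2 - (lam j) ^ 2))
    (p : Fin n → EuclideanSpace ℝ (Fin n))
    (hp_indep : AffineIndependent ℝ p)
    (cconst : ℝ)
    (hpm : ∀ j, ⟪p j, m⟫ = cconst)
    (hpn : ∀ i j k : Fin n, j ≠ i → k ≠ i → ⟪nv i, p j⟫ = ⟪nv i, p k⟫)
    (α : Fin n → ℝ)
    (hα : ∀ i j : Fin n, j ≠ i → α i = ⟪nv i, p i⟫ - ⟪nv i, p j⟫)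
    (hα_ne : ∀ i, α i ≠ 0)
    (hsum_ne : ∀ i, (∑ j, h i j / α j) ≠ 0)
    (β : Fin n → ℝ)
    (hβ : ∀ i, β i = (∑ j, h i j / α j)⁻¹)
    (q : Fin n → ℝ → EuclideanSpace ℝ (Fin n))
    (hq : ∀ (i : Fin n) (u : ℝ), q i u = β i • ((∑ j, (h i j / α j) • p j)
      - ((2 * (lam i) ^ 2 * u ^ 2) / ((lam i) ^ 2 * u ^ 2 + 1)) • nv i
      + ((2 * lam i * u) / ((lam i) ^ 2 * u ^ 2 + 1)) • m))
    :
    ∀ i j : Fin n, i ≠ j →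
      (∀ u : ℝ, ‖p j - q i u‖ = ‖p j - q i 0‖) ∧
      (∀ u : ℝ, ‖q i u - q j u‖ = ‖q i 0 - q j 0‖) := by
  intro i j hij
  have hD : lam i ^ 2 - lam j ^ 2 ≠ 0 := by
    rw [sq_sub_sq]
    exact mul_ne_zero (fun h0 => (hlam i j hij).2 (eq_neg_of_add_eq_zero_left h0))
      (sub_ne_zero.2 (hlam i j hij).1)
  obtain ⟨c, hc⟩ : ∃ c : Fin n → EuclideanSpace ℝ (Fin n),
      ∀ k, c k = β k • ∑ l, (h k l / α l) • p l := ⟨_, fun _ => rfl⟩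
  have hnp : ∀ k l : Fin n, l ≠ k → ∀ r,
      ⟪nv k, p r⟫ = ⟪nv k, p l⟫ + if r = k then α k else 0 := by
    intro k l hlk r
    split_ifs with hr
    · rw [hr, hα k l hlk]; ring
    · rw [add_zero, hpn k r l hr hlk]
  have hnc : ∀ k l : Fin n, l ≠ k → ∀ r, ⟪nv k, c r⟫ = ⟪nv k, p l⟫ + β r * h r k := by
    intro k l hlk r
    rw [hc, hβ, inner_normalized_sum_of_eq_off _ _ _ (hsum_ne r) k _ _ (hnp k l hlk),
      div_mul_cancel₀ _ (hα_ne k)]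
  have hmp : ∀ r, ⟪m, p r⟫ = cconst := fun r => by rw [real_inner_comm, hpm]
  have hmc : ∀ r, ⟪m, c r⟫ = cconst := by
    intro r
    rw [hc, hβ, inner_normalized_sum_of_eq_off _ _ _ (hsum_ne r) i cconst 0 (by simp [hmp])]
    ring
  have hq' : ∀ k u, q k u = c k + β k • ((2 * lam k * u / (lam k ^ 2 * u ^ 2 + 1)) • m
      - (2 * lam k ^ 2 * u ^ 2 / (lam k ^ 2 * u ^ 2 + 1)) • nv k) := by
    intro k u
    rw [hq, hc]
    module
  have hpq : ∀ u, ‖p j - q i u‖ ^ 2 = ‖c i - p j‖ ^ 2 := by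
    intro u
    have key := norm_sq_displaced_sub (c i) (p j) (nv i) (nv j) m (hnv_unit i) (hnv_unit j) hm_unit
      (hm_orth i) (hm_orth j) (by rw [inner_sub_right, hmc, hmp, sub_self]) (β i) 0
      (2 * lam i ^ 2 * u ^ 2 / (lam i ^ 2 * u ^ 2 + 1)) (2 * lam i * u / (lam i ^ 2 * u ^ 2 + 1))
      0 0
    rw [← hq', zero_smul, add_zero, deformation_coeff_sq, inner_sub_right (nv i),
      hnc i j hij.symm, hhdiag] at key
    rw [norm_sub_rev, key]
    ring
  have hqq : ∀ u, ‖q i u - q j u‖ ^ 2 = ‖c i - c j‖ ^ 2 := by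
    intro u
    rw [hq', hq', norm_sq_displaced_sub (c i) (c j) (nv i) (nv j) m (hnv_unit i) (hnv_unit j)
      hm_unit (hm_orth i) (hm_orth j) (by rw [inner_sub_right, hmc, hmc, sub_self]),
      deformation_coeff_sq, deformation_coeff_sq, deformation_coeff_mul _ _ _ _ hD,
      inner_sub_right (nv i), inner_sub_right (nv j), hnc i j hij.symm, hnc i j hij.symm,
      hnc j i hij, hnc j i hij, hhdiag, hhdiag, hhoff i j hij, hhoff j i hij.symm,
      real_inner_comm (nv i) (nv j)]
    ring
  refine ⟨fun u => ?_, fun u => ?_⟩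
  · rw [← sq_eq_sq₀ (norm_nonneg _) (norm_nonneg _), hpq, hpq]
  · rw [← sq_eq_sq₀ (norm_nonneg _) (norm_nonneg _), hqq, hqq]
end

section
/- For every i ∈ {1,…,n} and every u ∈ ℝ one has ‖p_i − q_i(u)‖² = ‖p_i − q_i(0)‖² + 4λ_i²u²·α_iβ_i/(λ_i²u²+1). In particular, the distance between the opposite vertices p_i and q_i(u) is a non-constant function of u, so the deformation u ↦ (p_1, …, p_n, q_1(u), …, q_n(u)) is a genuine flexion. -/
open scoped RealInnerProductSpace BigOperators

/-- Squared norm of `a + b • (s • v - t • w)`, where `v, w` are orthonormal, `a` is orthogonal to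
`w`, and `(s, t)` runs over the circle `s ^ 2 + t ^ 2 = 2 * s` in its rational parametrization. -/
lemma norm_sq_add_rational_rotation {E : Type*} [NormedAddCommGroup E] [InnerProductSpace ℝ E]
    (a v w : E) (hv : ‖v‖ = 1) (hw : ‖w‖ = 1) (hvw : ⟪w, v⟫ = 0) (haw : ⟪a, w⟫ = 0)
    (b l u : ℝ) :
    ‖a + b • (((2 * l ^ 2 * u ^ 2) / (l ^ 2 * u ^ 2 + 1)) • v
      - ((2 * l * u) / (l ^ 2 * u ^ 2 + 1)) • w)‖ ^ 2 =
      ‖a‖ ^ 2 + 4 * l ^ 2 * u ^ 2 * ((⟪a, v⟫ + b) * b) / (l ^ 2 * u ^ 2 + 1) := by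
  have hd : l ^ 2 * u ^ 2 + 1 ≠ 0 := by positivity
  have hvw' : ⟪v, w⟫ = 0 := by rw [real_inner_comm, hvw]
  rw [norm_add_sq_real, norm_smul, mul_pow, norm_sub_sq_real]
  simp only [inner_smul_left, inner_smul_right, inner_sub_right, norm_smul, hv, hw, hvw', haw,
    Real.norm_eq_abs, mul_one, sq_abs, mul_zero, sub_zero]
  field_simp
  ring

/-- If `p i` has height `α i` over the common level of the other points in direction `v`, then the
weighted barycentre of the `p j` with weights `c j / α j`, where `c i = 1`, lies at height
`(∑ j, c j / α j)⁻¹` over that level. -/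
lemma inner_sub_barycentre {ι E : Type*} [Fintype ι] [NormedAddCommGroup E]
    [InnerProductSpace ℝ E] (p : ι → E) (v : E) (α c : ι → ℝ) (i : ι)
    (hα : ∀ j, j ≠ i → α i = ⟪v, p i⟫ - ⟪v, p j⟫) (hαi : α i ≠ 0) (hc : c i = 1)
    (hS : ∑ j, c j / α j ≠ 0) :
    ⟪p i - (∑ j, c j / α j)⁻¹ • ∑ j, (c j / α j) • p j, v⟫ = α i - (∑ j, c j / α j)⁻¹ := by
  classical
  have hterm : ∀ j, c j / α j * ⟪v, p j⟫ =
      c j / α j * (⟪v, p i⟫ - α i) + if j = i then 1 else 0 := by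
    intro j
    by_cases hj : j = i
    · subst hj
      rw [if_pos rfl, hc]
      field_simp
      ring
    · rw [if_neg hj, hα j hj]
      ring
  have hsum : ∑ j, c j / α j * ⟪v, p j⟫ = (∑ j, c j / α j) * (⟪v, p i⟫ - α i) + 1 := by
    simp_rw [hterm]
    rw [Finset.sum_add_distrib, ← Finset.sum_mul]
    simp
  rw [real_inner_comm, inner_sub_right, inner_smul_right, inner_sum]
  simp_rw [inner_smul_right]
  rw [hsum]
  field_simp
  ring

/-- The squared distance between the opposite vertices `p i` and `q i u`
equals `‖p i - q i 0‖² + 4λᵢ²u²·αᵢβᵢ/(λᵢ²u²+1)`; in particular it is a non-constant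
function of `u`, so the deformation is a genuine flexion. -/
theorem euclidean_diagonal_formula (n : ℕ) (hn : 2 ≤ n)
    (nv : Fin n → EuclideanSpace ℝ (Fin n))
    (m : EuclideanSpace ℝ (Fin n))
    (hnv_unit : ∀ i, ‖nv i‖ = 1)
    (hm_unit : ‖m‖ = 1)
    (hm_orth : ∀ i, ⟪m, nv i⟫ = 0)
    (lam : Fin n → ℝ)
    (hlam_ne : ∀ i, lam i ≠ 0)
    (hlam : ∀ i j : Fin n, i ≠ j → lam i ≠ lam j ∧ lam i ≠ -lam j)
    (h : Fin n → Fin n → ℝ)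
    (hhdiag : ∀ i, h i i = 1)
    (hhoff : ∀ i j : Fin n, i ≠ j →
      h i j = 2 * lam i * (lam i * ⟪nv i, nv j⟫ - lam j) / ((lam i) ^ 2 - (lam j) ^ 2))
    (p : Fin n → EuclideanSpace ℝ (Fin n))
    (hp_indep : AffineIndependent ℝ p)
    (cconst : ℝ)
    (hpm : ∀ j, ⟪p j, m⟫ = cconst)
    (hpn : ∀ i j k : Fin n, j ≠ i → k ≠ i → ⟪nv i, p j⟫ = ⟪nv i, p k⟫)
    (α : Fin n → ℝ)
    (hα : ∀ i j : Fin n, j ≠ i → α i = ⟪nv i, p i⟫ - ⟪nv i, p j⟫)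
    (hα_ne : ∀ i, α i ≠ 0)
    (hsum_ne : ∀ i, (∑ j, h i j / α j) ≠ 0)
    (β : Fin n → ℝ)
    (hβ : ∀ i, β i = (∑ j, h i j / α j)⁻¹)
    (q : Fin n → ℝ → EuclideanSpace ℝ (Fin n))
    (hq : ∀ (i : Fin n) (u : ℝ), q i u = β i • ((∑ j, (h i j / α j) • p j)
      - ((2 * (lam i) ^ 2 * u ^ 2) / ((lam i) ^ 2 * u ^ 2 + 1)) • nv i
      + ((2 * lam i * u) / ((lam i) ^ 2 * u ^ 2 + 1)) • m))
    :
    (∀ (i : Fin n) (u : ℝ), ‖p i - q i u‖ ^ 2 =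
      ‖p i - q i 0‖ ^ 2 + 4 * (lam i) ^ 2 * u ^ 2 * (α i * β i) / ((lam i) ^ 2 * u ^ 2 + 1)) ∧
    (∀ i : Fin n, ¬ (∀ u v : ℝ, ‖p i - q i u‖ = ‖p i - q i v‖)) := by
  have key : ∀ (i : Fin n) (u : ℝ), ‖p i - q i u‖ ^ 2 =
      ‖p i - β i • ∑ j, (h i j / α j) • p j‖ ^ 2 +
        4 * (lam i) ^ 2 * u ^ 2 * (α i * β i) / ((lam i) ^ 2 * u ^ 2 + 1) := by
    intro i u
    have han := inner_sub_barycentre p (nv i) α (h i) i (fun j hj => hα i j hj) (hα_ne i)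
      (hhdiag i) (hsum_ne i)
    have ham : ⟪p i - β i • ∑ j, (h i j / α j) • p j, m⟫ = 0 := by
      rw [inner_sub_left, real_inner_smul_left, sum_inner]
      simp_rw [real_inner_smul_left, hpm]
      rw [← Finset.sum_mul, ← mul_assoc, hβ, inv_mul_cancel₀ (hsum_ne i), one_mul, sub_self]
    rw [← hβ] at han
    have hrot := norm_sq_add_rational_rotation _ (nv i) m (hnv_unit i) hm_unit (hm_orth i) ham
      (β i) (lam i) u
    rw [han, sub_add_cancel] at hrot
    rw [← hrot, hq]
    congr 2
    module
  have formula : ∀ (i : Fin n) (u : ℝ), ‖p i - q i u‖ ^ 2 =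
      ‖p i - q i 0‖ ^ 2 +
        4 * (lam i) ^ 2 * u ^ 2 * (α i * β i) / ((lam i) ^ 2 * u ^ 2 + 1) := by
    intro i u
    rw [key i u, key i 0]
    simp
  refine ⟨formula, fun i hconst => ?_⟩
  have h1 := formula i 1
  rw [hconst 1 0, left_eq_add] at h1
  have hβ_ne : β i ≠ 0 := hβ i ▸ inv_ne_zero (hsum_ne i)
  have hl := hlam_ne i
  have ha := hα_ne i
  have hne : 4 * (lam i) ^ 2 * 1 ^ 2 * (α i * β i) / ((lam i) ^ 2 * 1 ^ 2 + 1) ≠ 0 := by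
    positivity
  exact hne h1
end

section
/- Assume in addition that 0 < λ_1 < ⋯ < λ_n and that for every partition [n] = A ⊔ B into disjoint subsets the n points {p_i : i ∈ A} ∪ {q_j(0) : j ∈ B} are affinely independent. For a partition [n] = A ⊔ B let V_{A,B}(u) denote the (n−1)-dimensional Hausdorff measure of the convex hull of {p_i : i ∈ A} ∪ {q_j(u) : j ∈ B}, and set Y_+ = {i ∈ [n] : α_iβ_i > 0} and Y_− = {i ∈ [n] : α_iβ_i < 0}. Then for every u ∈ ℝ: Σ_{A⊔B=[n]} (−1)^{|B∩Y_+|} V_{A,B}(u) = 0 and Σ_{A⊔B=[n]} (−1)^{|B∩Y_−|} V_{A,B}(u) = 0 (the sums are over all 2^n partitions of [n] = {1,…,n}). -/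
open scoped RealInnerProductSpace BigOperators
open MeasureTheory
open scoped Matrix

section Determinants

open Matrix

variable {ι : Type*} [Fintype ι] [DecidableEq ι]

/-- A real matrix, not necessarily symmetric, whose quadratic form is positive has positive
determinant. -/
theorem Matrix.det_pos_of_dotProduct_mulVec_pos (N : Matrix ι ι ℝ)
    (hN : ∀ x : ι → ℝ, x ≠ 0 → 0 < x ⬝ᵥ N *ᵥ x) : 0 < N.det := by
  let f : ℝ → ℝ := fun r => ((1 - r) • (1 : Matrix ι ι ℝ) + r • N).det
  have hf : Continuous f := by
    refine Continuous.matrix_det ?_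
    fun_prop
  have hne : ∀ r ∈ Set.Icc (0 : ℝ) 1, f r ≠ 0 := by
    rintro r ⟨hr0, hr1⟩ h0
    obtain ⟨x, hx, hx0⟩ := Matrix.exists_mulVec_eq_zero_iff.mpr h0
    have h1 : 0 < x ⬝ᵥ x := by
      simpa using (Matrix.dotProduct_star_self_pos_iff (v := x)).mpr hx
    have h2 := hN x hx
    have h3 : (1 - r) * (x ⬝ᵥ x) + r * (x ⬝ᵥ N *ᵥ x) = 0 := by
      have := congrArg (fun y => x ⬝ᵥ y) hx0
      simpa [Matrix.add_mulVec, Matrix.smul_mulVec, dotProduct_add] using this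
    rcases eq_or_lt_of_le hr0 with rfl | hr
    · simp at h3
      exact hx h3
    · nlinarith [mul_pos hr h2, mul_nonneg (sub_nonneg.mpr hr1) h1.le]
  by_contra! hle
  have h0 : f 0 = 1 := by simp [f]
  have h1 : f 1 = N.det := by simp [f]
  obtain ⟨r, hr, hr0⟩ := intermediate_value_Icc' (zero_le_one' ℝ) hf.continuousOn
    (show (0 : ℝ) ∈ Set.Icc (f 1) (f 0) by rw [h0, h1]; exact ⟨hle, zero_le_one⟩)
  exact hne r hr hr0

/-- If the quadratic form of `H` is nonnegative, then replacing some rows of `H` by the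
corresponding rows of the identity matrix gives a matrix with nonnegative determinant. -/
theorem Matrix.det_piecewise_one_nonneg (H : Matrix ι ι ℝ)
    (hH : ∀ x : ι → ℝ, 0 ≤ x ⬝ᵥ H *ᵥ x) (A : Finset ι) :
    0 ≤ (Matrix.of fun i j => if i ∈ A then (1 : Matrix ι ι ℝ) i j else H i j).det := by
  let d : ℝ → ι → ℝ := fun s i => if i ∈ A then s else 1
  let e : ι → ℝ := fun i => if i ∈ A then 1 else 0
  let K : ℝ → Matrix ι ι ℝ := fun s => diagonal (d s) * (H + s • 1) + diagonal e
  have hd : Continuous d := by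
    refine continuous_pi fun i => ?_
    by_cases hi : i ∈ A <;> simp only [d, hi, if_true, if_false] <;> fun_prop
  have hK : Continuous fun s => (K s).det := by
    refine Continuous.matrix_det ?_
    refine ((hd.matrix_diagonal).matrix_mul ?_).add continuous_const
    fun_prop
  have hK0 : K 0 = Matrix.of fun i j => if i ∈ A then (1 : Matrix ι ι ℝ) i j else H i j := by
    ext i j
    by_cases hi : i ∈ A <;> simp [K, d, e, hi, diagonal_apply, one_apply]
  rw [← hK0]
  refine ge_of_tendsto (hK.continuousWithinAt (s := Set.Ioi 0) (x := 0)) ?_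
  filter_upwards [self_mem_nhdsWithin] with s hs
  have hs : 0 < s := hs
  have hfac : K s = diagonal (d s) * (H + s • 1 + diagonal fun i => e i / s) := by
    ext i j
    by_cases hi : i ∈ A <;> simp [K, d, e, hi, diagonal_apply]
    split_ifs <;> field_simp
    simp
  rw [hfac, det_mul, det_diagonal]
  refine mul_nonneg (Finset.prod_nonneg fun i _ => ?_)
    (Matrix.det_pos_of_dotProduct_mulVec_pos _ fun x hx => ?_).le
  · simp only [d]; split_ifs <;> linarith
  · have h1 : 0 < x ⬝ᵥ x := by
      simpa using (Matrix.dotProduct_star_self_pos_iff (v := x)).mpr hx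
    have h2 : 0 ≤ x ⬝ᵥ (diagonal fun i => e i / s) *ᵥ x := by
      simp only [dotProduct, mulVec_diagonal]
      refine Finset.sum_nonneg fun i _ => ?_
      have : 0 ≤ e i / s := div_nonneg (by simp only [e]; split_ifs <;> simp) hs.le
      nlinarith [mul_nonneg this (mul_self_nonneg (x i))]
    have h3 : x ⬝ᵥ (H + s • 1 + diagonal fun i => e i / s) *ᵥ x
        = x ⬝ᵥ H *ᵥ x + s * (x ⬝ᵥ x) + x ⬝ᵥ (diagonal fun i => e i / s) *ᵥ x := by
      simp [Matrix.add_mulVec, Matrix.smul_mulVec, dotProduct_add]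
    rw [h3]
    nlinarith [mul_pos hs h1, hH x]

/-- Expansion of `det (1 + D T)`, with `D` diagonal, over the subsets of rows taken
from `1`. -/
theorem Matrix.sum_prod_mul_det_piecewise_one {R : Type*} [CommRing R] (c : ι → R)
    (T : Matrix ι ι R) :
    ∑ A : Finset ι, (∏ i ∈ Aᶜ, c i) *
        (Matrix.of fun i j => if i ∈ A then (1 : Matrix ι ι R) i j else T i j).det
      = (1 + diagonal c * T).det := by
  have h := (Matrix.detRowAlternating (R := R) (n := ι)).map_add_univ (1 : Matrix ι ι R)
    (diagonal c * T)
  change (1 + diagonal c * T).det = _ at h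
  rw [h]
  refine Finset.sum_congr rfl fun A _ => ?_
  have hc : (∏ i ∈ Aᶜ, c i) = ∏ i, (if i ∈ A then 1 else c i) := by
    rw [Finset.prod_ite]
    simp [Finset.filter_not, Finset.compl_eq_univ_sdiff]
  rw [hc, ← Matrix.det_mul_column]
  change _ = Matrix.det _
  congr 1
  ext i j
  by_cases hi : i ∈ A <;> simp [hi, Finset.piecewise]

end Determinants

section InnerProduct

/-- The points of an affinely independent family in a hyperplane with unit normal `m`, translated
so that one of them becomes `m`, are linearly independent. -/
theorem linearIndependent_sub_add_of_affineIndependent {ι E : Type*} [Fintype ι]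
    [NormedAddCommGroup E] [InnerProductSpace ℝ E] (p : ι → E) (hp : AffineIndependent ℝ p)
    (m : E) (hm : ‖m‖ = 1) (c : ℝ) (hpm : ∀ j, ⟪p j, m⟫ = c) (i₀ : ι) :
    LinearIndependent ℝ fun i => p i - p i₀ + m := by
  rw [Fintype.linearIndependent_iff]
  intro w hw
  have hsum : ∑ i, w i = 0 := by
    have := congrArg (fun v => ⟪v, m⟫) hw
    simpa [sum_inner, inner_smul_left, inner_add_left, inner_sub_left, hpm, hm] using this
  have hcomb : ∑ i, w i • p i = 0 := by
    have : ∑ i, w i • (p i - p i₀ + m) = ∑ i, w i • p i + (∑ i, w i) • (m - p i₀) := by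
      rw [Finset.sum_smul, ← Finset.sum_add_distrib]
      exact Finset.sum_congr rfl fun i _ => by module
    rwa [this, hsum, zero_smul, add_zero] at hw
  exact fun i => affineIndependent_iff.mp hp Finset.univ w hsum hcomb i (Finset.mem_univ i)

/-- Rotating a point `x` in the plane of `n₁`, `m` and a point `y` in the plane of `n₂`, `m`
preserves their distance under the compatibility condition `hst` on the two rotations. -/
theorem dist_add_smul_sub_eq {E : Type*} [NormedAddCommGroup E] [InnerProductSpace ℝ E]
    (x y m n₁ n₂ : E) (hm : ‖m‖ = 1) (hn₁ : ‖n₁‖ = 1) (hn₂ : ‖n₂‖ = 1)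
    (hmn₁ : ⟪m, n₁⟫ = 0) (hmn₂ : ⟪m, n₂⟫ = 0) (hxy : ⟪x - y, m⟫ = 0)
    (b₁ b₂ s₁ s₂ t₁ t₂ h₁₂ h₂₁ : ℝ)
    (h₁ : ⟪x - y, n₁⟫ = b₁ - b₂ * h₂₁) (h₂ : ⟪x - y, n₂⟫ = b₁ * h₁₂ - b₂)
    (hst₁ : s₁ ^ 2 + t₁ ^ 2 = 2 * s₁) (hst₂ : s₂ ^ 2 + t₂ ^ 2 = 2 * s₂)
    (hst : s₁ * h₂₁ + s₂ * h₁₂ = s₁ * s₂ * ⟪n₁, n₂⟫ + t₁ * t₂) :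
    dist (x + b₁ • (t₁ • m - s₁ • n₁)) (y + b₂ • (t₂ • m - s₂ • n₂)) = dist x y := by
  rw [← mul_self_inj dist_nonneg dist_nonneg, dist_eq_norm, dist_eq_norm,
    ← real_inner_self_eq_norm_mul_norm, ← real_inner_self_eq_norm_mul_norm]
  have hm' : ⟪m, m⟫ = 1 := by simp [hm]
  have hn₁' : ⟪n₁, n₁⟫ = 1 := by simp [hn₁]
  have hn₂' : ⟪n₂, n₂⟫ = 1 := by simp [hn₂]
  have hrw : x + b₁ • (t₁ • m - s₁ • n₁) - (y + b₂ • (t₂ • m - s₂ • n₂))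
      = (x - y) + (b₁ * t₁ - b₂ * t₂) • m - (b₁ * s₁) • n₁ + (b₂ * s₂) • n₂ := by module
  rw [hrw]
  generalize x - y = z at *
  have hnm₁ : ⟪n₁, m⟫ = 0 := by rwa [real_inner_comm]
  have hnm₂ : ⟪n₂, m⟫ = 0 := by rwa [real_inner_comm]
  simp only [inner_add_left, inner_add_right, inner_sub_left, inner_sub_right,
    real_inner_smul_left, real_inner_smul_right, real_inner_comm z, real_inner_comm n₁ n₂,
    hm', hn₁', hn₂', hmn₁, hmn₂, hnm₁, hnm₂, hxy, h₁, h₂]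
  linear_combination b₁ ^ 2 * hst₁ + b₂ ^ 2 * hst₂ + 2 * b₁ * b₂ * hst

end InnerProduct

section HausdorffMeasure

/-- A map that does not expand distances relative to another one does not increase
Hausdorff measures of images relative to it. -/
theorem hausdorffMeasure_image_le_of_dist_le {X Y Z : Type*} [MetricSpace Y]
    [MeasurableSpace Y] [BorelSpace Y] [MetricSpace Z] [MeasurableSpace Z] [BorelSpace Z]
    {d : ℝ} (hd : 0 ≤ d) (f : X → Y) (g : X → Z) (s : Set X)
    (hfg : ∀ x ∈ s, ∀ y ∈ s, dist (f x) (f y) ≤ dist (g x) (g y)) :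
    μH[d] (f '' s) ≤ μH[d] (g '' s) := by
  rcases s.eq_empty_or_nonempty with rfl | ⟨x₀, hx₀⟩
  · simp
  have hinv : ∀ z : Z, ∃ x, z ∈ g '' s → x ∈ s ∧ g x = z := by
    intro z
    by_cases hz : z ∈ g '' s
    · obtain ⟨x, hx⟩ := hz
      exact ⟨x, fun _ => hx⟩
    · exact ⟨x₀, fun h => absurd h hz⟩
  choose r hr using hinv
  have hlip : LipschitzOnWith 1 (f ∘ r) (g '' s) := by
    refine LipschitzOnWith.of_dist_le_mul fun a ha b hb => ?_
    have := hfg _ (hr a ha).1 _ (hr b hb).1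
    simpa [(hr a ha).2, (hr b hb).2] using this
  have himage : f '' s ⊆ (f ∘ r) '' (g '' s) := by
    rintro _ ⟨x, hx, rfl⟩
    have hz := hr (g x) ⟨x, hx, rfl⟩
    refine ⟨g x, ⟨x, hx, rfl⟩, dist_le_zero.mp ?_⟩
    simpa [hz.2] using hfg _ hz.1 x hx
  calc μH[d] (f '' s) ≤ μH[d] ((f ∘ r) '' (g '' s)) := measure_mono himage
    _ ≤ μH[d] (g '' s) := by simpa using hlip.hausdorffMeasure_image_le hd

theorem convexHull_range_eq_image_stdSimplex {ι E : Type*} [Fintype ι] [AddCommGroup E]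
    [Module ℝ E] (x : ι → E) :
    convexHull ℝ (Set.range x) = (fun w : ι → ℝ => ∑ i, w i • x i) '' stdSimplex ℝ ι := by
  classical
  rw [← convexHull_basis_eq_stdSimplex]
  have h := (Fintype.linearCombination ℝ x).image_convexHull
    (Set.range fun i j : ι => if i = j then (1 : ℝ) else 0)
  rw [← Set.range_comp] at h
  convert! h.symm using 3
  ext i
  simp [Fintype.linearCombination_apply]

variable {ι E : Type*} [Fintype ι] [NormedAddCommGroup E] [InnerProductSpace ℝ E]
  [MeasurableSpace E] [BorelSpace E]

/-- The Hausdorff measures of a (possibly degenerate) simplex depend only on its edge lengths. -/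
theorem hausdorffMeasure_convexHull_range_congr {d : ℝ} (hd : 0 ≤ d) (x y : ι → E)
    (hxy : ∀ i j, dist (x i) (x j) = dist (y i) (y j)) :
    μH[d] (convexHull ℝ (Set.range x)) = μH[d] (convexHull ℝ (Set.range y)) := by
  have hdist : ∀ v ∈ stdSimplex ℝ ι, ∀ w ∈ stdSimplex ℝ ι,
      dist (∑ i, v i • x i) (∑ i, w i • x i) = dist (∑ i, v i • y i) (∑ i, w i • y i) := by
    intro v hv w hw
    have hx := EuclideanGeometry.dist_affineCombination x hv.2 hw.2
    have hy := EuclideanGeometry.dist_affineCombination y hv.2 hw.2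
    simp only [Finset.affineCombination_eq_linear_combination _ _ _ hv.2,
      Finset.affineCombination_eq_linear_combination _ _ _ hw.2] at hx hy
    simp only [hxy] at hx
    rw [← hy] at hx
    exact (mul_self_inj dist_nonneg dist_nonneg).mp hx
  rw [convexHull_range_eq_image_stdSimplex, convexHull_range_eq_image_stdSimplex]
  exact le_antisymm
    (hausdorffMeasure_image_le_of_dist_le hd _ _ _ fun v hv w hw => (hdist v hv w hw).le)
    (hausdorffMeasure_image_le_of_dist_le hd _ _ _ fun v hv w hw => (hdist v hv w hw).ge)

variable [FiniteDimensional ℝ E]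

/-- A linear endomorphism inducing the identity modulo a subspace `W` multiplies the
`finrank W`-dimensional Hausdorff measure of subsets of translates of `W` by the absolute value
of its determinant. -/
theorem hausdorffMeasure_image_linearMap_of_sub_mem (W : Submodule ℝ E) (f : E →ₗ[ℝ] E)
    (hf : ∀ v, f v - v ∈ W) (v₀ : E) (S : Set E) (hS : ∀ v ∈ S, v - v₀ ∈ W) :
    μH[(Module.finrank ℝ W : ℝ)] (f '' S)
      = ENNReal.ofReal |LinearMap.det f| * μH[(Module.finrank ℝ W : ℝ)] S := by
  have hW : W ≤ W.comap f := fun w hw => by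
    simpa using W.add_mem (hf w) hw
  have hdet : LinearMap.det f = LinearMap.det (f.restrict hW) := by
    have hq : W.mapQ W f hW = LinearMap.id := by
      ext v
      simpa [Submodule.Quotient.eq] using hf v
    rw [LinearMap.det_eq_det_mul_det W f hW, hq, LinearMap.det_id, mul_one]
  let T : Set W := {w | v₀ + w ∈ S}
  have hiso : ∀ a : E, Isometry fun w : W => a + (w : E) := fun a =>
    (IsometryEquiv.addLeft a).isometry.comp W.subtypeₗᵢ.isometry
  have hST : S = (fun w : W => v₀ + (w : E)) '' T := by
    ext v
    refine ⟨fun hv => ⟨⟨v - v₀, hS v hv⟩, by simpa [T] using hv, by simp⟩, ?_⟩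
    rintro ⟨w, hw, rfl⟩
    exact hw
  have hfST : f '' S = (fun w : W => f v₀ + (w : E)) '' (f.restrict hW '' T) := by
    rw [hST, Set.image_image, Set.image_image]
    simp
  have hd : (0 : ℝ) ≤ Module.finrank ℝ W := Nat.cast_nonneg _
  rw [hfST, (hiso _).hausdorffMeasure_image (Or.inl hd), hdet, hST,
    (hiso _).hausdorffMeasure_image (Or.inl hd)]
  exact Measure.addHaar_image_linearMap _ _ _

/-- The volume of a simplex whose vertices have barycentric coordinates `M` with respect to a
nondegenerate simplex in a hyperplane is `|det M|` times the volume of the latter. -/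
theorem hausdorffMeasure_convexHull_range_sum_smul [DecidableEq ι] [Nonempty ι]
    (hcard : Fintype.card ι = Module.finrank ℝ E) (p : ι → E) (hp : AffineIndependent ℝ p)
    (m : E) (hm : ‖m‖ = 1) (c : ℝ) (hpm : ∀ j, ⟪p j, m⟫ = c)
    (M : Matrix ι ι ℝ) (hM : ∀ i, ∑ j, M i j = 1) :
    μH[(Fintype.card ι : ℝ) - 1] (convexHull ℝ (Set.range fun i => ∑ j, M i j • p j))
      = ENNReal.ofReal |M.det| * μH[(Fintype.card ι : ℝ) - 1] (convexHull ℝ (Set.range p)) := by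
  obtain ⟨i₀⟩ := ‹Nonempty ι›
  let b := basisOfLinearIndependentOfCardEqFinrank
    (linearIndependent_sub_add_of_affineIndependent p hp m hm c hpm i₀) hcard
  have hb : ∀ i, b i = p i - p i₀ + m := fun i => by simp [b]
  let f := Matrix.toLin b b M.transpose
  have hfb : ∀ i, f (b i) = ∑ j, M i j • b j := fun i => by
    simp [f, Matrix.toLin_self]
  have hbm : ∀ i, ⟪m, b i⟫ = 1 := fun i => by
    rw [hb, real_inner_comm]
    simp [inner_add_left, inner_sub_left, hpm, hm]
  have hfm : ∀ v, f v - v ∈ (ℝ ∙ m)ᗮ := by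
    intro v
    rw [Submodule.mem_orthogonal_singleton_iff_inner_right, inner_sub_right, sub_eq_zero]
    have : (innerₛₗ ℝ m) ∘ₗ f = innerₛₗ ℝ m := b.ext fun i => by
      simp [hfb, inner_sum, inner_smul_right, hbm, hM]
    exact congrArg (fun g => g v) this
  have hrank : (Module.finrank ℝ (ℝ ∙ m)ᗮ : ℝ) = (Fintype.card ι : ℝ) - 1 := by
    have h1 := (ℝ ∙ m).finrank_add_finrank_orthogonal
    rw [finrank_span_singleton (by rintro rfl; simp at hm), ← hcard] at h1
    rw [← h1]
    push_cast
    ring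
  have htrans : ∀ x : ι → E, μH[(Fintype.card ι : ℝ) - 1] (convexHull ℝ (Set.range x))
      = μH[(Fintype.card ι : ℝ) - 1] (convexHull ℝ (Set.range fun i => x i - p i₀ + m)) := by
    intro x
    refine hausdorffMeasure_convexHull_range_congr ?_ _ _ fun i j => by simp
    rw [← hrank]
    exact Nat.cast_nonneg _
  have hrange : (Set.range fun i => ∑ j, M i j • p j - p i₀ + m)
      = f '' Set.range fun i => p i - p i₀ + m := by
    rw [← Set.range_comp]
    congr 1
    ext1 i
    rw [Function.comp_apply, ← hb, hfb]
    simp only [hb, smul_add, smul_sub, Finset.sum_add_distrib, Finset.sum_sub_distrib,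
      ← Finset.sum_smul, hM, one_smul]
  rw [htrans, htrans p, hrange, ← f.image_convexHull, ← hrank,
    hausdorffMeasure_image_linearMap_of_sub_mem _ f hfm m]
  · simp [f, LinearMap.det_toLin]
  · have hsub : (Set.range fun i => p i - p i₀ + m) ⊆ {v | ⟪m, v⟫ = 1} := by
      rintro _ ⟨i, rfl⟩
      simpa [hb] using hbm i
    intro v hv
    rw [Submodule.mem_orthogonal_singleton_iff_inner_right, inner_sub_right]
    have := convexHull_min hsub (convex_hyperplane (innerₛₗ ℝ m).isLinear 1) hv
    simp [Set.mem_ofPred_eq.mp this, hm]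

end HausdorffMeasure

/-- the alternating sums of the `(n-1)`-dimensional volumes of the facets
of a flexible cross-polytope of the simplest type in Euclidean space, with signs given
by the sets `Y₊ = {i : αᵢβᵢ > 0}` and `Y₋ = {i : αᵢβᵢ < 0}`, vanish identically. -/
theorem euclidean_facet_volume_relation (n : ℕ) (hn : 2 ≤ n)
    (nv : Fin n → EuclideanSpace ℝ (Fin n))
    (m : EuclideanSpace ℝ (Fin n))
    (hnv_unit : ∀ i, ‖nv i‖ = 1)
    (hm_unit : ‖m‖ = 1)
    (hm_orth : ∀ i, ⟪m, nv i⟫ = 0)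
    (lam : Fin n → ℝ)
    (hlam_ne : ∀ i, lam i ≠ 0)
    (hlam : ∀ i j : Fin n, i ≠ j → lam i ≠ lam j ∧ lam i ≠ -lam j)
    (h : Fin n → Fin n → ℝ)
    (hhdiag : ∀ i, h i i = 1)
    (hhoff : ∀ i j : Fin n, i ≠ j →
      h i j = 2 * lam i * (lam i * ⟪nv i, nv j⟫ - lam j) / ((lam i) ^ 2 - (lam j) ^ 2))
    (p : Fin n → EuclideanSpace ℝ (Fin n))
    (hp_indep : AffineIndependent ℝ p)
    (cconst : ℝ)
    (hpm : ∀ j, ⟪p j, m⟫ = cconst)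
    (hpn : ∀ i j k : Fin n, j ≠ i → k ≠ i → ⟪nv i, p j⟫ = ⟪nv i, p k⟫)
    (α : Fin n → ℝ)
    (hα : ∀ i j : Fin n, j ≠ i → α i = ⟪nv i, p i⟫ - ⟪nv i, p j⟫)
    (hα_ne : ∀ i, α i ≠ 0)
    (hsum_ne : ∀ i, (∑ j, h i j / α j) ≠ 0)
    (β : Fin n → ℝ)
    (hβ : ∀ i, β i = (∑ j, h i j / α j)⁻¹)
    (q : Fin n → ℝ → EuclideanSpace ℝ (Fin n))
    (hq : ∀ (i : Fin n) (u : ℝ), q i u = β i • ((∑ j, (h i j / α j) • p j)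
      - ((2 * (lam i) ^ 2 * u ^ 2) / ((lam i) ^ 2 * u ^ 2 + 1)) • nv i
      + ((2 * lam i * u) / ((lam i) ^ 2 * u ^ 2 + 1)) • m))
    (hlam_pos : ∀ i, 0 < lam i)
    (hlam_mono : StrictMono lam)
    (hindep : ∀ A : Finset (Fin n),
      AffineIndependent ℝ (fun i : Fin n => if i ∈ A then p i else q i 0)) :
    ∀ u : ℝ,
      (∑ A : Finset (Fin n),
        (-1 : ℝ) ^ ((Aᶜ ∩ Finset.univ.filter (fun i => 0 < α i * β i)).card) *
          (μH[(n : ℝ) - 1] (convexHull ℝ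
            (p '' ↑A ∪ (fun j => q j u) '' ↑(Aᶜ)))).toReal) = 0 ∧
      (∑ A : Finset (Fin n),
        (-1 : ℝ) ^ ((Aᶜ ∩ Finset.univ.filter (fun i => α i * β i < 0)).card) *
          (μH[(n : ℝ) - 1] (convexHull ℝ
            (p '' ↑A ∪ (fun j => q j u) '' ↑(Aᶜ)))).toReal) = 0 := by
  have hne : Nonempty (Fin n) := ⟨⟨0, by omega⟩⟩
  have hβ_ne : ∀ i, β i ≠ 0 := fun i => by rw [hβ]; exact inv_ne_zero (hsum_ne i)
  have hrow : ∀ i, ∑ j, h i j / α j = (β i)⁻¹ := fun i => by rw [hβ, inv_inv]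
  -- Inner products of the normals with the vertices.
  obtain ⟨γ, hnp⟩ : ∃ γ : Fin n → ℝ, ∀ i k, ⟪nv i, p k⟫ = γ i + if k = i then α i else 0 := by
    have hex : ∀ i : Fin n, ∃ j, j ≠ i := fun i => by
      have : Nontrivial (Fin n) := Fin.nontrivial_iff_two_le.mpr hn
      exact exists_ne i
    choose o ho using hex
    refine ⟨fun i => ⟪nv i, p (o i)⟫, fun i k => ?_⟩
    split_ifs with hk
    · rw [hk, hα i (o i) (ho i)]; ring
    · rw [add_zero, hpn i k (o i) hk (ho i)]
  have hnq : ∀ i j, ⟪nv i, β j • ∑ k, (h j k / α k) • p k⟫ = γ i + β j * h j i := by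
    intro i j
    have h1 : ∑ k, h j k / α k * ⟪nv i, p k⟫ = (∑ k, h j k / α k) * γ i + h j i := by
      simp_rw [hnp, mul_add, Finset.sum_add_distrib, Finset.sum_mul]
      simp [hα_ne]
    rw [inner_smul_right, inner_sum]
    simp_rw [inner_smul_right]
    rw [h1, hrow]
    field_simp [hβ_ne j]
  have hqm : ∀ j, ⟪β j • ∑ k, (h j k / α k) • p k, m⟫ = cconst := by
    intro j
    rw [real_inner_smul_left, sum_inner]
    simp_rw [real_inner_smul_left, hpm]
    rw [← Finset.sum_mul, hrow]
    field_simp [hβ_ne j]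
  have hlam_sq : ∀ i j, i ≠ j → lam i ^ 2 - lam j ^ 2 ≠ 0 := by
    intro i j hij
    rw [sq_sub_sq]
    exact mul_ne_zero (fun h0 => (hlam i j hij).2 (by linarith))
      (sub_ne_zero.mpr (hlam i j hij).1)
  -- The symmetric part of `h` is the Gram matrix of the normals.
  have hsymm : ∀ i j, h i j + h j i = 2 * ⟪nv i, nv j⟫ := by
    intro i j
    by_cases hij : i = j
    · subst hij
      rw [hhdiag, real_inner_self_eq_norm_sq, hnv_unit]; norm_num
    · have hne := hlam_sq i j hij
      have hne' := hlam_sq j i (Ne.symm hij)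
      rw [hhoff i j hij, hhoff j i (Ne.symm hij), real_inner_comm (nv i) (nv j),
        div_add_div _ _ hne hne', div_eq_iff (mul_ne_zero hne hne')]
      ring
  let H : Matrix (Fin n) (Fin n) ℝ := Matrix.of h
  have hH : ∀ x : Fin n → ℝ, 0 ≤ x ⬝ᵥ H *ᵥ x := by
    intro x
    have h1 : x ⬝ᵥ H *ᵥ x = ∑ i, ∑ j, x i * x j * h i j := by
      simp only [dotProduct, Matrix.mulVec, Finset.mul_sum, H, Matrix.of_apply]
      exact Finset.sum_congr rfl fun i _ => Finset.sum_congr rfl fun j _ => by ring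
    have h2 : ⟪∑ i, x i • nv i, ∑ i, x i • nv i⟫ = ∑ i, ∑ j, x i * x j * ⟪nv i, nv j⟫ := by
      simp only [sum_inner, inner_sum, real_inner_smul_left, real_inner_smul_right]
      exact Finset.sum_congr rfl fun i _ => Finset.sum_congr rfl fun j _ => by
        rw [real_inner_comm]; ring
    have h3 : x ⬝ᵥ H *ᵥ x = ∑ i, ∑ j, x i * x j * h j i := by
      rw [h1, Finset.sum_comm]
      exact Finset.sum_congr rfl fun i _ => Finset.sum_congr rfl fun j _ => by ring
    have h4 : x ⬝ᵥ H *ᵥ x + x ⬝ᵥ H *ᵥ x = 2 * ⟪∑ i, x i • nv i, ∑ i, x i • nv i⟫ := by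
      rw [h2]
      nth_rewrite 1 [h1]
      rw [h3, ← Finset.sum_add_distrib, Finset.mul_sum]
      refine Finset.sum_congr rfl fun i _ => ?_
      rw [← Finset.sum_add_distrib, Finset.mul_sum]
      refine Finset.sum_congr rfl fun j _ => ?_
      linear_combination x i * x j * hsymm i j
    have h5 := real_inner_self_nonneg (x := ∑ i, x i • nv i)
    linarith
  -- The normals satisfy a linear relation with coefficients `1 / α j`.
  have hnv_sum : ∑ j, (α j)⁻¹ • nv j = 0 := by
    let b := basisOfLinearIndependentOfCardEqFinrank
      (linearIndependent_sub_add_of_affineIndependent p hp_indep m hm_unit cconst hpm hne.some)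
      (by simp)
    refine InnerProductSpace.ext_inner_right_basis b fun i => ?_
    have hnm : ∀ j, ⟪nv j, m⟫ = 0 := fun j => by rw [real_inner_comm, hm_orth]
    simp [b, sum_inner, real_inner_smul_left, inner_add_right, inner_sub_right, hnp, hnm,
      mul_add, Finset.sum_add_distrib, hα_ne]
  have hcol : ∀ j, ∑ i, h i j / α i = -(β j)⁻¹ := by
    intro j
    have h1 : ∑ i, (h j i / α i + h i j / α i) = 0 := by
      have h2 := congrArg (fun v => 2 * ⟪nv j, v⟫) hnv_sum
      simp only [inner_sum, real_inner_smul_right, inner_zero_right, mul_zero, Finset.mul_sum] at h2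
      rw [← h2]
      refine Finset.sum_congr rfl fun i _ => ?_
      rw [← add_div, hsymm]
      ring
    rw [Finset.sum_add_distrib, hrow] at h1
    linarith
  have hdet_sub : (1 + Matrix.diagonal (fun i => -(β i / α i)) * H).det = 0 := by
    refine Matrix.exists_mulVec_eq_zero_iff.mp ⟨fun i => (α i)⁻¹, fun h0 => ?_, ?_⟩
    · exact inv_ne_zero (hα_ne hne.some) (congrFun h0 hne.some)
    · ext i
      have h1 : (H *ᵥ fun i => (α i)⁻¹) i = (β i)⁻¹ := by
        rw [← hrow]; simp [Matrix.mulVec, dotProduct, H, div_eq_mul_inv]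
      rw [Matrix.add_mulVec, Matrix.one_mulVec, ← Matrix.mulVec_mulVec, Pi.add_apply,
        Matrix.mulVec_diagonal, h1]
      field_simp [hβ_ne i, hα_ne i]
      simp
  have hdet_add : (1 + Matrix.diagonal (fun i => β i / α i) * H).det = 0 := by
    refine Matrix.exists_vecMul_eq_zero_iff.mp ⟨fun i => (β i)⁻¹, fun h0 => ?_, ?_⟩
    · exact inv_ne_zero (hβ_ne hne.some) (congrFun h0 hne.some)
    · have h2 : (fun i => (β i)⁻¹) ᵥ* Matrix.diagonal (fun i => β i / α i)
          = fun i => (α i)⁻¹ := by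
        ext i
        rw [Matrix.vecMul_diagonal]
        field_simp [hβ_ne i]
      ext j
      have h1 : ((fun i => (α i)⁻¹) ᵥ* H) j = -(β j)⁻¹ := by
        rw [← hcol]; simp [Matrix.vecMul, dotProduct, H, div_eq_inv_mul]
      rw [Matrix.vecMul_add, Matrix.vecMul_one, ← Matrix.vecMul_vecMul, h2, Pi.add_apply, h1]
      simp
  -- Facets move isometrically.
  have hq' : ∀ i u, q i u = β i • (∑ j, (h i j / α j) • p j)
      + β i • (((2 * lam i * u) / (lam i ^ 2 * u ^ 2 + 1)) • m
        - ((2 * lam i ^ 2 * u ^ 2) / (lam i ^ 2 * u ^ 2 + 1)) • nv i) := by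
    intro i u
    rw [hq]
    module
  have hst : ∀ i u, ((2 * lam i ^ 2 * u ^ 2) / (lam i ^ 2 * u ^ 2 + 1)) ^ 2
      + ((2 * lam i * u) / (lam i ^ 2 * u ^ 2 + 1)) ^ 2
      = 2 * ((2 * lam i ^ 2 * u ^ 2) / (lam i ^ 2 * u ^ 2 + 1)) := by
    intro i u
    have : lam i ^ 2 * u ^ 2 + 1 ≠ 0 := by positivity
    field_simp
  have hpq : ∀ i j u, i ≠ j →
      dist (q i u) (p j) = dist (β i • ∑ k, (h i k / α k) • p k) (p j) := by
    intro i j u hij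
    have := dist_add_smul_sub_eq (β i • ∑ k, (h i k / α k) • p k) (p j) m (nv i) (nv i)
      hm_unit (hnv_unit i) (hnv_unit i) (hm_orth i) (hm_orth i)
      (by rw [inner_sub_left, hqm, hpm, sub_self]) (β i) 0 _ 0 _ 0 1 0
      (by rw [inner_sub_left, real_inner_comm, hnq, real_inner_comm, hnp, hhdiag]
          simp [hij.symm])
      (by rw [inner_sub_left, real_inner_comm, hnq, real_inner_comm, hnp, hhdiag]
          simp [hij.symm])
      (hst i u) (by simp) (by simp)
    rw [hq', ← this]
    simp
  have hqq : ∀ i j u, i ≠ j → dist (q i u) (q j u)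
      = dist (β i • ∑ k, (h i k / α k) • p k) (β j • ∑ k, (h j k / α k) • p k) := by
    intro i j u hij
    rw [hq', hq']
    refine dist_add_smul_sub_eq _ _ m (nv i) (nv j)
      hm_unit (hnv_unit i) (hnv_unit j) (hm_orth i) (hm_orth j)
      (by rw [inner_sub_left, hqm, hqm, sub_self]) _ _ _ _ _ _ (h i j) (h j i)
      (by rw [inner_sub_left, real_inner_comm, hnq, real_inner_comm, hnq, hhdiag]; ring)
      (by rw [inner_sub_left, real_inner_comm, hnq, real_inner_comm, hnq, hhdiag]; ring)
      (hst i u) (hst j u) ?_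
    have hne := hlam_sq i j hij
    have hji : h j i = 2 * ⟪nv i, nv j⟫ - h i j := by linarith [hsymm i j]
    have hi : lam i ^ 2 * u ^ 2 + 1 ≠ 0 := by positivity
    have hj : lam j ^ 2 * u ^ 2 + 1 ≠ 0 := by positivity
    rw [hji, hhoff i j hij]
    field_simp
    ring
  have hn1 : (0 : ℝ) ≤ n - 1 := by
    have : (2 : ℝ) ≤ n := by exact_mod_cast hn
    linarith
  let V := (μH[(n : ℝ) - 1] (convexHull ℝ (Set.range p))).toReal
  have hfacet : ∀ (A : Finset (Fin n)) (u : ℝ), (μH[(n : ℝ) - 1] (convexHull ℝ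
      (p '' ↑A ∪ (fun j => q j u) '' ↑(Aᶜ)))).toReal = (∏ i ∈ Aᶜ, |β i / α i|) *
        (Matrix.of fun i j => if i ∈ A then (1 : Matrix (Fin n) (Fin n) ℝ) i j
          else H i j).det * V := by
    intro A u
    let M : Matrix (Fin n) (Fin n) ℝ := Matrix.of fun i j =>
      if i ∈ A then (1 : Matrix (Fin n) (Fin n) ℝ) i j else β i * (h i j / α j)
    have hM : ∀ i, ∑ j, M i j = 1 := by
      intro i
      by_cases hi : i ∈ A
      · simp [M, hi, Matrix.one_apply]
      · simp [M, hi, ← Finset.mul_sum, hrow, hβ_ne]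
    have hMp : ∀ i, ∑ j, M i j • p j
        = if i ∈ A then p i else β i • ∑ k, (h i k / α k) • p k := by
      intro i
      by_cases hi : i ∈ A
      · simp [M, hi, Matrix.one_apply]
      · simp [M, hi, Finset.smul_sum, mul_smul]
    have hset : p '' ↑A ∪ (fun j => q j u) '' ↑(Aᶜ)
        = Set.range fun i => if i ∈ A then p i else q i u := by
      ext x
      simp only [Set.mem_union, Set.mem_image, Set.mem_range, Finset.mem_coe, Finset.mem_compl]
      constructor
      · rintro (⟨i, hi, rfl⟩ | ⟨i, hi, rfl⟩) <;> exact ⟨i, by simp [hi]⟩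
      · rintro ⟨i, rfl⟩
        by_cases hi : i ∈ A
        · exact Or.inl ⟨i, hi, by simp [hi]⟩
        · exact Or.inr ⟨i, hi, by simp [hi]⟩
    have hdist : ∀ i j, dist (if i ∈ A then p i else q i u) (if j ∈ A then p j else q j u)
        = dist (∑ k, M i k • p k) (∑ k, M j k • p k) := by
      intro i j
      by_cases hij : i = j
      · simp [hij]
      rw [hMp, hMp]
      by_cases hi : i ∈ A <;> by_cases hj : j ∈ A <;> simp only [hi, hj, if_true, if_false]
      · rw [dist_comm, hpq j i u (Ne.symm hij), dist_comm]
      · exact hpq i j u hij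
      · exact hqq i j u hij
    have hdetM : M.det = (∏ i ∈ Aᶜ, β i / α i) *
        (Matrix.of fun i j => if i ∈ A then (1 : Matrix (Fin n) (Fin n) ℝ) i j
          else H i j).det := by
      have hfac : M = Matrix.diagonal (fun i => if i ∈ A then α i else β i) *
          (Matrix.of fun i j => if i ∈ A then (1 : Matrix (Fin n) (Fin n) ℝ) i j else H i j) *
          Matrix.diagonal fun j => (α j)⁻¹ := by
        ext i j
        rw [Matrix.mul_diagonal, Matrix.diagonal_mul]
        by_cases hi : i ∈ A
        · by_cases hij : i = j
          · subst hij; simp [M, hi, hα_ne]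
          · simp [M, hi, hij]
        · simp [M, H, hi, div_eq_mul_inv, mul_assoc]
      rw [hfac, Matrix.det_mul, Matrix.det_mul, Matrix.det_diagonal, Matrix.det_diagonal,
        mul_right_comm, ← Finset.prod_mul_distrib, ← Finset.prod_mul_prod_compl A]
      rw [Finset.prod_congr rfl (g := fun _ => (1 : ℝ)) fun i hi => by simp [hi, hα_ne],
        Finset.prod_congr rfl (s₁ := Aᶜ) (g := fun i => β i / α i) fun i hi => by
          simp [Finset.mem_compl.mp hi, div_eq_mul_inv]]
      simp
    have hvol := hausdorffMeasure_convexHull_range_sum_smul (by simp) p hp_indep m hm_unit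
      cconst hpm M hM
    rw [Fintype.card_fin] at hvol
    rw [hset, hausdorffMeasure_convexHull_range_congr hn1 _ _ hdist, hvol, ENNReal.toReal_mul,
      ENNReal.toReal_ofReal (abs_nonneg _), hdetM, abs_mul, Finset.abs_prod,
      abs_of_nonneg (Matrix.det_piecewise_one_nonneg H hH A)]
  have hsum : ∀ (P : Fin n → Prop) [DecidablePred P] (u : ℝ) (s : ℝ),
      (∀ i, (if P i then -1 else 1) * |β i / α i| = s * (β i / α i)) →
      (1 + Matrix.diagonal (fun i => s * (β i / α i)) * H).det = 0 →
      ∑ A : Finset (Fin n), (-1 : ℝ) ^ ((Aᶜ ∩ Finset.univ.filter P).card) *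
        (μH[(n : ℝ) - 1] (convexHull ℝ
          (p '' ↑A ∪ (fun j => q j u) '' ↑(Aᶜ)))).toReal = 0 := by
    intro P _ u s hP hdet
    rw [← Matrix.sum_prod_mul_det_piecewise_one] at hdet
    rw [← zero_mul V, ← hdet, Finset.sum_mul]
    refine Finset.sum_congr rfl fun A _ => ?_
    have hsign : (-1 : ℝ) ^ ((Aᶜ ∩ Finset.univ.filter P).card)
        = ∏ i ∈ Aᶜ, if P i then -1 else 1 := by
      rw [← Finset.prod_filter, Finset.prod_const]
      congr 2
      ext i
      simp
    rw [hfacet, hsign, ← mul_assoc, ← mul_assoc, ← Finset.prod_mul_distrib]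
    simp_rw [hP]
  have hsgn : ∀ i, 0 < α i * β i ↔ 0 < β i / α i := fun i => by
    rw [mul_comm, mul_pos_iff, div_pos_iff]
  have hsgn' : ∀ i, α i * β i < 0 ↔ β i / α i < 0 := fun i => by
    rw [mul_comm, mul_neg_iff, div_neg_iff]
  intro u
  refine ⟨hsum _ u (-1) (fun i => ?_) (by simpa using hdet_sub),
    hsum _ u 1 (fun i => ?_) (by simpa using hdet_add)⟩
  · simp only [hsgn]
    split_ifs with hi
    · rw [abs_of_pos hi]
    · rw [abs_of_nonpos (not_lt.mp hi)]; ring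
  · simp only [hsgn']
    split_ifs with hi
    · rw [abs_of_neg hi]; ring
    · rw [abs_of_nonneg (not_lt.mp hi)]
end

section
/- Assume in addition that n ≥ 3, that 0 < λ_1 < ⋯ < λ_n, and that for every partition [n] = A ⊔ B into disjoint subsets the n points {p_i : i ∈ A} ∪ {q_j(0) : j ∈ B} are affinely independent. For each k ∈ [n] set X_k = {i ∈ [n] : (i < k and α_iβ_i > 0) or (i > k and α_iβ_i < 0)}, and for disjoint subsets I, J with I ⊔ J = [n]∖{k} let W_{I,J}(u) denote the (n−2)-dimensional Hausdorff measure of the convex hull of {p_i : i ∈ I} ∪ {q_j(u) : j ∈ J}. Then for every k ∈ [n] and every u ∈ ℝ: Σ_{I⊔J=[n]∖{k}} (−1)^{|J∩X_k|} W_{I,J}(u) = 0. -/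
open scoped RealInnerProductSpace BigOperators
open MeasureTheory

/-- The cosine of the flexion angle `2 arctan (a u)`. -/
noncomputable def rotCos (a u : ℝ) : ℝ := (1 - a ^ 2 * u ^ 2) / (1 + a ^ 2 * u ^ 2)

/-- The sine of the flexion angle `2 arctan (a u)`. -/
noncomputable def rotSin (a u : ℝ) : ℝ := 2 * a * u / (1 + a ^ 2 * u ^ 2)

/-- The off-diagonal coefficient of the parametrization, for parameters `a`, `b` and cosine `x`. -/
noncomputable def pairCoeff (a b x : ℝ) : ℝ := 2 * a * (a * x - b) / (a ^ 2 - b ^ 2)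

/-- The factor by which the heights over the facet with normal of parameter `b` change when the
vertex with parameter `a` is replaced by its opposite, where `x` is the cosine. -/
noncomputable def pairScale (a b x : ℝ) : ℝ := (b ^ 2 - a ^ 2) / (a ^ 2 + b ^ 2 - 2 * a * b * x)

lemma rotCos_sq_add_rotSin_sq (a u : ℝ) : rotCos a u ^ 2 + rotSin a u ^ 2 = 1 := by
  have : 1 + a ^ 2 * u ^ 2 ≠ 0 := by positivity
  unfold rotCos rotSin
  field_simp
  ring

lemma pairCoeff_add (a b x : ℝ) (hab : a ^ 2 - b ^ 2 ≠ 0) :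
    pairCoeff a b x + pairCoeff b a x = 2 * x := by
  have : b ^ 2 - a ^ 2 ≠ 0 := fun h => hab (by linarith)
  unfold pairCoeff
  field_simp
  ring

lemma pairScale_ne_zero {a b x : ℝ} (hab : a ^ 2 - b ^ 2 ≠ 0)
    (hE : a ^ 2 + b ^ 2 - 2 * a * b * x ≠ 0) : pairScale a b x ≠ 0 :=
  div_ne_zero (fun h => hab (by linarith)) hE

lemma pairScale_sq (a b x : ℝ) (hab : a ^ 2 - b ^ 2 ≠ 0)
    (hE : a ^ 2 + b ^ 2 - 2 * a * b * x ≠ 0) :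
    pairScale a b x ^ 2 * (1 - pairCoeff a b x * pairCoeff b a x) = 1 := by
  have : b ^ 2 - a ^ 2 ≠ 0 := fun h => hab (by linarith)
  unfold pairCoeff pairScale
  generalize hE' : a ^ 2 + b ^ 2 - 2 * a * b * x = E at hE ⊢
  field_simp
  rw [← hE']
  ring

lemma rot_normal (a b x u : ℝ) (hab : a ^ 2 - b ^ 2 ≠ 0) :
    rotCos a u * rotSin b u - rotSin a u * (pairCoeff b a x - (1 - rotCos b u) * x) =
      (pairScale a b x)⁻¹ * rotSin b u := by
  have h1 : b ^ 2 - a ^ 2 ≠ 0 := fun h => hab (by linarith)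
  have h2 : 1 + a ^ 2 * u ^ 2 ≠ 0 := by positivity
  have h3 : 1 + b ^ 2 * u ^ 2 ≠ 0 := by positivity
  unfold pairCoeff pairScale rotCos rotSin
  field_simp
  ring

lemma rot_tangent (a b x u : ℝ) (hab : a ^ 2 - b ^ 2 ≠ 0) :
    rotCos a u * (pairCoeff b a x - (1 - rotCos b u) * x) + rotSin a u * rotSin b u =
      pairCoeff b a x - (1 - rotCos b u) * (x - pairCoeff a b x) := by
  have h1 : b ^ 2 - a ^ 2 ≠ 0 := fun h => hab (by linarith)
  have h2 : 1 + a ^ 2 * u ^ 2 ≠ 0 := by positivity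
  have h3 : 1 + b ^ 2 * u ^ 2 ≠ 0 := by positivity
  unfold pairCoeff rotCos rotSin
  field_simp
  ring

lemma pairCoeff_mutate_left (a b x : ℝ) (hab : a ^ 2 - b ^ 2 ≠ 0)
    (hE : a ^ 2 + b ^ 2 - 2 * a * b * x ≠ 0) :
    pairCoeff a b (-pairScale a b x * (x - pairCoeff a b x)) =
      pairScale a b x * pairCoeff a b x := by
  unfold pairCoeff pairScale
  generalize hE' : a ^ 2 + b ^ 2 - 2 * a * b * x = E at hE ⊢
  field_simp
  rw [← hE']
  ring

lemma pairCoeff_mutate_right (a b x : ℝ) (hab : a ^ 2 - b ^ 2 ≠ 0)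
    (hE : a ^ 2 + b ^ 2 - 2 * a * b * x ≠ 0) :
    pairCoeff b a (-pairScale a b x * (x - pairCoeff a b x)) =
      -pairScale a b x * pairCoeff b a x := by
  have h1 : b ^ 2 - a ^ 2 ≠ 0 := fun h => hab (by linarith)
  unfold pairCoeff pairScale
  generalize hE' : a ^ 2 + b ^ 2 - 2 * a * b * x = E at hE ⊢
  field_simp
  rw [← hE']
  ring

lemma pairCoeff_mutate (a b r x y z : ℝ) (hab : a ^ 2 - b ^ 2 ≠ 0) (har : a ^ 2 - r ^ 2 ≠ 0)
    (hbr : b ^ 2 - r ^ 2 ≠ 0)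
    (hEb : a ^ 2 + b ^ 2 - 2 * a * b * x ≠ 0) (hEr : a ^ 2 + r ^ 2 - 2 * a * r * y ≠ 0) :
    pairCoeff b r (pairScale a b x * pairScale a r y *
        (z - x * pairCoeff a r y - y * pairCoeff a b x + pairCoeff a b x * pairCoeff a r y)) =
      pairScale a b x * pairScale a r y *
        (pairCoeff b r z - pairCoeff a r y * pairCoeff b a x) := by
  have h1 : b ^ 2 - a ^ 2 ≠ 0 := fun h => hab (by linarith)
  unfold pairCoeff pairScale
  generalize hE₁ : a ^ 2 + b ^ 2 - 2 * a * b * x = E₁ at hEb ⊢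
  generalize hE₂ : a ^ 2 + r ^ 2 - 2 * a * r * y = E₂ at hEr ⊢
  field_simp
  rw [← hE₁, ← hE₂]
  ring

/-- The coefficient `h i j` attached to the parameters `lam` and the Gram matrix `g`. -/
noncomputable def coeff {ι : Type*} [DecidableEq ι] (lam : ι → ℝ) (g : ι → ι → ℝ) (i j : ι) : ℝ :=
  if i = j then 1 else pairCoeff (lam i) (lam j) (g i j)

/-- A snapshot of a flexible cross-polytope of the simplest type with opposite vertices `p i`,
`q i`, based at the facet with vertices `p`: `m` is a unit normal of that facet, `nv i` is a unit
normal, inside the facet, of its face opposite to `p i`, and the Gram matrix of `nv` is `g`. -/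
structure IsFrame {ι E : Type*} [Fintype ι] [DecidableEq ι] [NormedAddCommGroup E]
    [InnerProductSpace ℝ E] (lam : ι → ℝ) (u : ℝ) (p q : ι → E) (α β : ι → ℝ) (g : ι → ι → ℝ)
    (nv : ι → E) (m : E) (d : ι → ℝ) (c : ℝ) : Prop where
  gram : ∀ i j, ⟪nv i, nv j⟫ = g i j
  gram_self : ∀ i, g i i = 1
  normal_self : ⟪m, m⟫ = 1
  normal_nv : ∀ i, ⟪m, nv i⟫ = 0
  normal_p : ∀ l, ⟪m, p l⟫ = c
  nv_p : ∀ r l, ⟪nv r, p l⟫ = d r + if l = r then α r else 0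
  normal_q : ∀ j, ⟪m, q j⟫ = c + β j * rotSin (lam j) u
  nv_q : ∀ r j, ⟪nv r, q j⟫ = d r + β j * (coeff lam g j r - (1 - rotCos (lam j) u) * g j r)
  balance : ∑ i, (α i)⁻¹ • nv i = 0
  α_ne : ∀ i, α i ≠ 0
  β_ne : ∀ i, β i ≠ 0
  lam_sq : ∀ i j, i ≠ j → lam i ^ 2 - lam j ^ 2 ≠ 0
  lam_pos : ∀ i, 0 < lam i

section Mutation

variable {ι E : Type*} [DecidableEq ι] [NormedAddCommGroup E] [InnerProductSpace ℝ E]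

/-- The height `α` of the vertices after replacing the vertex `p i` by `q i`. -/
noncomputable def mutateα (lam : ι → ℝ) (i : ι) (α β : ι → ℝ) (g : ι → ι → ℝ) (r : ι) : ℝ :=
  if r = i then -β i else pairScale (lam i) (lam r) (g i r) * α r

/-- The height `β` of the opposite vertices after replacing the vertex `p i` by `q i`. -/
noncomputable def mutateβ (lam : ι → ℝ) (i : ι) (α β : ι → ℝ) (g : ι → ι → ℝ) (r : ι) : ℝ :=
  if r = i then -α i else (pairScale (lam i) (lam r) (g i r))⁻¹ * β r

/-- The normals `nv` after replacing the vertex `p i` by `q i`. -/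
noncomputable def mutateNv (lam : ι → ℝ) (u : ℝ) (i : ι) (g : ι → ι → ℝ) (nv : ι → E) (m : E)
    (r : ι) : E :=
  if r = i then -(rotCos (lam i) u • nv i + rotSin (lam i) u • m)
  else pairScale (lam i) (lam r) (g i r) • (nv r +
    (-g i r + (g i r - pairCoeff (lam i) (lam r) (g i r)) * rotCos (lam i) u) • nv i +
    ((g i r - pairCoeff (lam i) (lam r) (g i r)) * rotSin (lam i) u) • m)

/-- The facet normal `m` after replacing the vertex `p i` by `q i`. -/
noncomputable def mutateNormal (lam : ι → ℝ) (u : ℝ) (i : ι) (nv : ι → E) (m : E) : E :=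
  rotCos (lam i) u • m - rotSin (lam i) u • nv i

/-- The Gram matrix of `nv` after replacing the vertex `p i` by `q i`. -/
noncomputable def mutateGram (lam : ι → ℝ) (i : ι) (g : ι → ι → ℝ) (j r : ι) : ℝ :=
  if j = i then
    if r = i then 1
    else -pairScale (lam i) (lam r) (g i r) * (g i r - pairCoeff (lam i) (lam r) (g i r))
  else if r = i then
    -pairScale (lam i) (lam j) (g i j) * (g i j - pairCoeff (lam i) (lam j) (g i j))
  else if j = r then 1
  else pairScale (lam i) (lam j) (g i j) * pairScale (lam i) (lam r) (g i r) *
    (g j r - g i j * pairCoeff (lam i) (lam r) (g i r) - g i r * pairCoeff (lam i) (lam j) (g i j)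
      + pairCoeff (lam i) (lam j) (g i j) * pairCoeff (lam i) (lam r) (g i r))

end Mutation

namespace IsFrame

variable {ι E : Type*} [Fintype ι] [DecidableEq ι] [NormedAddCommGroup E] [InnerProductSpace ℝ E]
  {lam : ι → ℝ} {u : ℝ} {p q : ι → E} {α β : ι → ℝ} {g : ι → ι → ℝ} {nv : ι → E} {m : E}
  {d : ι → ℝ} {c : ℝ}

lemma gram_comm (F : IsFrame lam u p q α β g nv m d c) (i j : ι) : g i j = g j i := by
  rw [← F.gram, ← F.gram, real_inner_comm]

lemma lam_gram_pos (F : IsFrame lam u p q α β g nv m d c) (i j : ι) (hij : i ≠ j) :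
    0 < lam i ^ 2 + lam j ^ 2 - 2 * lam i * lam j * g i j := by
  have norm_nv : ∀ k, ‖nv k‖ = 1 := fun k => by
    rw [norm_eq_sqrt_real_inner, F.gram, F.gram_self, Real.sqrt_one]
  have hg : g i j ≤ 1 := by
    simpa [F.gram, norm_nv] using real_inner_le_norm (nv i) (nv j)
  have hne : lam i - lam j ≠ 0 := fun h => F.lam_sq i j hij (by
    rw [sub_eq_zero.1 h, sub_self])
  have h1 : 0 < (lam i - lam j) ^ 2 := by positivity
  have h2 := mul_nonneg (mul_pos (F.lam_pos i) (F.lam_pos j)).le (sub_nonneg.2 hg)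
  nlinarith

lemma lam_gram (F : IsFrame lam u p q α β g nv m d c) (i j : ι) (hij : i ≠ j) :
    lam i ^ 2 + lam j ^ 2 - 2 * lam i * lam j * g i j ≠ 0 :=
  (F.lam_gram_pos i j hij).ne'

lemma sum_inv_mul_gram (F : IsFrame lam u p q α β g nv m d c) (i : ι) :
    ∑ r, (α r)⁻¹ * g i r = 0 := by
  have h := congrArg (fun x => ⟪nv i, x⟫) F.balance
  simpa [inner_sum, inner_smul_right, F.gram] using h

lemma sum_inv_mul_offset (F : IsFrame lam u p q α β g nv m d c) [Nonempty ι] :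
    ∑ r, (α r)⁻¹ * d r = -1 := by
  obtain ⟨l⟩ := ‹Nonempty ι›
  have h := congrArg (fun x => ⟪x, p l⟫) F.balance
  simp only [sum_inner, real_inner_smul_left, F.nv_p, inner_zero_left, mul_add,
    Finset.sum_add_distrib, mul_ite, mul_zero, Finset.sum_ite_eq, Finset.mem_univ, if_true,
    inv_mul_cancel₀ (F.α_ne l)] at h
  linarith

lemma sum_inv_mul_coeff (F : IsFrame lam u p q α β g nv m d c) (i : ι) :
    ∑ r, (α r)⁻¹ * coeff lam g i r = (β i)⁻¹ := by
  have : Nonempty ι := ⟨i⟩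
  have h := congrArg (fun x => ⟪x, q i⟫) F.balance
  simp only [sum_inner, real_inner_smul_left, F.nv_q, inner_zero_left] at h
  have e : ∑ r, (α r)⁻¹ * (d r + β i * (coeff lam g i r - (1 - rotCos (lam i) u) * g i r)) =
      ∑ r, (α r)⁻¹ * d r + β i * ∑ r, (α r)⁻¹ * coeff lam g i r -
        β i * (1 - rotCos (lam i) u) * ∑ r, (α r)⁻¹ * g i r := by
    simp only [Finset.mul_sum, ← Finset.sum_add_distrib, ← Finset.sum_sub_distrib]
    exact Finset.sum_congr rfl fun r _ => by ring
  rw [e, F.sum_inv_mul_gram, F.sum_inv_mul_offset] at h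
  exact eq_inv_of_mul_eq_one_right (by linarith)

lemma inner_mutateNv (F : IsFrame lam u p q α β g nv m d c) (i j r : ι) :
    ⟪mutateNv lam u i g nv m j, mutateNv lam u i g nv m r⟫ = mutateGram lam i g j r := by
  have cs := rotCos_sq_add_rotSin_sq (lam i) u
  have mn : ∀ k, ⟪nv k, m⟫ = 0 := fun k => by rw [real_inner_comm, F.normal_nv]
  unfold mutateNv mutateGram
  by_cases hj : j = i <;> by_cases hr : r = i
  · simp only [hj, hr, if_true, inner_add_left, inner_add_right, inner_neg_left, inner_neg_right,
      real_inner_smul_left, real_inner_smul_right, F.gram, F.gram_self, F.normal_self,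
      F.normal_nv, mn]
    linear_combination cs
  · simp only [hj, hr, if_true, if_false, inner_add_left, inner_add_right, inner_neg_left,
      real_inner_smul_left, real_inner_smul_right, F.gram, F.gram_self, F.normal_self,
      F.normal_nv, mn]
    linear_combination -pairScale (lam i) (lam r) (g i r) *
      (g i r - pairCoeff (lam i) (lam r) (g i r)) * cs
  · simp only [hj, hr, if_true, if_false, inner_add_left, inner_add_right, inner_neg_right,
      real_inner_smul_left, real_inner_smul_right, F.gram, F.gram_self, F.normal_self,
      F.normal_nv, mn, F.gram_comm j i]
    linear_combination -pairScale (lam i) (lam j) (g i j) *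
      (g i j - pairCoeff (lam i) (lam j) (g i j)) * cs
  · simp only [hj, hr, if_false, inner_add_left, inner_add_right,
      real_inner_smul_left, real_inner_smul_right, F.gram, F.gram_self, F.normal_self,
      F.normal_nv, mn, F.gram_comm j i]
    split_ifs with hjr
    · subst hjr
      have h1 := pairScale_sq (lam i) (lam j) (g i j) (F.lam_sq i j (Ne.symm hj))
        (F.lam_gram i j (Ne.symm hj))
      have h2 := pairCoeff_add (lam i) (lam j) (g i j) (F.lam_sq i j (Ne.symm hj))
      rw [eq_sub_of_add_eq' h2] at h1
      rw [F.gram_self]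
      linear_combination h1 + pairScale (lam i) (lam j) (g i j) ^ 2 *
        (g i j - pairCoeff (lam i) (lam j) (g i j)) ^ 2 * cs
    · linear_combination pairScale (lam i) (lam j) (g i j) * pairScale (lam i) (lam r) (g i r) *
        (g i j - pairCoeff (lam i) (lam j) (g i j)) *
        (g i r - pairCoeff (lam i) (lam r) (g i r)) * cs

lemma balance_mutate (F : IsFrame lam u p q α β g nv m d c) (i : ι) :
    ∑ r, (mutateα lam i α β g r)⁻¹ • mutateNv lam u i g nv m r = 0 := by
  have hb := F.balance
  have hg := F.sum_inv_mul_gram i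
  have hc := F.sum_inv_mul_coeff i
  rw [← Finset.add_sum_erase _ _ (Finset.mem_univ i)] at hb hg hc ⊢
  have e : ∀ r ∈ Finset.univ.erase i, (mutateα lam i α β g r)⁻¹ • mutateNv lam u i g nv m r =
      (α r)⁻¹ • nv r - ((α r)⁻¹ * g i r) • nv i +
        ((α r)⁻¹ * g i r - (α r)⁻¹ * coeff lam g i r) •
          (rotCos (lam i) u • nv i + rotSin (lam i) u • m) := by
    intro r hr
    have hr := (Finset.mem_erase.1 hr).1
    have h1 := F.α_ne r
    have h2 := pairScale_ne_zero (F.lam_sq i r (Ne.symm hr)) (F.lam_gram i r (Ne.symm hr))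
    simp only [mutateα, mutateNv, coeff, hr, Ne.symm hr, if_false, smul_smul]
    rw [mul_inv, mul_assoc, mul_comm (α r)⁻¹, ← mul_assoc, inv_mul_cancel₀ h2, one_mul]
    module
  rw [Finset.sum_congr rfl e, Finset.sum_add_distrib, Finset.sum_sub_distrib, ← Finset.sum_smul,
    ← Finset.sum_smul, Finset.sum_sub_distrib, eq_neg_of_add_eq_zero_right hb,
    eq_neg_of_add_eq_zero_right hg, eq_sub_of_add_eq' hc]
  simp only [mutateα, mutateNv, coeff, if_true, F.gram_self, inv_neg]
  module

lemma mutate (F : IsFrame lam u p q α β g nv m d c) (i : ι) :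
    IsFrame lam u (Function.update p i (q i)) (Function.update q i (p i))
      (mutateα lam i α β g) (mutateβ lam i α β g) (mutateGram lam i g)
      (mutateNv lam u i g nv m) (mutateNormal lam u i nv m)
      (fun r => if r = i then -(rotCos (lam i) u * d i + rotSin (lam i) u * c)
        else pairScale (lam i) (lam r) (g i r) * (d r +
    (-g i r + (g i r - pairCoeff (lam i) (lam r) (g i r)) * rotCos (lam i) u) * d i +
    ((g i r - pairCoeff (lam i) (lam r) (g i r)) * rotSin (lam i) u) * c))
      (rotCos (lam i) u * c - rotSin (lam i) u * d i) := by
  have cs := rotCos_sq_add_rotSin_sq (lam i) u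
  have mn : ∀ k, ⟪nv k, m⟫ = 0 := fun k => by rw [real_inner_comm, F.normal_nv]
  have scale : ∀ r, r ≠ i → pairScale (lam i) (lam r) (g i r) ≠ 0 := fun r hr =>
    pairScale_ne_zero (F.lam_sq i r hr.symm) (F.lam_gram i r hr.symm)
  refine ⟨F.inner_mutateNv i, ?_, ?_, ?_, ?_, ?_, ?_, ?_, F.balance_mutate i, ?_, ?_, F.lam_sq,
    F.lam_pos⟩
  · intro j
    unfold mutateGram
    split_ifs <;> simp_all
  · simp only [mutateNormal, inner_sub_left, inner_sub_right, real_inner_smul_left,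
      real_inner_smul_right, F.gram, F.gram_self, F.normal_self, F.normal_nv, mn]
    linear_combination cs
  · intro j
    unfold mutateNormal mutateNv
    split_ifs with hj
    · simp only [inner_sub_left, inner_add_right, inner_neg_right, real_inner_smul_left,
        real_inner_smul_right, F.gram, F.gram_self, F.normal_self, F.normal_nv, mn]
      ring
    · simp only [inner_sub_left, inner_add_right, real_inner_smul_left, real_inner_smul_right,
        F.gram, F.gram_self, F.normal_self, F.normal_nv, mn]
      ring
  · intro l
    by_cases hl : l = i
    · subst hl
      simp only [mutateNormal, Function.update_self, inner_sub_left, real_inner_smul_left,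
        F.normal_q, F.nv_q, F.gram_self, coeff, if_true]
      ring
    · simp only [mutateNormal, Function.update_of_ne hl, inner_sub_left, real_inner_smul_left,
        F.normal_p, F.nv_p, hl, if_false]
      ring
  · intro r l
    by_cases hl : l = i <;> by_cases hr : r = i
    · subst hl hr
      simp only [mutateNv, mutateα, Function.update_self, inner_add_left, inner_neg_left,
        real_inner_smul_left, F.normal_q, F.nv_q, F.gram_self, coeff, if_true]
      linear_combination -β r * cs
    · subst hl
      simp only [mutateNv, Function.update_self, inner_add_left, hr, Ne.symm hr, if_false,
        real_inner_smul_left, F.normal_q, F.nv_q, F.gram_self, coeff, if_true]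
      linear_combination pairScale (lam l) (lam r) (g l r) *
        (g l r - pairCoeff (lam l) (lam r) (g l r)) * β l * cs
    · subst hr
      simp only [mutateNv, Function.update_of_ne hl, inner_add_left, inner_neg_left, hl, if_false,
        real_inner_smul_left, F.normal_p, F.nv_p, if_true]
      ring
    · simp only [mutateNv, mutateα, Function.update_of_ne hl, inner_add_left, hl, hr, if_false,
        real_inner_smul_left, F.normal_p, F.nv_p]
      split_ifs <;> ring
  · intro j
    by_cases hj : j = i
    · subst hj
      simp only [mutateNormal, mutateβ, Function.update_self, inner_sub_left,
        real_inner_smul_left, F.normal_p, F.nv_p, if_true]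
      ring
    · have h := rot_normal (lam i) (lam j) (g i j) u (F.lam_sq i j (Ne.symm hj))
      simp only [mutateNormal, mutateβ, Function.update_of_ne hj, inner_sub_left,
        real_inner_smul_left, F.normal_q, F.nv_q, hj, if_false, coeff, F.gram_comm j i]
      linear_combination β j * h
  · intro r j
    by_cases hj : j = i <;> by_cases hr : r = i
    · subst hj hr
      simp only [mutateNv, mutateβ, mutateGram, Function.update_self, inner_add_left,
        inner_neg_left, real_inner_smul_left, F.normal_p, F.nv_p, coeff, if_true]
      ring
    · subst hj
      have h := pairCoeff_mutate_left (lam j) (lam r) (g j r) (F.lam_sq j r (Ne.symm hr))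
        (F.lam_gram j r (Ne.symm hr))
      simp only [mutateNv, mutateβ, mutateGram, Function.update_self, inner_add_left, hr,
        Ne.symm hr, if_false, real_inner_smul_left, F.normal_p, F.nv_p, coeff, if_true, h]
      ring
    · subst hr
      have h := pairCoeff_mutate_right (lam r) (lam j) (g r j) (F.lam_sq r j (Ne.symm hj))
        (F.lam_gram r j (Ne.symm hj))
      have h' := rot_tangent (lam r) (lam j) (g r j) u (F.lam_sq r j (Ne.symm hj))
      have hs := scale j hj
      simp only [mutateNv, mutateβ, mutateGram, Function.update_of_ne hj, inner_add_left,
        inner_neg_left, hj, if_false, real_inner_smul_left, F.normal_q, F.nv_q, coeff, if_true, h,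
        F.gram_comm j r]
      field_simp
      linear_combination -β j * h'
    · have hsj := scale j hj
      have hsr := scale r hr
      have h' := rot_tangent (lam i) (lam j) (g i j) u (F.lam_sq i j (Ne.symm hj))
      have hadd := pairCoeff_add (lam i) (lam j) (g i j) (F.lam_sq i j (Ne.symm hj))
      have hsq := pairScale_sq (lam i) (lam j) (g i j) (F.lam_sq i j (Ne.symm hj))
        (F.lam_gram i j (Ne.symm hj))
      by_cases hjr : j = r
      · subst hjr
        simp only [mutateNv, mutateβ, mutateGram, Function.update_of_ne hj, inner_add_left,
          hj, if_false, real_inner_smul_left, F.normal_q, F.nv_q, coeff, if_true,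
          F.gram_comm j i, F.gram_self]
        field_simp
        rw [eq_sub_of_add_eq' hadd] at h' hsq ⊢
        linear_combination β j * pairScale (lam i) (lam j) (g i j) ^ 2 *
          (g i j - pairCoeff (lam i) (lam j) (g i j)) * h' + β j * rotCos (lam j) u * hsq
      · have h := pairCoeff_mutate (lam i) (lam j) (lam r) (g i j) (g i r) (g j r)
          (F.lam_sq i j (Ne.symm hj)) (F.lam_sq i r (Ne.symm hr)) (F.lam_sq j r hjr)
          (F.lam_gram i j (Ne.symm hj)) (F.lam_gram i r (Ne.symm hr))
        simp only [mutateNv, mutateβ, mutateGram, Function.update_of_ne hj, inner_add_left,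
          hj, hr, hjr, if_false, real_inner_smul_left, F.normal_q, F.nv_q, coeff,
          F.gram_comm j i, h]
        field_simp
        linear_combination β j * (g i r - pairCoeff (lam i) (lam r) (g i r)) * h'
  · intro j
    unfold mutateα
    split_ifs with hj
    · exact neg_ne_zero.2 (F.β_ne i)
    · exact mul_ne_zero (scale j hj) (F.α_ne j)
  · intro j
    unfold mutateβ
    split_ifs with hj
    · exact neg_ne_zero.2 (F.α_ne i)
    · exact mul_ne_zero (inv_ne_zero (scale j hj)) (F.β_ne j)

lemma inner_nv_sub (F : IsFrame lam u p q α β g nv m d c) {r l : ι} (hrl : r ≠ l) (j : ι) :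
    ⟪nv r, p j - p l⟫ = if j = r then α r else 0 := by
  rw [inner_sub_right, F.nv_p, F.nv_p, if_neg hrl.symm]
  ring

lemma inner_normal_sub (F : IsFrame lam u p q α β g nv m d c) (j l : ι) :
    ⟪m, p j - p l⟫ = 0 := by
  rw [inner_sub_right, F.normal_p, F.normal_p, sub_self]

end IsFrame

/-- Pairing against a family `w` with nonzero diagonal and vanishing off-diagonal entries shows
linear independence. -/
lemma linearIndependent_of_inner_diagonal {ι E : Type*} [Fintype ι] [DecidableEq ι]
    [NormedAddCommGroup E] [InnerProductSpace ℝ E] {y w : ι → E}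
    (hdiag : ∀ i, ⟪w i, y i⟫ ≠ 0) (hoff : ∀ i j, j ≠ i → ⟪w i, y j⟫ = 0) :
    LinearIndependent ℝ y := by
  rw [Fintype.linearIndependent_iff]
  intro a ha i
  have h := congrArg (fun x => ⟪w i, x⟫) ha
  simp only [inner_sum, inner_smul_right, inner_zero_right] at h
  rw [Finset.sum_eq_single i (fun j _ hj => by rw [hoff i j hj, mul_zero])
    (fun hi => absurd (Finset.mem_univ i) hi)] at h
  exact (mul_eq_zero.1 h).resolve_right (hdiag i)

/-- A vector with constant inner products against the vertices of a hyperplane simplex is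
normal to that hyperplane. -/
lemma eq_smul_normal {ι E : Type*} [Fintype ι] [DecidableEq ι] [Nonempty ι]
    [NormedAddCommGroup E] [InnerProductSpace ℝ E] [FiniteDimensional ℝ E]
    (hdim : Fintype.card ι = Module.finrank ℝ E) {p nv : ι → E} {m : E} {α d : ι → ℝ} {c : ℝ}
    (hm : ⟪m, m⟫ = 1) (hmn : ∀ i, ⟪m, nv i⟫ = 0) (hmp : ∀ l, ⟪m, p l⟫ = c)
    (hnp : ∀ r l, ⟪nv r, p l⟫ = d r + if l = r then α r else 0) (hα : ∀ i, α i ≠ 0)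
    {v : E} {e : ℝ} (hv : ∀ l, ⟪v, p l⟫ = e) : v = ⟪m, v⟫ • m := by
  obtain ⟨b⟩ := ‹Nonempty ι›
  let y : ι → E := fun j => if j = b then m else p j - p b
  let w : ι → E := fun j => if j = b then m else nv j
  have hy : LinearIndependent ℝ y := by
    refine linearIndependent_of_inner_diagonal (w := w) (fun i => ?_) (fun i j hij => ?_)
    · by_cases hi : i = b
      · simp only [y, w, hi, if_true, hm]
        exact one_ne_zero
      · simp [y, w, hi, Ne.symm hi, inner_sub_right, hnp, hα]
    · by_cases hi : i = b <;> by_cases hj : j = b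
      · exact absurd (hj.trans hi.symm) hij
      · simp [y, w, hi, hj, inner_sub_right, hmp]
      · simp [y, w, hi, hj, real_inner_comm, hmn]
      · simp [y, w, hi, hj, hij, Ne.symm hi, inner_sub_right, hnp]
  have key : v - ⟪m, v⟫ • m = 0 := by
    refine InnerProductSpace.ext_inner_right_basis
      (basisOfLinearIndependentOfCardEqFinrank hy hdim) fun i => ?_
    rw [coe_basisOfLinearIndependentOfCardEqFinrank, inner_zero_left]
    by_cases hi : i = b
    · simp only [y, hi, if_true, inner_sub_left, real_inner_smul_left, hm, mul_one,
        real_inner_comm m v, sub_self]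
    · simp only [y, hi, if_false, inner_sub_left, inner_sub_right, real_inner_smul_left, hmp, hv]
      ring
  exact sub_eq_zero.1 key

/-- The volume of a simplex with a marked vertex `x` and edges `y` from it is a universal multiple
of the square root of the Gram determinant of the edges. -/
lemma hausdorffMeasure_convexHull_simplex {E : Type*} [NormedAddCommGroup E]
    [InnerProductSpace ℝ E] [MeasurableSpace E] [BorelSpace E] {d : ℕ} (x : E) (y : Fin d → E) :
    (μH[(d : ℝ)] (convexHull ℝ (insert x (Set.range fun i => x + y i)))).toReal =
      Real.sqrt (Matrix.gram ℝ y).det * (μH[(d : ℝ)] (convexHull ℝ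
        (insert 0 (Set.range (EuclideanSpace.basisFun (Fin d) ℝ))))).toReal := by
  let b := EuclideanSpace.basisFun (Fin d) ℝ
  let f : EuclideanSpace ℝ (Fin d) →ₗ[ℝ] E := b.toBasis.constr ℝ y
  have hf : ∀ i, f (b i) = y i := fun i => by
    have := b.toBasis.constr_basis ℝ y i
    rwa [b.coe_toBasis] at this
  have hset : convexHull ℝ (insert x (Set.range fun i => x + y i)) =
      (fun z => x + z) '' (f '' convexHull ℝ (insert 0 (Set.range b))) := by
    rw [f.image_convexHull, Set.image_insert_eq, map_zero, ← Set.range_comp]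
    have h1 := (AffineEquiv.constVAdd ℝ E x).toAffineMap.image_convexHull
      (insert 0 (Set.range (f ∘ b)))
    simpa [Set.image_insert_eq, ← Set.range_comp, Function.comp_def, hf] using h1.symm
  have hgram : f.normDet ^ 2 = (Matrix.gram ℝ y).det := by
    have := f.normDet_sq_eq_det_gram b
    simpa only [hf, RCLike.ofReal_real_eq_id, id] using this
  have hvol := f.hausdorffMeasure_image (convexHull ℝ (insert 0 (Set.range b)))
  rw [finrank_euclideanSpace_fin] at hvol
  rw [hset, (isometry_add_left x).hausdorffMeasure_image (Or.inl d.cast_nonneg), hvol,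
    ENNReal.toReal_mul, ENNReal.toReal_ofReal f.normDet_nonneg, ← hgram,
    Real.sqrt_sq f.normDet_nonneg]

/-- The determinant of the matrix of inner products of two families of `n` vectors of `ℝⁿ` is
the product of their determinants. -/
lemma det_inner_eq_mul {ι : Type*} [Fintype ι] [DecidableEq ι] (x y : ι → EuclideanSpace ℝ ι) :
    (Matrix.of fun i j => ⟪x i, y j⟫).det =
      (Matrix.of fun i j => x i j).det * (Matrix.of fun i j => y i j).det := by
  rw [← Matrix.det_transpose (Matrix.of fun i j => y i j), ← Matrix.det_mul]
  congr 1
  ext i j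
  simp [Matrix.mul_apply, PiLp.inner_apply, mul_comm]

/-- Expansion of a determinant along a column with a single nonzero entry, on the diagonal. -/
lemma det_eq_mul_of_column {ι R : Type*} [Fintype ι] [DecidableEq ι] [CommRing R]
    (M : Matrix ι ι R) (k : ι) (h : ∀ i, i ≠ k → M i k = 0) :
    M.det = M k k * (M.toSquareBlockProp fun i => ¬ i = k).det := by
  rw [Matrix.twoBlockTriangular_det M (fun i => i = k) fun i hi j hj => hj ▸ h i hi]
  congr 1
  convert Matrix.det_eq_elem_of_subsingleton (M.toSquareBlockProp fun i => i = k) ⟨k, rfl⟩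
  rfl

/-- The `D`-dimensional volume of the convex hull of the points `p i` with `i ≠ k`. -/
noncomputable def faceVolume {ι E : Type*} [NormedAddCommGroup E] [InnerProductSpace ℝ E]
    [MeasurableSpace E] [BorelSpace E] (D : ℕ) (p : ι → E) (k : ι) : ℝ :=
  (μH[(D : ℝ)] (convexHull ℝ (p '' {k}ᶜ))).toReal

namespace IsFrame

variable {ι : Type*} [Fintype ι] [DecidableEq ι] {lam : ι → ℝ} {u : ℝ}
  {p q : ι → EuclideanSpace ℝ ι} {α β : ι → ℝ} {g : ι → ι → ℝ} {nv : ι → EuclideanSpace ℝ ι}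
  {m : EuclideanSpace ℝ ι} {d : ι → ℝ} {c : ℝ}

/-- The Gram determinant of the edges at `p o` of the face opposite to `p k`, times the squared
height of `p k`, does not depend on `k`. -/
lemma det_gram_mul_sq (F : IsFrame lam u p q α β g nv m d c) {o k : ι} (hok : o ≠ k) :
    (Matrix.gram ℝ fun j : {j // j ≠ k ∧ j ≠ o} => p j - p o).det * α k ^ 2 =
      (Matrix.of fun i j => (if i = o then m else p i - p o : EuclideanSpace ℝ ι) j).det ^ 2 := by
  set T : ι → EuclideanSpace ℝ ι := fun i => if i = o then m else p i - p o with hT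
  set Y : ι → EuclideanSpace ℝ ι := fun i => if i = k then nv k else T i with hY
  have mn : ∀ k, ⟪nv k, m⟫ = 0 := fun k => by rw [real_inner_comm, F.normal_nv]
  have hYk : Y k = nv k := by simp [hY]
  have hYT : ∀ i, i ≠ k → Y i = T i := fun i hi => by simp [hY, hi]
  have hTn : ∀ i, ⟪T i, nv k⟫ = if i = k then α k else 0 := fun i => by
    simp only [hT]
    by_cases hi : i = o
    · subst hi
      rw [if_pos rfl, if_neg hok, F.normal_nv]
    · rw [if_neg hi, real_inner_comm, F.inner_nv_sub hok.symm]
  have hYn : ∀ i, ⟪Y i, nv k⟫ = if i = k then 1 else 0 := fun i => by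
    by_cases hi : i = k
    · subst hi
      rw [if_pos rfl, hYk, F.gram, F.gram_self]
    · rw [hYT i hi, hTn, if_neg hi, if_neg hi]
  have hYo : Y o = m := by simp [hY, hT, hok]
  have hYm : ∀ i, ⟪Y i, m⟫ = if i = o then 1 else 0 := fun i => by
    by_cases hi : i = o
    · subst hi
      rw [if_pos rfl, hYo, F.normal_self]
    · rw [if_neg hi]
      by_cases hk : i = k
      · subst hk
        rw [hYk, mn]
      · rw [hYT i hk, hT, real_inner_comm]
        simp only [hi, if_false, F.inner_normal_sub]
  have hN : (Matrix.of fun i j => ⟪T i, Y j⟫).det =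
      α k * ((Matrix.of fun i j => ⟪Y i, Y j⟫).toSquareBlockProp fun i => ¬ i = k).det := by
    rw [det_eq_mul_of_column _ k fun i hi => by rw [Matrix.of_apply, hYk, hTn, if_neg hi]]
    congr 1
    · rw [Matrix.of_apply, hYk, hTn, if_pos rfl]
    · congr 1
      ext i j
      simp [Matrix.toSquareBlockProp, hYT i i.2]
  have hG : (Matrix.of fun i j => ⟪Y i, Y j⟫).det =
      ((Matrix.of fun i j => ⟪Y i, Y j⟫).toSquareBlockProp fun i => ¬ i = k).det := by
    rw [det_eq_mul_of_column _ k fun i hi => by rw [Matrix.of_apply, hYk, hYn, if_neg hi],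
      Matrix.of_apply, hYk, F.gram, F.gram_self, one_mul]
  have hE : (Matrix.of fun i j => ⟪Y i, Y j⟫).det =
      (Matrix.gram ℝ fun j : {j // j ≠ k ∧ j ≠ o} => p j - p o).det := by
    rw [Matrix.twoBlockTriangular_det _ (fun i => i ≠ k ∧ i ≠ o)]
    · have h1 : ((Matrix.of fun i j => ⟪Y i, Y j⟫).toSquareBlockProp
          fun i => ¬ (i ≠ k ∧ i ≠ o)) = 1 := by
        ext ⟨i, hi⟩ ⟨j, hj⟩
        have hj' : j = k ∨ j = o := by tauto
        rcases hj' with rfl | rfl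
        · simp [Matrix.toSquareBlockProp, hYk, hYn, Matrix.one_apply]
        · simp [Matrix.toSquareBlockProp, hYo, hYm, Matrix.one_apply]
      rw [h1, Matrix.det_one, mul_one]
      congr 1
      ext i j
      simp [Matrix.toSquareBlockProp, hYT _ i.2.1, hYT _ j.2.1, hT, i.2.2, j.2.2]
    · intro i hi j hj
      have hi' : i = k ∨ i = o := by tauto
      rcases hi' with rfl | rfl
      · rw [Matrix.of_apply, real_inner_comm, hYk, hYn, if_neg hj.1]
      · rw [Matrix.of_apply, real_inner_comm, hYo, hYm, if_neg hj.2]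
  rw [← hG, det_inner_eq_mul, det_inner_eq_mul] at hN
  rw [← hE, det_inner_eq_mul]
  have hdet : (Matrix.of fun i j => Y i j).det ≠ 0 := by
    have hlin : LinearIndependent ℝ Y := by
      refine linearIndependent_of_inner_diagonal (w := fun i => if i = k then nv k else
        if i = o then m else nv i - g i k • nv k) (fun i => ?_) (fun i j hij => ?_)
      · by_cases hi : i = k
        · simp only [hi, if_true, hYk, F.gram, F.gram_self]
          exact one_ne_zero
        · by_cases ho : i = o
          · simp only [ho, hok, if_true, if_false, hYo, F.normal_self]
            exact one_ne_zero
          · simp only [hi, ho, if_false, inner_sub_left, real_inner_smul_left]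
            rw [real_inner_comm (Y i) (nv k), hYn, if_neg hi, hYT i hi, hT]
            simp only [ho, if_false, F.inner_nv_sub ho, if_true]
            simpa using F.α_ne i
      · by_cases hi : i = k
        · simp only [hi, if_true]
          rw [real_inner_comm, hYn, if_neg (hi ▸ hij)]
        · by_cases ho : i = o
          · simp only [ho, hok, if_true, if_false]
            rw [real_inner_comm, hYm, if_neg (ho ▸ hij)]
          · simp only [hi, ho, if_false, inner_sub_left, real_inner_smul_left]
            rw [real_inner_comm (Y j) (nv k), hYn]
            by_cases hj : j = k
            · subst hj
              rw [hYk, F.gram, if_pos rfl]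
              ring
            · rw [hYT j hj, hT, if_neg hj]
              by_cases hjo : j = o
              · simp [hjo, mn]
              · simp only [hjo, if_false, F.inner_nv_sub ho, hij]
                ring
    have h0 := Matrix.det_gram_ne_zero_iff_linearIndependent.2 hlin
    rw [Matrix.gram, det_inner_eq_mul] at h0
    exact left_ne_zero_of_mul h0
  have := mul_right_cancel₀ hdet (hN.trans (mul_assoc _ _ _).symm)
  rw [this]
  ring

lemma volume_mul_height_eq (F : IsFrame lam u p q α β g nv m d c) {D : ℕ}
    (hD : Fintype.card ι = D + 2) {o k : ι} (hok : o ≠ k) :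
    (μH[(D : ℝ)] (convexHull ℝ (p '' {k}ᶜ))).toReal * |α k| =
      (μH[(D : ℝ)] (convexHull ℝ
        (insert 0 (Set.range (EuclideanSpace.basisFun (Fin D) ℝ))))).toReal *
      |(Matrix.of fun i j => (if i = o then m else p i - p o : EuclideanSpace ℝ ι) j).det| := by
  have hcard : Fintype.card (Fin D) = Fintype.card {j // j ≠ k ∧ j ≠ o} := by
    have h : (Finset.univ.filter fun j => j ≠ k ∧ j ≠ o) = (Finset.univ.erase o).erase k := by
      ext j
      simp
    rw [Fintype.card_fin, Fintype.card_subtype, h, Finset.card_erase_of_mem (by simp [hok.symm]),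
      Finset.card_erase_of_mem (Finset.mem_univ o), Finset.card_univ, hD]
    rfl
  let e : Fin D ≃ {j // j ≠ k ∧ j ≠ o} := Fintype.equivOfCardEq hcard
  have hset : p '' {k}ᶜ = insert (p o) (Set.range fun i => p o + (p (e i) - p o)) := by
    ext x
    simp only [add_sub_cancel, Set.mem_image, Set.mem_compl_iff, Set.mem_singleton_iff,
      Set.mem_insert_iff, Set.mem_range]
    constructor
    · rintro ⟨j, hj, rfl⟩
      by_cases hjo : j = o
      · exact Or.inl (by rw [hjo])
      · exact Or.inr ⟨e.symm ⟨j, hj, hjo⟩, by simp⟩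
    · rintro (rfl | ⟨i, rfl⟩)
      · exact ⟨o, hok, rfl⟩
      · exact ⟨e i, (e i).2.1, rfl⟩
  have hgram : (Matrix.gram ℝ fun i => p (e i) - p o).det =
      (Matrix.gram ℝ fun j : {j // j ≠ k ∧ j ≠ o} => p j - p o).det :=
    Matrix.det_submatrix_equiv_self e (Matrix.gram ℝ fun j : {j // j ≠ k ∧ j ≠ o} => p j - p o)
  have h := congrArg Real.sqrt (F.det_gram_mul_sq hok)
  rw [Real.sqrt_mul' _ (sq_nonneg _), Real.sqrt_sq_eq_abs, Real.sqrt_sq_eq_abs] at h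
  rw [hset, hausdorffMeasure_convexHull_simplex, hgram, ← h]
  ring

/-- The volume of the face opposite to `p k` inside the base facet is inversely proportional to
the height of `p k`. -/
lemma volume_mul_height (F : IsFrame lam u p q α β g nv m d c) {D : ℕ}
    (hD : Fintype.card ι = D + 2) (hD_pos : 0 < D) (k l : ι) :
    faceVolume D p k * |α k| = faceVolume D p l * |α l| := by
  obtain ⟨o, ho⟩ : ∃ o, o ∉ ({k, l} : Finset ι) := by
    by_contra! h
    have h1 := Finset.card_le_two (a := k) (b := l)
    rw [Finset.eq_univ_iff_forall.2 h, Finset.card_univ] at h1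
    omega
  simp only [Finset.mem_insert, Finset.mem_singleton, not_or] at ho
  rw [faceVolume, faceVolume, F.volume_mul_height_eq hD ho.1, F.volume_mul_height_eq hD ho.2]

end IsFrame

lemma hasDerivAt_rotCos (a u : ℝ) :
    HasDerivAt (rotCos a) (-rotSin a u * (2 * a / (1 + a ^ 2 * u ^ 2))) u := by
  have h0 : 1 + a ^ 2 * u ^ 2 ≠ 0 := by positivity
  have h1 : HasDerivAt (fun x : ℝ => a ^ 2 * x ^ 2) (a ^ 2 * (2 * u)) u := by
    simpa using (hasDerivAt_pow 2 u).const_mul (a ^ 2)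
  refine ((h1.const_sub 1).div (h1.const_add 1) h0).congr_deriv ?_
  unfold rotSin
  field_simp
  ring

lemma hasDerivAt_rotSin (a u : ℝ) :
    HasDerivAt (rotSin a) (rotCos a u * (2 * a / (1 + a ^ 2 * u ^ 2))) u := by
  have h0 : 1 + a ^ 2 * u ^ 2 ≠ 0 := by positivity
  have h1 : HasDerivAt (fun x : ℝ => a ^ 2 * x ^ 2) (a ^ 2 * (2 * u)) u := by
    simpa using (hasDerivAt_pow 2 u).const_mul (a ^ 2)
  have h2 : HasDerivAt (fun x : ℝ => 2 * a * x) (2 * a) u := by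
    simpa using (hasDerivAt_id u).const_mul (2 * a)
  refine (h2.div (h1.const_add 1) h0).congr_deriv ?_
  unfold rotCos
  field_simp
  ring

lemma differentiable_rotCos (a : ℝ) : Differentiable ℝ (rotCos a) :=
  fun u => (hasDerivAt_rotCos a u).differentiableAt

lemma differentiable_rotSin (a : ℝ) : Differentiable ℝ (rotSin a) :=
  fun u => (hasDerivAt_rotSin a u).differentiableAt

/-- A flexible cross-polytope of the simplest type: the frames `nv`, `m` of the facet with
vertices `p u` are differentiable functions of the parameter `u`, while the heights `α`, `β` and
the Gram matrix `g` are constant. -/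
structure IsFamily {ι E : Type*} [Fintype ι] [DecidableEq ι] [NormedAddCommGroup E]
    [InnerProductSpace ℝ E] (lam : ι → ℝ) (p q : ℝ → ι → E) (α β : ι → ℝ) (g : ι → ι → ℝ)
    (nv : ℝ → ι → E) (m : ℝ → E) : Prop where
  frame : ∀ u, ∃ d c, IsFrame lam u (p u) (q u) α β g (nv u) (m u) d c
  differentiable_nv : ∀ i, Differentiable ℝ fun u => nv u i
  differentiable_normal : Differentiable ℝ m

namespace IsFamily

variable {ι E : Type*} [Fintype ι] [DecidableEq ι] [NormedAddCommGroup E] [InnerProductSpace ℝ E]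
  {lam : ι → ℝ} {p q : ℝ → ι → E} {α β : ι → ℝ} {g : ι → ι → ℝ} {nv : ℝ → ι → E} {m : ℝ → E}

lemma mutate (F : IsFamily lam p q α β g nv m) (i : ι) :
    IsFamily lam (fun u => Function.update (p u) i (q u i))
      (fun u => Function.update (q u) i (p u i)) (mutateα lam i α β g) (mutateβ lam i α β g)
      (mutateGram lam i g) (fun u => mutateNv lam u i g (nv u) (m u))
      (fun u => mutateNormal lam u i (nv u) (m u)) := by
  have h1 := F.differentiable_nv
  have h2 := F.differentiable_normal
  have h3 := differentiable_rotCos (lam i)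
  have h4 := differentiable_rotSin (lam i)
  refine ⟨fun u => ?_, fun r => ?_, ?_⟩
  · obtain ⟨d, c, hF⟩ := F.frame u
    exact ⟨_, _, hF.mutate i⟩
  · have h1i := h1 i
    have h1r := h1 r
    unfold mutateNv
    split_ifs <;> fun_prop
  · have h1i := h1 i
    unfold mutateNormal
    fun_prop

/-- A family is determined by its vertices, the facet normal at parameter zero and the products
of opposite heights. -/
lemma unique [FiniteDimensional ℝ E] [Nonempty ι] (hdim : Fintype.card ι = Module.finrank ℝ E)
    (F : IsFamily lam p q α β g nv m) {α' β' : ι → ℝ} {g' : ι → ι → ℝ} {nv' : ℝ → ι → E}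
    {m' : ℝ → E} (F' : IsFamily lam p q α' β' g' nv' m') (hm : m 0 = m' 0)
    (hmul : ∀ i, α i * β i = α' i * β' i) : m = m' ∧ nv = nv' := by
  have hsmul : ∀ u, m' u = ⟪m u, m' u⟫ • m u := fun u => by
    obtain ⟨d, c, hF⟩ := F.frame u
    obtain ⟨d', c', hF'⟩ := F'.frame u
    exact eq_smul_normal hdim hF.normal_self hF.normal_nv hF.normal_p hF.nv_p hF.α_ne hF'.normal_p
  have hself : ∀ u, ⟪m u, m u⟫ = 1 := fun u => by
    obtain ⟨d, c, hF⟩ := F.frame u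
    exact hF.normal_self
  have hself' : ∀ u, ⟪m' u, m' u⟫ = 1 := fun u => by
    obtain ⟨d, c, hF⟩ := F'.frame u
    exact hF.normal_self
  have hone : ∀ u, ⟪m u, m' u⟫ = 1 := by
    have hcont : Continuous fun u => ⟪m u, m' u⟫ :=
      F.differentiable_normal.continuous.inner F'.differentiable_normal.continuous
    have hsq : ∀ u, ⟪m u, m' u⟫ ^ 2 = 1 := fun u => by
      have h := hself' u
      nth_rewrite 1 [hsmul u] at h
      rw [real_inner_smul_left] at h
      rw [sq, h]
    have hsq' : Set.EqOn ((fun u => ⟪m u, m' u⟫) ^ 2) ((fun _ => (1 : ℝ)) ^ 2) Set.univ :=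
      fun u _ => by simpa using hsq u
    rcases isPreconnected_univ.eq_or_eq_neg_of_sq_eq hcont.continuousOn
      continuousOn_const hsq' (fun _ => one_ne_zero) with h | h
    · exact fun u => h (Set.mem_univ u)
    · have h0 := h (Set.mem_univ 0)
      simp only [← hm, hself] at h0
      exact absurd (h0 : (1 : ℝ) = -1) (by norm_num)
  have hmm : m = m' := by
    funext u
    rw [hsmul u, hone, one_smul]
  refine ⟨hmm, ?_⟩
  subst hmm
  have hβ : β = β' := by
    funext j
    obtain ⟨d, c, hF⟩ := F.frame 1
    obtain ⟨d', c', hF'⟩ := F'.frame 1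
    have h1 := hF.normal_q j
    have h2 := hF.normal_p j
    rw [hF'.normal_q] at h1
    rw [hF'.normal_p] at h2
    have h3 : rotSin (lam j) 1 ≠ 0 := by
      have := hF.lam_pos j
      unfold rotSin
      positivity
    exact mul_right_cancel₀ h3 (by linarith)
  subst hβ
  have hα : α = α' := by
    funext j
    obtain ⟨d, c, hF⟩ := F.frame 1
    exact mul_right_cancel₀ (hF.β_ne j) (hmul j)
  subst hα
  funext u r
  obtain ⟨d, c, hF⟩ := F.frame u
  obtain ⟨d', c', hF'⟩ := F'.frame u
  have h := eq_smul_normal hdim hF.normal_self hF.normal_nv hF.normal_p hF.nv_p hF.α_ne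
    (v := nv u r - nv' u r) (e := d r - d' r) fun l => by
      rw [inner_sub_left, hF.nv_p, hF'.nv_p]
      ring
  rw [inner_sub_right, hF.normal_nv, hF'.normal_nv, sub_zero, zero_smul] at h
  exact sub_eq_zero.1 h

lemma inner_deriv_normal (F : IsFamily lam p q α β g nv m) (u : ℝ) : ⟪m u, deriv m u⟫ = 0 := by
  have h := (F.differentiable_normal u).hasDerivAt
  have h1 := h.inner ℝ h
  have h2 : (fun t => ⟪m t, m t⟫) = fun _ => (1 : ℝ) := by
    funext t
    obtain ⟨d, c, hF⟩ := F.frame t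
    exact hF.normal_self
  rw [h2] at h1
  have h3 := h1.unique (hasDerivAt_const u (1 : ℝ))
  rw [real_inner_comm (m u) (deriv m u)] at h3
  linarith

lemma inner_deriv_nv (F : IsFamily lam p q α β g nv m) (i : ι) (u : ℝ) :
    ⟪nv u i, deriv (fun t => nv t i) u⟫ = 0 := by
  have h := (F.differentiable_nv i u).hasDerivAt
  have h1 := h.inner ℝ h
  have h2 : (fun t => ⟪nv t i, nv t i⟫) = fun _ => (1 : ℝ) := by
    funext t
    obtain ⟨d, c, hF⟩ := F.frame t
    rw [hF.gram, hF.gram_self]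
  rw [h2] at h1
  have h3 := h1.unique (hasDerivAt_const u (1 : ℝ))
  rw [real_inner_comm (nv u i)] at h3
  linarith

lemma inner_normal_deriv_nv (F : IsFamily lam p q α β g nv m) (i : ι) (u : ℝ) :
    ⟪m u, deriv (fun t => nv t i) u⟫ = -⟪nv u i, deriv m u⟫ := by
  have h1 := (F.differentiable_normal u).hasDerivAt.inner ℝ (F.differentiable_nv i u).hasDerivAt
  have h2 : (fun t => ⟪m t, nv t i⟫) = fun _ => (0 : ℝ) := by
    funext t
    obtain ⟨d, c, hF⟩ := F.frame t
    exact hF.normal_nv i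
  rw [h2] at h1
  have h3 := h1.unique (hasDerivAt_const u (0 : ℝ))
  rw [real_inner_comm (nv u i) (deriv m u)] at h3
  linarith

/-- Replacing `p i` by `q i` changes the angular velocity of the facet at its face opposite to
`p i` by the derivative of the flexion angle. -/
lemma inner_deriv_mutate (F : IsFamily lam p q α β g nv m) (i : ι) (u : ℝ) :
    ⟪mutateNv lam u i g (nv u) (m u) i, deriv (fun t => mutateNormal lam t i (nv t) (m t)) u⟫ =
      2 * lam i / (1 + lam i ^ 2 * u ^ 2) - ⟪nv u i, deriv m u⟫ := by
  have hm := (F.differentiable_normal u).hasDerivAt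
  have hn := (F.differentiable_nv i u).hasDerivAt
  have hd := ((hasDerivAt_rotCos (lam i) u).smul hm).sub ((hasDerivAt_rotSin (lam i) u).smul hn)
  have hd' : deriv (fun t => mutateNormal lam t i (nv t) (m t)) u = _ := hd.deriv
  obtain ⟨d, c, hF⟩ := F.frame u
  have cs := rotCos_sq_add_rotSin_sq (lam i) u
  have e1 := hF.normal_self
  have e2 := hF.normal_nv i
  have e3 : ⟪nv u i, m u⟫ = 0 := by rw [real_inner_comm, e2]
  have e4 : ⟪nv u i, nv u i⟫ = 1 := by rw [hF.gram, hF.gram_self]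
  rw [hd']
  simp only [mutateNv, if_true, inner_add_left, inner_neg_left, inner_add_right, inner_sub_right,
    real_inner_smul_left, real_inner_smul_right, e1, e2, e3, e4, F.inner_deriv_normal,
    F.inner_deriv_nv, F.inner_normal_deriv_nv]
  linear_combination (2 * lam i / (1 + lam i ^ 2 * u ^ 2) - ⟪nv u i, deriv m u⟫) * cs

end IsFamily

/-- The vertices of the facet of a cross-polytope containing `q i` for `i ∈ A` and `p i` for
`i ∉ A`. -/
def swap {ι E : Type*} [DecidableEq ι] (A : Finset ι) (p q : ι → E) (i : ι) : E :=
  if i ∈ A then q i else p i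

lemma swap_insert {ι E : Type*} [DecidableEq ι] {A : Finset ι} {i : ι} (hi : i ∉ A)
    (p q : ι → E) :
    swap (insert i A) p q = Function.update (swap A p q) i (swap A q p i) := by
  funext j
  by_cases hj : j = i
  · subst hj
    simp [swap, hi]
  · simp [swap, hj]

/-- The set of indices, relative to `k`, whose opposite heights produce a change of sign. -/
noncomputable def signSet {n : ℕ} (γ : Fin n → ℝ) (k : Fin n) : Finset (Fin n) :=
  Finset.univ.filter fun i => (i < k ∧ 0 < γ i) ∨ (k < i ∧ γ i < 0)

/-- The sign of the face opposite to the vertex `k` of the facet indexed by `A`. -/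
noncomputable def faceSign {n : ℕ} (γ ε : Fin n → ℝ) (A : Finset (Fin n)) (k : Fin n) : ℝ :=
  ε k * ∏ i ∈ A.erase k, if i ∈ signSet γ k then -1 else 1

lemma faceSign_insert_self {n : ℕ} (γ ε : Fin n → ℝ) (A : Finset (Fin n)) (k : Fin n) :
    faceSign γ ε (insert k A) k = faceSign γ ε A k := by
  simp [faceSign]

lemma faceSign_insert_of_ne {n : ℕ} (γ ε : Fin n → ℝ) {A : Finset (Fin n)} {i k : Fin n}
    (hi : i ∉ A) (hik : i ≠ k) :
    faceSign γ ε (insert i A) k = (if i ∈ signSet γ k then -1 else 1) * faceSign γ ε A k := by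
  rw [faceSign, faceSign, Finset.erase_insert_of_ne hik,
    Finset.prod_insert fun h => hi (Finset.mem_of_mem_erase h)]
  ring

lemma pairScale_pos {a b x : ℝ} (hab : a ^ 2 < b ^ 2)
    (hE : 0 < a ^ 2 + b ^ 2 - 2 * a * b * x) : 0 < pairScale a b x :=
  div_pos (sub_pos.2 hab) hE

lemma pairScale_neg {a b x : ℝ} (hab : b ^ 2 < a ^ 2)
    (hE : 0 < a ^ 2 + b ^ 2 - 2 * a * b * x) : pairScale a b x < 0 :=
  div_neg_of_neg_of_pos (sub_neg.2 hab) hE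

/-- The signs of the heights `α` agree, up to a common factor, with a prescribed pattern. -/
def HasSign {ι : Type*} (ρ α : ι → ℝ) : Prop :=
  ∃ σ : ℝ, σ * σ = 1 ∧ ∀ k, |α k| = σ * ρ k * α k

lemma HasSign.mutate {n : ℕ} {lam α β γ ε : Fin n → ℝ} {g : Fin n → Fin n → ℝ}
    {A : Finset (Fin n)} {i : Fin n} (hi : i ∉ A) (hα : ∀ k, α k ≠ 0) (hβ : ∀ k, β k ≠ 0)
    (hγ : ∀ k, α k * β k = γ k)
    (hpos : ∀ r, i < r → 0 < pairScale (lam i) (lam r) (g i r))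
    (hneg : ∀ r, r < i → pairScale (lam i) (lam r) (g i r) < 0)
    (h : HasSign (faceSign γ ε A) α) :
    HasSign (faceSign γ ε (insert i A)) (mutateα lam i α β g) := by
  obtain ⟨σ, hσ, h⟩ := h
  have hγi : γ i ≠ 0 := hγ i ▸ mul_ne_zero (hα i) (hβ i)
  obtain ⟨s, hs, hsγ⟩ : ∃ s : ℝ, s * s = 1 ∧ ((s = 1 ∧ 0 < γ i) ∨ (s = -1 ∧ γ i < 0)) := by
    rcases hγi.lt_or_gt with h | h
    · exact ⟨-1, by norm_num, Or.inr ⟨rfl, h⟩⟩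
    · exact ⟨1, by norm_num, Or.inl ⟨rfl, h⟩⟩
  have habs : |γ i| = s * γ i := by
    rcases hsγ with ⟨rfl, h⟩ | ⟨rfl, h⟩
    · rw [abs_of_pos h, one_mul]
    · rw [abs_of_neg h, neg_one_mul]
  refine ⟨-(s * σ), by linear_combination hs * σ ^ 2 + hσ, fun k => ?_⟩
  by_cases hk : k = i
  · subst hk
    rw [faceSign_insert_self, mutateα, if_pos rfl, abs_neg]
    have h1 := h k
    refine mul_left_cancel₀ (abs_ne_zero.2 (hα k)) ?_
    rw [← abs_mul, hγ, habs, ← hγ]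
    have h2 := abs_mul_abs_self (α k)
    have h3 : |α k| * (σ * faceSign γ ε A k) = α k :=
      mul_right_cancel₀ (hα k) (by linear_combination h2 - |α k| * h1)
    linear_combination -(s * β k) * h3
  · rw [faceSign_insert_of_ne γ ε hi (Ne.symm hk), mutateα, if_neg hk, abs_mul, h k]
    rcases lt_or_gt_of_ne hk with hlt | hlt
    · rw [abs_of_neg (hneg k hlt)]
      rcases hsγ with ⟨rfl, hγ₀⟩ | ⟨rfl, hγ₀⟩
      · rw [if_neg (by simp [signSet, hlt.not_gt, hγ₀.not_gt])]
        ring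
      · rw [if_pos (by simp [signSet, hlt, hγ₀])]
        ring
    · rw [abs_of_pos (hpos k hlt)]
      rcases hsγ with ⟨rfl, hγ₀⟩ | ⟨rfl, hγ₀⟩
      · rw [if_pos (by simp [signSet, hlt, hγ₀])]
        ring
      · rw [if_neg (by simp [signSet, hlt.not_gt, hγ₀.not_gt])]
        ring

lemma mutateα_mul_mutateβ {ι : Type*} [DecidableEq ι] {lam α β : ι → ℝ} {g : ι → ι → ℝ} {i : ι}
    (hscale : ∀ r, r ≠ i → pairScale (lam i) (lam r) (g i r) ≠ 0) (k : ι) :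
    mutateα lam i α β g k * mutateβ lam i α β g k = α k * β k := by
  unfold mutateα mutateβ
  split_ifs with hk
  · subst hk
    ring
  · have := hscale k hk
    field_simp

/-- A choice of normals and heights for the facet indexed by `A`, starting at `u = 0` from the
normal `m₀`, with the prescribed products and signs of heights. -/
structure IsBranch {n : ℕ} {E : Type*} [NormedAddCommGroup E] [InnerProductSpace ℝ E]
    (lam γ ε : Fin n → ℝ) (p q : ℝ → Fin n → E) (m₀ : E) (A : Finset (Fin n))
    (α β : Fin n → ℝ) (g : Fin n → Fin n → ℝ) (nv : ℝ → Fin n → E) (m : ℝ → E) : Prop where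
  family : IsFamily lam (fun u => swap A (p u) (q u)) (fun u => swap A (q u) (p u)) α β g nv m
  normal_zero : m 0 = m₀
  mul_eq : ∀ k, α k * β k = γ k
  sign : HasSign (faceSign γ ε A) α

namespace IsBranch

variable {n : ℕ} {E : Type*} [NormedAddCommGroup E] [InnerProductSpace ℝ E]
  {lam γ ε : Fin n → ℝ} {p q : ℝ → Fin n → E} {m₀ : E} {A : Finset (Fin n)}
  {α β : Fin n → ℝ} {g : Fin n → Fin n → ℝ} {nv : ℝ → Fin n → E} {m : ℝ → E}

lemma mutate (B : IsBranch lam γ ε p q m₀ A α β g nv m) (hlam : StrictMono lam) {i : Fin n}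
    (hi : i ∉ A) :
    IsBranch lam γ ε p q m₀ (insert i A) (mutateα lam i α β g) (mutateβ lam i α β g)
      (mutateGram lam i g) (fun u => mutateNv lam u i g (nv u) (m u))
      (fun u => mutateNormal lam u i (nv u) (m u)) := by
  obtain ⟨d, c, F⟩ := B.family.frame 0
  refine ⟨?_, ?_, ?_, ?_⟩
  · simpa only [swap_insert hi] using B.family.mutate i
  · simp [mutateNormal, rotCos, rotSin, B.normal_zero]
  · intro k
    rw [mutateα_mul_mutateβ, B.mul_eq]
    exact fun r hr => pairScale_ne_zero (F.lam_sq i r hr.symm) (F.lam_gram i r hr.symm)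
  · refine B.sign.mutate hi F.α_ne F.β_ne B.mul_eq
      (fun r hr => pairScale_pos ?_ (F.lam_gram_pos i r hr.ne))
      (fun r hr => pairScale_neg ?_ (F.lam_gram_pos i r hr.ne'))
    · exact pow_lt_pow_left₀ (hlam hr) (F.lam_pos i).le two_ne_zero
    · exact pow_lt_pow_left₀ (hlam hr) (F.lam_pos r).le two_ne_zero

end IsBranch

/-- Distinct functions `u ↦ a / (1 + a² u²)` are linearly independent. -/
lemma eq_zero_of_sum_mul_eq_zero {ι : Type*} [Fintype ι] [DecidableEq ι] {a s : ι → ℝ}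
    (ha : ∀ i, a i ≠ 0) (hne : ∀ i j, i ≠ j → a i ^ 2 - a j ^ 2 ≠ 0)
    (h : ∀ u : ℝ, ∑ i, 2 * a i / (1 + a i ^ 2 * u ^ 2) * s i = 0) (k : ι) : s k = 0 := by
  let P : Polynomial ℝ := ∑ i, Polynomial.C (a i * s i) *
    ∏ j ∈ Finset.univ.erase i, (1 + Polynomial.C (a j ^ 2) * Polynomial.X)
  have hP : ∀ x, P.eval x = ∑ i, a i * s i * ∏ j ∈ Finset.univ.erase i, (1 + a j ^ 2 * x) :=
    fun x => by simp [P, Polynomial.eval_finsetSum, Polynomial.eval_prod]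
  have hzero : ∀ u : ℝ, P.eval (u ^ 2) = 0 := by
    intro u
    have hden : ∀ i, 1 + a i ^ 2 * u ^ 2 ≠ 0 := fun i => by positivity
    have h1 : P.eval (u ^ 2) = (∏ j, (1 + a j ^ 2 * u ^ 2)) / 2 *
        ∑ i, 2 * a i / (1 + a i ^ 2 * u ^ 2) * s i := by
      rw [hP, Finset.mul_sum]
      refine Finset.sum_congr rfl fun i _ => ?_
      rw [← Finset.mul_prod_erase _ _ (Finset.mem_univ i)]
      have := hden i
      generalize ∏ x ∈ Finset.univ.erase i, (1 + a x ^ 2 * u ^ 2) = Q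
      field_simp
    rw [h1, h, mul_zero]
  have hP0 : P = 0 := by
    refine P.eq_zero_of_infinite_isRoot (Set.Infinite.mono ?_ (Set.Ici_infinite (0 : ℝ)))
    intro x hx
    have := hzero (Real.sqrt x)
    rwa [Real.sq_sqrt hx] at this
  have hk := hP (-(a k ^ 2)⁻¹)
  have hak := ha k
  rw [hP0, Polynomial.eval_zero, Finset.sum_eq_single k] at hk
  · refine ((mul_eq_zero.1 ((mul_eq_zero.1 hk.symm).resolve_right ?_))).resolve_left hak
    refine Finset.prod_ne_zero_iff.2 fun j hj h0 => hne k j (Finset.mem_erase.1 hj).1.symm ?_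
    field_simp at h0
    linarith
  · intro i _ hik
    rw [Finset.prod_eq_zero (Finset.mem_erase.2 ⟨Ne.symm hik, Finset.mem_univ k⟩), mul_zero]
    field_simp
    ring
  · exact fun hk => absurd (Finset.mem_univ k) hk

namespace IsBranch

variable {n : ℕ} {lam γ ε : Fin n → ℝ} {p q : ℝ → Fin n → EuclideanSpace ℝ (Fin n)}
  {m₀ : EuclideanSpace ℝ (Fin n)} {A : Finset (Fin n)} {α β : Fin n → ℝ}
  {g : Fin n → Fin n → ℝ} {nv : ℝ → Fin n → EuclideanSpace ℝ (Fin n)}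
  {m : ℝ → EuclideanSpace ℝ (Fin n)}

lemma exists_of_empty (B : IsBranch lam γ ε p q m₀ ∅ α β g nv m) (hlam : StrictMono lam)
    (A : Finset (Fin n)) : ∃ α β g nv m, IsBranch lam γ ε p q m₀ A α β g nv m := by
  induction A using Finset.induction with
  | empty => exact ⟨α, β, g, nv, m, B⟩
  | insert i A hi ih =>
    obtain ⟨_, _, _, _, _, B'⟩ := ih
    exact ⟨_, _, _, _, _, B'.mutate hlam hi⟩

lemma unique (B : IsBranch lam γ ε p q m₀ A α β g nv m) {α' β' : Fin n → ℝ}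
    {g' : Fin n → Fin n → ℝ} {nv' : ℝ → Fin n → EuclideanSpace ℝ (Fin n)}
    {m' : ℝ → EuclideanSpace ℝ (Fin n)} (B' : IsBranch lam γ ε p q m₀ A α' β' g' nv' m')
    (hn : 0 < n) : m = m' ∧ nv = nv' := by
  have : Nonempty (Fin n) := ⟨⟨0, hn⟩⟩
  exact B.family.unique (by simp) B'.family (B.normal_zero.trans B'.normal_zero.symm)
    fun k => (B.mul_eq k).trans (B'.mul_eq k).symm

lemma faceVolume_insert_self {E : Type*} [NormedAddCommGroup E] [InnerProductSpace ℝ E]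
    [MeasurableSpace E] [BorelSpace E] (D : ℕ) (A : Finset (Fin n)) (k : Fin n)
    (x y : Fin n → E) : faceVolume D (swap (insert k A) x y) k = faceVolume D (swap A x y) k := by
  have h : swap (insert k A) x y '' {k}ᶜ = swap A x y '' {k}ᶜ :=
    Set.image_congr fun j hj => by
      have hj : j ≠ k := hj
      simp [swap, hj]
  rw [faceVolume, faceVolume, h]

/-- The volumes of the faces of codimension two are constant during the flexion. -/
lemma faceVolume_eq (B : IsBranch lam γ ε p q m₀ ∅ α β g nv m) (hlam : StrictMono lam)
    (hp : ∀ u, p u = p 0) {D : ℕ} (hD : n = D + 2) (hD_pos : 0 < D) (A : Finset (Fin n))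
    (k : Fin n) (u : ℝ) :
    faceVolume D (swap A (p u) (q u)) k = faceVolume D (swap A (p 0) (q 0)) k := by
  induction A using Finset.induction generalizing k with
  | empty =>
    have h : ∀ x y : Fin n → EuclideanSpace ℝ (Fin n), swap ∅ x y = x := fun x y => by
      funext j
      simp [swap]
    rw [h, h, hp]
  | insert i A hi ih =>
    obtain ⟨α', _, _, _, _, B'⟩ := B.exists_of_empty hlam (insert i A)
    have hcard : Fintype.card (Fin n) = D + 2 := by rw [Fintype.card_fin, hD]
    obtain ⟨_, _, F⟩ := B'.family.frame u
    obtain ⟨_, _, F₀⟩ := B'.family.frame 0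
    have h := F.volume_mul_height hcard hD_pos k i
    have h₀ := F₀.volume_mul_height hcard hD_pos k i
    rw [faceVolume_insert_self, ih, ← faceVolume_insert_self D A i (p 0) (q 0), ← h₀] at h
    exact mul_right_cancel₀ (abs_ne_zero.2 (F.α_ne k)) h

/-- The relation between the angular velocity of a facet at its faces and their volumes. -/
lemma sum_faceSign_mul_inner (B : IsBranch lam γ ε p q m₀ A α β g nv m) {D : ℕ} (hD : n = D + 2)
    (hD_pos : 0 < D) (u : ℝ) :
    ∑ k, faceSign γ ε A k * faceVolume D (swap A (p u) (q u)) k * ⟪nv u k, deriv m u⟫ = 0 := by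
  obtain ⟨d, c, F⟩ := B.family.frame u
  obtain ⟨σ, hσ, hsign⟩ := B.sign
  have hcard : Fintype.card (Fin n) = D + 2 := by rw [Fintype.card_fin, hD]
  have k₀ : Fin n := ⟨0, by omega⟩
  have h := congrArg (fun x => ⟪x, deriv m u⟫) F.balance
  simp only [sum_inner, real_inner_smul_left, inner_zero_left] at h
  have e : ∀ k, faceSign γ ε A k * faceVolume D (swap A (p u) (q u)) k * ⟪nv u k, deriv m u⟫ =
      σ * (faceVolume D (swap A (p u) (q u)) k₀ * |α k₀|) * ((α k)⁻¹ * ⟪nv u k, deriv m u⟫) := by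
    intro k
    have hk := mul_inv_cancel₀ (F.α_ne k)
    rw [F.volume_mul_height hcard hD_pos k₀ k, hsign k]
    linear_combination -faceSign γ ε A k * faceVolume D (swap A (p u) (q u)) k *
      ⟪nv u k, deriv m u⟫ * (α k * (α k)⁻¹ * hσ + hk)
  rw [Finset.sum_congr rfl fun k _ => e k, ← Finset.mul_sum, h, mul_zero]

/-- The alternating sums of the volumes of the faces of codimension two opposite to a pair of
opposite vertices vanish. -/
theorem sum_faceSign_mul_faceVolume (B : IsBranch lam γ ε p q m₀ ∅ α β g nv m)
    (hlam : StrictMono lam) (hp : ∀ u, p u = p 0) {D : ℕ} (hD : n = D + 2) (hD_pos : 0 < D)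
    (k : Fin n) :
    ∑ A ∈ (Finset.univ.erase k).powerset,
      faceSign γ ε A k * faceVolume D (swap A (p 0) (q 0)) k = 0 := by
  obtain ⟨d, c, F⟩ := B.family.frame 0
  refine eq_zero_of_sum_mul_eq_zero (s := fun k => ∑ A ∈ (Finset.univ.erase k).powerset,
    faceSign γ ε A k * faceVolume D (swap A (p 0) (q 0)) k) (fun i => (F.lam_pos i).ne') F.lam_sq
    (fun u => ?_) k
  choose α' β' g' nv' m' B' using B.exists_of_empty hlam
  have hstep : ∀ k, ∀ A ∈ (Finset.univ.erase k).powerset,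
      ⟪nv' A u k, deriv (m' A) u⟫ + ⟪nv' (insert k A) u k, deriv (m' (insert k A)) u⟫ =
        2 * lam k / (1 + lam k ^ 2 * u ^ 2) := by
    intro k A hA
    have hkA : k ∉ A := fun h => Finset.notMem_erase k _ (Finset.mem_powerset.1 hA h)
    obtain ⟨hm, hnv⟩ := (B' (insert k A)).unique ((B' A).mutate hlam hkA) (by omega)
    rw [hm, hnv, (B' A).family.inner_deriv_mutate]
    ring
  have hsum : ∑ A : Finset (Fin n), ∑ k, faceSign γ ε A k *
      faceVolume D (swap A (p u) (q u)) k * ⟪nv' A u k, deriv (m' A) u⟫ = 0 :=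
    Finset.sum_eq_zero fun A _ => (B' A).sum_faceSign_mul_inner hD hD_pos u
  rw [Finset.sum_comm] at hsum
  refine Eq.trans ?_ hsum
  refine Finset.sum_congr rfl fun k _ => ?_
  rw [← Finset.powerset_univ, ← Finset.insert_erase (Finset.mem_univ k),
    Finset.sum_powerset_insert (Finset.notMem_erase k _), ← Finset.sum_add_distrib,
    Finset.erase_insert (Finset.notMem_erase k _), Finset.mul_sum]
  refine Finset.sum_congr rfl fun A hA => ?_
  rw [← hstep k A hA, faceSign_insert_self, faceVolume_insert_self,
    B.faceVolume_eq hlam hp hD hD_pos A k u]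
  ring

end IsBranch

lemma isFrame_of_parametrization {ι E : Type*} [Fintype ι] [DecidableEq ι] [Nonempty ι]
    [NormedAddCommGroup E] [InnerProductSpace ℝ E] [FiniteDimensional ℝ E]
    (hdim : Fintype.card ι = Module.finrank ℝ E) {lam α β : ι → ℝ} {nv p q : ι → E} {m : E}
    {d : ι → ℝ} {c u : ℝ} (hnv : ∀ i, ‖nv i‖ = 1) (hm : ‖m‖ = 1) (hm_orth : ∀ i, ⟪m, nv i⟫ = 0)
    (hlam_pos : ∀ i, 0 < lam i) (hlam_sq : ∀ i j, i ≠ j → lam i ^ 2 - lam j ^ 2 ≠ 0)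
    (hpm : ∀ j, ⟪m, p j⟫ = c)
    (hα : ∀ i j, j ≠ i → α i = ⟪nv i, p i⟫ - ⟪nv i, p j⟫) (hα_ne : ∀ i, α i ≠ 0)
    (hd : ∀ i, d i = ⟪nv i, p i⟫ - α i)
    {h : ι → ι → ℝ} (hh : ∀ i j, h i j = coeff lam (fun i j => ⟪nv i, nv j⟫) i j)
    (hβ : ∀ i, β i * ∑ j, h i j / α j = 1)
    (hq : ∀ i, q i = β i • ((∑ j, (h i j / α j) • p j) - (1 - rotCos (lam i) u) • nv i +
      rotSin (lam i) u • m)) :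
    IsFrame lam u p q α β (fun i j => ⟪nv i, nv j⟫) nv m d c := by
  have hmm : ⟪m, m⟫ = 1 := by rw [real_inner_self_eq_norm_sq, hm, one_pow]
  have hnn : ∀ i, ⟪nv i, nv i⟫ = 1 := fun i => by
    rw [real_inner_self_eq_norm_sq, hnv, one_pow]
  have hm_orth' : ∀ i, ⟪nv i, m⟫ = 0 := fun i => (real_inner_comm _ _).trans (hm_orth i)
  have hnp : ∀ r l, ⟪nv r, p l⟫ = d r + if l = r then α r else 0 := by
    intro r l
    split_ifs with hl
    · rw [hl, hd]
      ring
    · rw [hd, hα r l hl]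
      ring
  refine ⟨fun _ _ => rfl, hnn, hmm, hm_orth, hpm, hnp, fun j => ?_, fun r j => ?_, ?_, hα_ne,
    fun i => left_ne_zero_of_mul_eq_one (hβ i), hlam_sq, hlam_pos⟩
  · simp only [hq, inner_smul_right, inner_add_right, inner_sub_right, inner_sum, hpm, hmm,
      hm_orth, ← Finset.sum_mul]
    linear_combination c * hβ j
  · have e : ∑ l, h j l / α l * ⟪nv r, p l⟫ =
        (∑ l, h j l / α l) * d r + h j r := by
      simp only [hnp, mul_add, Finset.sum_add_distrib, ← Finset.sum_mul, mul_ite, mul_zero,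
        Finset.sum_ite_eq', Finset.mem_univ, if_true, div_mul_cancel₀ _ (hα_ne r)]
    simp only [hq, inner_smul_right, inner_add_right, inner_sub_right, inner_sum, e,
      hm_orth', ← hh]
    rw [real_inner_comm (nv j) (nv r)]
    linear_combination d r * hβ j
  · have hv := eq_smul_normal hdim hmm hm_orth hpm hnp hα_ne (v := ∑ i, (α i)⁻¹ • nv i)
      (e := ∑ r, (α r)⁻¹ * d r + 1) fun l => by
        simp only [sum_inner, real_inner_smul_left, hnp, mul_add, Finset.sum_add_distrib,
          mul_ite, mul_zero, Finset.sum_ite_eq, Finset.mem_univ, if_true,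
          inv_mul_cancel₀ (hα_ne l)]
    rw [hv, inner_sum]
    simp only [inner_smul_right, hm_orth, mul_zero, Finset.sum_const_zero, zero_smul]

/-- for each `k`, the alternating sum of the `(n-2)`-dimensional volumes of
the codimension-two faces not containing the vertices `p k`, `q k u`, with signs governed
by the set `X k`, vanishes identically during the flexion. -/
theorem euclidean_codim_two_volume_relation (n : ℕ) (hn : 3 ≤ n)
    (nv : Fin n → EuclideanSpace ℝ (Fin n))
    (m : EuclideanSpace ℝ (Fin n))
    (hnv_unit : ∀ i, ‖nv i‖ = 1)
    (hm_unit : ‖m‖ = 1)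
    (hm_orth : ∀ i, ⟪m, nv i⟫ = 0)
    (lam : Fin n → ℝ)
    (hlam_ne : ∀ i, lam i ≠ 0)
    (hlam : ∀ i j : Fin n, i ≠ j → lam i ≠ lam j ∧ lam i ≠ -lam j)
    (h : Fin n → Fin n → ℝ)
    (hhdiag : ∀ i, h i i = 1)
    (hhoff : ∀ i j : Fin n, i ≠ j →
      h i j = 2 * lam i * (lam i * ⟪nv i, nv j⟫ - lam j) / ((lam i) ^ 2 - (lam j) ^ 2))
    (p : Fin n → EuclideanSpace ℝ (Fin n))
    (hp_indep : AffineIndependent ℝ p)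
    (cconst : ℝ)
    (hpm : ∀ j, ⟪p j, m⟫ = cconst)
    (hpn : ∀ i j k : Fin n, j ≠ i → k ≠ i → ⟪nv i, p j⟫ = ⟪nv i, p k⟫)
    (α : Fin n → ℝ)
    (hα : ∀ i j : Fin n, j ≠ i → α i = ⟪nv i, p i⟫ - ⟪nv i, p j⟫)
    (hα_ne : ∀ i, α i ≠ 0)
    (hsum_ne : ∀ i, (∑ j, h i j / α j) ≠ 0)
    (β : Fin n → ℝ)
    (hβ : ∀ i, β i = (∑ j, h i j / α j)⁻¹)
    (q : Fin n → ℝ → EuclideanSpace ℝ (Fin n))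
    (hq : ∀ (i : Fin n) (u : ℝ), q i u = β i • ((∑ j, (h i j / α j) • p j)
      - ((2 * (lam i) ^ 2 * u ^ 2) / ((lam i) ^ 2 * u ^ 2 + 1)) • nv i
      + ((2 * lam i * u) / ((lam i) ^ 2 * u ^ 2 + 1)) • m))
    (hlam_pos : ∀ i, 0 < lam i)
    (hlam_mono : StrictMono lam)
    (hindep : ∀ A : Finset (Fin n),
      AffineIndependent ℝ (fun i : Fin n => if i ∈ A then p i else q i 0)) :
    ∀ (k : Fin n) (u : ℝ),
      ∑ I ∈ (Finset.univ.erase k).powerset,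
        (-1 : ℝ) ^ (((Finset.univ.erase k \ I) ∩
            Finset.univ.filter (fun i : Fin n =>
              (i < k ∧ 0 < α i * β i) ∨ (k < i ∧ α i * β i < 0))).card) *
          (μH[(n : ℝ) - 2] (convexHull ℝ
            (p '' ↑I ∪ (fun j => q j u) '' ↑(Finset.univ.erase k \ I)))).toReal = 0 := by
  have hcard : Fintype.card (Fin n) = Module.finrank ℝ (EuclideanSpace ℝ (Fin n)) := by simp
  have : Nonempty (Fin n) := ⟨⟨0, by omega⟩⟩
  have hlam_sq : ∀ i j, i ≠ j → lam i ^ 2 - lam j ^ 2 ≠ 0 := fun i j hij h0 => by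
    rcases sq_eq_sq_iff_eq_or_eq_neg.1 (sub_eq_zero.1 h0) with h1 | h1
    · exact (hlam i j hij).1 h1
    · exact (hlam i j hij).2 h1
  have hh : ∀ i j, h i j = coeff lam (fun i j => ⟪nv i, nv j⟫) i j := fun i j => by
    unfold coeff pairCoeff
    split_ifs with hij
    · rw [hij, hhdiag]
    · rw [hhoff i j hij]
  have hβ_mul : ∀ i, β i * ∑ j, h i j / α j = 1 := fun i => by
    rw [hβ, inv_mul_cancel₀ (hsum_ne i)]
  have frame := fun u : ℝ => isFrame_of_parametrization (u := u) (q := fun i => q i u) hcard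
    hnv_unit hm_unit hm_orth hlam_pos hlam_sq (fun j => (real_inner_comm _ _).trans (hpm j)) hα
    hα_ne (fun _ => rfl) hh hβ_mul fun i => by
      rw [hq]
      have h0 : 1 + lam i ^ 2 * u ^ 2 ≠ 0 := by positivity
      have h1 : 1 - rotCos (lam i) u = (2 * (lam i) ^ 2 * u ^ 2) / ((lam i) ^ 2 * u ^ 2 + 1) := by
        unfold rotCos
        rw [add_comm _ (1 : ℝ)]
        field_simp
        ring
      have h2 : rotSin (lam i) u = (2 * lam i * u) / ((lam i) ^ 2 * u ^ 2 + 1) := by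
        unfold rotSin
        rw [add_comm _ (1 : ℝ)]
      rw [h1, h2]
  set ε : Fin n → ℝ := fun k => |α k| / α k with hε
  set γ : Fin n → ℝ := fun k => α k * β k with hγ
  have hswap : ∀ x y : Fin n → EuclideanSpace ℝ (Fin n), swap ∅ x y = x := fun x y => by
    funext j
    simp [swap]
  have B : IsBranch lam γ ε (fun _ => p) (fun u i => q i u) m ∅ α β (fun i j => ⟪nv i, nv j⟫)
      (fun _ => nv) (fun _ => m) := by
    refine ⟨⟨fun u => ⟨fun i => ⟪nv i, p i⟫ - α i, cconst, ?_⟩, fun _ => differentiable_const _,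
      differentiable_const _⟩, rfl, fun _ => rfl, 1, one_mul 1, fun k => ?_⟩
    · simpa only [hswap] using frame u
    · simp [faceSign, hε, hα_ne k]
  intro k u
  obtain ⟨D, rfl⟩ : ∃ D, n = D + 2 := ⟨n - 2, by omega⟩
  have main := B.sum_faceSign_mul_faceVolume hlam_mono (fun _ => rfl) rfl (by omega) k
  have hεk : ε k ≠ 0 := div_ne_zero (abs_ne_zero.2 (hα_ne k)) (hα_ne k)
  refine mul_left_cancel₀ hεk ?_
  rw [mul_zero, Finset.mul_sum]
  refine Eq.trans ?_ main
  refine Finset.sum_nbij' (fun I => Finset.univ.erase k \ I) (fun I => Finset.univ.erase k \ I)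
    (by simp [Finset.sdiff_subset]) (by simp [Finset.sdiff_subset]) ?_ ?_ ?_
  · intro I hI
    exact Finset.sdiff_sdiff_eq_self (Finset.mem_powerset.1 hI)
  · intro I hI
    exact Finset.sdiff_sdiff_eq_self (Finset.mem_powerset.1 hI)
  · intro I hI
    have hI := Finset.mem_powerset.1 hI
    have hk : k ∉ Finset.univ.erase k \ I := by simp
    have himg : p '' ↑I ∪ (fun j => q j u) '' ↑(Finset.univ.erase k \ I) =
        swap (Finset.univ.erase k \ I) p (fun i => q i u) '' {k}ᶜ := by
      have h1 : Set.EqOn p (swap (Finset.univ.erase k \ I) p fun i => q i u) ↑I := fun i hi => by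
        have hi : i ∈ I := hi
        simp [swap, hi]
      have h2 : Set.EqOn (fun j => q j u) (swap (Finset.univ.erase k \ I) p fun i => q i u)
          ↑(Finset.univ.erase k \ I) := fun i hi => (if_pos (Finset.mem_coe.1 hi)).symm
      rw [h1.image_eq, h2.image_eq, ← Set.image_union, ← Finset.coe_union,
        Finset.union_sdiff_of_subset hI]
      simp [Set.compl_eq_univ_sdiff]
    have hD : ((D + 2 : ℕ) : ℝ) - 2 = D := by
      push_cast
      ring
    rw [← B.faceVolume_eq hlam_mono (fun _ => rfl) rfl (by omega) _ k u, faceSign,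
      Finset.erase_eq_of_notMem hk, Finset.prod_ite_mem, Finset.prod_const, himg, hD, ← mul_assoc]
    rfl
end

section
/- Assume in addition that 0 < λ_1 < ⋯ < λ_n and that for every partition [n] = A ⊔ B into disjoint subsets the n points {p_i : i ∈ A} ∪ {q_j(0) : j ∈ B} are affinely independent. Then the nonzero products α_iβ_i do not all have the same sign: there exist indices i and j with α_iβ_i > 0 and α_jβ_j < 0. -/
open scoped RealInnerProductSpace BigOperators

/-- A vector orthogonal to all differences of `d` affinely independent points of a
`d`-dimensional inner product space and to a common nonzero normal `m` of them vanishes. -/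
theorem AffineIndependent.eq_zero_of_inner_eq {ι E : Type*} [Fintype ι] [Nonempty ι]
    [NormedAddCommGroup E] [InnerProductSpace ℝ E] [FiniteDimensional ℝ E]
    (hcard : Fintype.card ι = Module.finrank ℝ E) {p : ι → E} (hp : AffineIndependent ℝ p)
    {m v : E} (hm : m ≠ 0) (hpm : ∀ i j, ⟪p i, m⟫ = ⟪p j, m⟫)
    (hpv : ∀ i j, ⟪p i, v⟫ = ⟪p j, v⟫) (hmv : ⟪m, v⟫ = 0) : v = 0 := by
  have mem_orthogonal : ∀ w : E, (∀ i j, ⟪p i, w⟫ = ⟪p j, w⟫) →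
      w ∈ (vectorSpan ℝ (Set.range p))ᗮ := by
    intro w hw
    rw [← Submodule.span_singleton_le_iff_mem, Submodule.le_orthogonal_iff_le_orthogonal,
      vectorSpan_def, Submodule.span_le]
    rintro _ ⟨_, ⟨i, rfl⟩, _, ⟨j, rfl⟩, rfl⟩
    rw [SetLike.mem_coe, Submodule.mem_orthogonal_singleton_iff_inner_left]
    simp [inner_sub_left, hw i j]
  have hrank : Module.finrank ℝ (vectorSpan ℝ (Set.range p))ᗮ = 1 := by
    have hpos : 0 < Fintype.card ι := Fintype.card_pos
    have hspan := hp.finrank_vectorSpan (n := Fintype.card ι - 1) (by omega)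
    have hadd := (vectorSpan ℝ (Set.range p)).finrank_add_finrank_orthogonal
    omega
  obtain ⟨c, hc⟩ := (finrank_eq_one_iff_of_nonzero'
    (⟨m, mem_orthogonal m hpm⟩ : (vectorSpan ℝ (Set.range p))ᗮ)
    (by simpa [Subtype.ext_iff] using hm)).1 hrank ⟨v, mem_orthogonal v hpv⟩
  have hcv : c • m = v := congrArg Subtype.val hc
  rw [← hcv, inner_smul_right, mul_eq_zero, inner_self_eq_zero] at hmv
  rw [← hcv, hmv.resolve_right hm, zero_smul]

/-- A nonempty finite family of nonzero reals with zero sum takes values of both signs. -/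
theorem exists_pos_neg_of_sum_eq_zero {ι : Type*} [Fintype ι] [Nonempty ι] {f : ι → ℝ}
    (hf : ∀ i, f i ≠ 0) (hsum : ∑ i, f i = 0) : ∃ i j, 0 < f i ∧ f j < 0 := by
  have hne : ∃ i ∈ Finset.univ, f i ≠ 0 := ⟨Classical.arbitrary ι, Finset.mem_univ _, hf _⟩
  obtain ⟨i, -, hi⟩ := Finset.exists_pos_of_sum_zero_of_exists_nonzero f hsum hne
  obtain ⟨j, -, hj⟩ := Finset.exists_pos_of_sum_zero_of_exists_nonzero (s := Finset.univ)
    (fun i => -f i) (by simp [hsum]) (by simpa using hne)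
  exact ⟨i, j, hi, by simpa using hj⟩

/-- the products `αᵢβᵢ` do not all have the same sign: some one is
positive and some one is negative. -/
theorem euclidean_signs_not_all_equal (n : ℕ) (hn : 2 ≤ n)
    (nv : Fin n → EuclideanSpace ℝ (Fin n))
    (m : EuclideanSpace ℝ (Fin n))
    (hnv_unit : ∀ i, ‖nv i‖ = 1)
    (hm_unit : ‖m‖ = 1)
    (hm_orth : ∀ i, ⟪m, nv i⟫ = 0)
    (lam : Fin n → ℝ)
    (hlam_ne : ∀ i, lam i ≠ 0)
    (hlam : ∀ i j : Fin n, i ≠ j → lam i ≠ lam j ∧ lam i ≠ -lam j)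
    (h : Fin n → Fin n → ℝ)
    (hhdiag : ∀ i, h i i = 1)
    (hhoff : ∀ i j : Fin n, i ≠ j →
      h i j = 2 * lam i * (lam i * ⟪nv i, nv j⟫ - lam j) / ((lam i) ^ 2 - (lam j) ^ 2))
    (p : Fin n → EuclideanSpace ℝ (Fin n))
    (hp_indep : AffineIndependent ℝ p)
    (cconst : ℝ)
    (hpm : ∀ j, ⟪p j, m⟫ = cconst)
    (hpn : ∀ i j k : Fin n, j ≠ i → k ≠ i → ⟪nv i, p j⟫ = ⟪nv i, p k⟫)
    (α : Fin n → ℝ)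
    (hα : ∀ i j : Fin n, j ≠ i → α i = ⟪nv i, p i⟫ - ⟪nv i, p j⟫)
    (hα_ne : ∀ i, α i ≠ 0)
    (hsum_ne : ∀ i, (∑ j, h i j / α j) ≠ 0)
    (β : Fin n → ℝ)
    (hβ : ∀ i, β i = (∑ j, h i j / α j)⁻¹)
    (q : Fin n → ℝ → EuclideanSpace ℝ (Fin n))
    (hq : ∀ (i : Fin n) (u : ℝ), q i u = β i • ((∑ j, (h i j / α j) • p j)
      - ((2 * (lam i) ^ 2 * u ^ 2) / ((lam i) ^ 2 * u ^ 2 + 1)) • nv i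
      + ((2 * lam i * u) / ((lam i) ^ 2 * u ^ 2 + 1)) • m))
    (hlam_pos : ∀ i, 0 < lam i)
    (hlam_mono : StrictMono lam)
    (hindep : ∀ A : Finset (Fin n),
      AffineIndependent ℝ (fun i : Fin n => if i ∈ A then p i else q i 0)) :
    ∃ i j : Fin n, 0 < α i * β i ∧ α j * β j < 0 := by
  have : NeZero n := ⟨by omega⟩
  have hnormal : ∑ j, (α j)⁻¹ • nv j = 0 := by
    have hm : m ≠ 0 := by
      rintro rfl
      simp at hm_unit
    refine hp_indep.eq_zero_of_inner_eq (by simp) hm (fun i j => by rw [hpm, hpm]) ?_ ?_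
    · intro k l
      rcases eq_or_ne k l with rfl | hkl
      · rfl
      rw [← sub_eq_zero, ← inner_sub_left, inner_sum, Fintype.sum_eq_add k l hkl]
      · have hk := hα k l hkl.symm
        have hl := hα l k hkl
        rw [real_inner_smul_right, real_inner_smul_right, real_inner_comm, inner_sub_right,
          ← hk, real_inner_comm, inner_sub_right, ← neg_sub, ← hl]
        field_simp [hα_ne k, hα_ne l]
        simp
      · rintro j ⟨hjk, hjl⟩
        rw [real_inner_smul_right, real_inner_comm, inner_sub_right,
          hpn j k l hjk.symm hjl.symm, sub_self, mul_zero]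
    · simp [inner_sum, real_inner_smul_right, hm_orth]
  have hsymm : ∀ i j, h i j + h j i = 2 * ⟪nv i, nv j⟫ := by
    intro i j
    rcases eq_or_ne i j with rfl | hij
    · rw [hhdiag, real_inner_self_eq_norm_sq, hnv_unit]
      norm_num
    · have hsq : lam i ^ 2 - lam j ^ 2 ≠ 0 := by
        rw [sub_ne_zero, Ne, sq_eq_sq_iff_eq_or_eq_neg, not_or]
        exact hlam i j hij
      rw [hhoff i j hij, hhoff j i hij.symm, real_inner_comm (nv i) (nv j),
        ← neg_sub (lam i ^ 2) (lam j ^ 2)]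
      field_simp
      ring
  have hgram : ∑ i, ∑ j, (α i)⁻¹ * (α j)⁻¹ * ⟪nv i, nv j⟫ = 0 := by
    refine Finset.sum_eq_zero fun i _ => ?_
    have := congrArg (fun v => (α i)⁻¹ * ⟪nv i, v⟫) hnormal
    simpa [inner_sum, real_inner_smul_right, Finset.mul_sum, mul_assoc] using this
  have hsum : ∑ i, (α i * β i)⁻¹ = 0 := by
    have hexp : ∑ i, (α i * β i)⁻¹ = ∑ i, ∑ j, (α i)⁻¹ * (α j)⁻¹ * h i j := by
      refine Finset.sum_congr rfl fun i _ => ?_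
      rw [hβ, mul_inv, inv_inv, Finset.mul_sum]
      exact Finset.sum_congr rfl fun j _ => by ring
    have htwo : ∑ i, ∑ j, (α i)⁻¹ * (α j)⁻¹ * h i j + ∑ i, ∑ j, (α i)⁻¹ * (α j)⁻¹ * h i j
        = 2 * ∑ i, ∑ j, (α i)⁻¹ * (α j)⁻¹ * ⟪nv i, nv j⟫ := by
      conv_lhs => enter [2]; rw [Finset.sum_comm]
      simp only [← Finset.sum_add_distrib, Finset.mul_sum]
      refine Finset.sum_congr rfl fun i _ => Finset.sum_congr rfl fun j _ => ?_
      linear_combination (α i)⁻¹ * (α j)⁻¹ * hsymm i j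
    linarith
  have hne : ∀ i, (α i * β i)⁻¹ ≠ 0 := fun i => by
    rw [hβ]
    exact inv_ne_zero (mul_ne_zero (hα_ne i) (inv_ne_zero (hsum_ne i)))
  simpa only [inv_pos, inv_lt_zero] using exists_pos_neg_of_sum_eq_zero hne hsum
end

section
/- Assume in addition that n ≥ 3 and that for every partition [n] = A ⊔ B into disjoint subsets the n points {p_i : i ∈ A} ∪ {q_j(0) : j ∈ B} are affinely independent. For a partition [n] = A ⊔ B let M_{A,B}(u) denote the n×n matrix whose i-th column is p_i if i ∈ A and q_i(u) if i ∈ B. Then for every u ∈ ℝ: Σ_{A⊔B=[n]} (−1)^{|B|} det M_{A,B}(u) = 0. (This sum equals n! times the generalized oriented volume of the flexible cross-polytope of the simplest type with vertices p_i, q_i(u); hence that generalized volume is identically zero during the flexion.) -/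
open scoped RealInnerProductSpace BigOperators

/-- The alternating sum of the determinants of the matrices mixing the columns of `P` and `Q`
is the determinant of the matrix of differences. -/
theorem sum_neg_one_pow_mul_det_mixed_columns {ι R : Type*} [Fintype ι] [DecidableEq ι]
    [CommRing R] (P Q : ι → ι → R) :
    ∑ A : Finset ι, (-1 : R) ^ (Aᶜ.card) *
        Matrix.det (Matrix.of (fun r j : ι => if j ∈ A then P j r else Q j r))
      = Matrix.det (Matrix.of (fun r j : ι => P j r - Q j r)) := by
  have key := (Matrix.detRowAlternating (R := R) (n := ι)).toMultilinearMap.map_add_univ P (-Q)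
  rw [← Matrix.det_transpose (Matrix.of (fun r j : ι => P j r - Q j r))]
  have hdiff : (Matrix.of (fun r j : ι => P j r - Q j r)).transpose = P + -Q := by
    ext i j
    simp [sub_eq_add_neg]
  rw [hdiff]
  refine Eq.trans (Finset.sum_congr rfl fun A _ => ?_) key.symm
  have hsign : (-1 : R) ^ (Aᶜ.card) = ∏ j, (if j ∈ A then (1 : R) else -1) := by
    rw [Finset.prod_ite]
    simp [Finset.compl_eq_univ_sdiff, Finset.sdiff_eq_filter]
  rw [hsign, ← Matrix.det_mul_row, ← Matrix.det_transpose]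
  change Matrix.det _ = Matrix.det _
  congr 1
  ext i j
  by_cases hi : i ∈ A <;> simp [hi, Finset.piecewise]

/-- Vectors of `ℝⁿ` with a common nonzero orthogonal vector have vanishing determinant. -/
theorem det_columns_eq_zero_of_forall_inner_eq_zero {n : ℕ}
    {x : EuclideanSpace ℝ (Fin n)} (hx : x ≠ 0) (v : Fin n → EuclideanSpace ℝ (Fin n))
    (hv : ∀ i, ⟪x, v i⟫ = 0) :
    Matrix.det (Matrix.of (fun r j : Fin n => v j r)) = 0 := by
  rw [← Matrix.exists_vecMul_eq_zero_iff]
  refine ⟨fun i => x i, fun h0 => hx ?_, ?_⟩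
  · ext i
    exact congrFun h0 i
  · ext j
    have := hv j
    rw [PiLp.inner_apply] at this
    simpa [Matrix.vecMul, dotProduct, mul_comm] using this

/-- The scalar identity satisfied by the weights `1 / (λ² u² + 1)`, which makes the common
normal vector of the diagonals of the cross-polytope explicit. -/
theorem diagonal_weight_identity {a b g u : ℝ} (hab : a ^ 2 - b ^ 2 ≠ 0) :
    2 * a * (a * g - b) / (a ^ 2 - b ^ 2) * (1 / (a ^ 2 * u ^ 2 + 1) - 1 / (b ^ 2 * u ^ 2 + 1))
      + 2 * a ^ 2 * u ^ 2 / (a ^ 2 * u ^ 2 + 1) * (g * (1 / (b ^ 2 * u ^ 2 + 1)))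
      = 2 * a * u / (a ^ 2 * u ^ 2 + 1) * (u * (b * (1 / (b ^ 2 * u ^ 2 + 1)))) := by
  have ha : a ^ 2 * u ^ 2 + 1 ≠ 0 := by positivity
  have hb : b ^ 2 * u ^ 2 + 1 ≠ 0 := by positivity
  field_simp
  ring

/-- the alternating sum of the determinants of the matrices of facet
vertices of a flexible cross-polytope of the simplest type in Euclidean space is
identically zero during the flexion; equivalently, its generalized oriented volume
is identically zero. -/
theorem euclidean_generalized_volume_zero (n : ℕ) (hn : 3 ≤ n)
    (nv : Fin n → EuclideanSpace ℝ (Fin n))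
    (m : EuclideanSpace ℝ (Fin n))
    (hnv_unit : ∀ i, ‖nv i‖ = 1)
    (hm_unit : ‖m‖ = 1)
    (hm_orth : ∀ i, ⟪m, nv i⟫ = 0)
    (lam : Fin n → ℝ)
    (hlam_ne : ∀ i, lam i ≠ 0)
    (hlam : ∀ i j : Fin n, i ≠ j → lam i ≠ lam j ∧ lam i ≠ -lam j)
    (h : Fin n → Fin n → ℝ)
    (hhdiag : ∀ i, h i i = 1)
    (hhoff : ∀ i j : Fin n, i ≠ j →
      h i j = 2 * lam i * (lam i * ⟪nv i, nv j⟫ - lam j) / ((lam i) ^ 2 - (lam j) ^ 2))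
    (p : Fin n → EuclideanSpace ℝ (Fin n))
    (hp_indep : AffineIndependent ℝ p)
    (cconst : ℝ)
    (hpm : ∀ j, ⟪p j, m⟫ = cconst)
    (hpn : ∀ i j k : Fin n, j ≠ i → k ≠ i → ⟪nv i, p j⟫ = ⟪nv i, p k⟫)
    (α : Fin n → ℝ)
    (hα : ∀ i j : Fin n, j ≠ i → α i = ⟪nv i, p i⟫ - ⟪nv i, p j⟫)
    (hα_ne : ∀ i, α i ≠ 0)
    (hsum_ne : ∀ i, (∑ j, h i j / α j) ≠ 0)
    (β : Fin n → ℝ)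
    (hβ : ∀ i, β i = (∑ j, h i j / α j)⁻¹)
    (q : Fin n → ℝ → EuclideanSpace ℝ (Fin n))
    (hq : ∀ (i : Fin n) (u : ℝ), q i u = β i • ((∑ j, (h i j / α j) • p j)
      - ((2 * (lam i) ^ 2 * u ^ 2) / ((lam i) ^ 2 * u ^ 2 + 1)) • nv i
      + ((2 * lam i * u) / ((lam i) ^ 2 * u ^ 2 + 1)) • m))
    (hindep : ∀ A : Finset (Fin n),
      AffineIndependent ℝ (fun i : Fin n => if i ∈ A then p i else q i 0)) :
    ∀ u : ℝ,
      ∑ A : Finset (Fin n), (-1 : ℝ) ^ (Aᶜ.card) *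
        Matrix.det (Matrix.of (fun r j : Fin n =>
          if j ∈ A then p j r else q j u r)) = 0 := by
  intro u
  rw [sum_neg_one_pow_mul_det_mixed_columns (fun j r => p j r) (fun j r => q j u r)]
  have hdiag : ∀ i, p i - q i u = β i • ((∑ j, (h i j / α j) • (p i - p j))
      + ((2 * (lam i) ^ 2 * u ^ 2) / ((lam i) ^ 2 * u ^ 2 + 1)) • nv i
      - ((2 * lam i * u) / ((lam i) ^ 2 * u ^ 2 + 1)) • m) := by
    intro i
    have hβi : β i * ∑ j, h i j / α j = 1 := by
      rw [hβ]
      exact inv_mul_cancel₀ (hsum_ne i)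
    have hpi : p i = β i • ∑ j, (h i j / α j) • p i := by
      rw [← Finset.sum_smul, smul_smul, hβi, one_smul]
    simp only [hq, smul_sub (h i _ / α _), Finset.sum_sub_distrib]
    conv_lhs => rw [hpi]
    module
  have hpm' : ∀ i j, ⟪m, p i - p j⟫ = 0 := fun i j => by
    rw [inner_sub_right, real_inner_comm, real_inner_comm (p j), hpm, hpm, sub_self]
  suffices hx : ∃ x : EuclideanSpace ℝ (Fin n), x ≠ 0 ∧ ∀ i, ⟪x, p i - q i u⟫ = 0 by
    obtain ⟨x, hx0, hx⟩ := hx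
    exact det_columns_eq_zero_of_forall_inner_eq_zero hx0 (fun i => p i - q i u) hx
  by_cases hu : u = 0
  · refine ⟨m, fun hm => by simp [hm] at hm_unit, fun i => ?_⟩
    rw [hdiag]
    simp [hu, inner_smul_right, inner_sum, hpm']
  have hpn' : ∀ k i j, ⟪nv k, p i - p j⟫ =
      α k * ((if k = i then 1 else 0) - (if k = j then 1 else 0)) := by
    intro k i j
    rw [inner_sub_right]
    by_cases hi : k = i <;> by_cases hj : k = j
    · simp [← hi, ← hj]
    · subst hi
      simp [hj, hα k j (Ne.symm hj)]
    · subst hj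
      simp [hi, hα k i (Ne.symm hi)]
    · simp [hi, hj, hpn k i j (Ne.symm hi) (Ne.symm hj)]
  set y : Fin n → ℝ := fun j => 1 / ((lam j) ^ 2 * u ^ 2 + 1) with hy
  set z : ℝ := ∑ j, u * (lam j * y j) / α j with hz
  set x : EuclideanSpace ℝ (Fin n) := (∑ k, (y k / α k) • nv k) + z • m with hxdef
  have hxp : ∀ i j, ⟪x, p i - p j⟫ = y i - y j := by
    intro i j
    simp only [hxdef, inner_add_left, sum_inner, real_inner_smul_left, hpm', hpn', mul_zero,
      add_zero]
    have : ∀ k, y k / α k * (α k * ((if k = i then 1 else 0) - (if k = j then 1 else 0)))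
        = (if k = i then y k else 0) - (if k = j then y k else 0) := by
      intro k
      rw [← mul_assoc, div_mul_cancel₀ _ (hα_ne k)]
      simp [mul_sub]
    simp [this]
  have hxn : ∀ i, ⟪x, nv i⟫ = ∑ j, ⟪nv i, nv j⟫ * y j / α j := by
    intro i
    simp only [hxdef, inner_add_left, sum_inner, real_inner_smul_left, hm_orth, mul_zero, add_zero]
    refine Finset.sum_congr rfl fun j _ => ?_
    rw [real_inner_comm]
    ring
  have hxm : ⟪x, m⟫ = z := by
    rw [real_inner_comm]
    simp [hxdef, inner_add_right, inner_sum, real_inner_smul_right, hm_orth, hm_unit]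
  have hsq : ∀ i j, i ≠ j → lam i ^ 2 - lam j ^ 2 ≠ 0 := by
    intro i j hij h0
    rcases sq_eq_sq_iff_eq_or_eq_neg.mp (sub_eq_zero.mp h0) with h1 | h1
    · exact (hlam i j hij).1 h1
    · exact (hlam i j hij).2 h1
  refine ⟨x, fun hx0 => ?_, fun i => ?_⟩
  · have hij : (⟨0, by omega⟩ : Fin n) ≠ ⟨1, by omega⟩ := by simp
    have h01 := hxp ⟨0, by omega⟩ ⟨1, by omega⟩
    rw [hx0, inner_zero_left, eq_comm, sub_eq_zero] at h01
    simp only [hy, one_div, inv_inj, add_left_inj] at h01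
    exact hsq _ _ hij (sub_eq_zero.mpr (mul_right_cancel₀ (pow_ne_zero 2 hu) h01))
  · rw [hdiag, real_inner_smul_right, inner_sub_right, inner_add_right, inner_sum]
    simp only [real_inner_smul_right, hxp, hxn, hxm]
    rw [hz, Finset.mul_sum, Finset.mul_sum, ← Finset.sum_add_distrib, ← Finset.sum_sub_distrib,
      Finset.sum_eq_zero, mul_zero]
    intro j _
    have key : h i j * (y i - y j)
        + 2 * lam i ^ 2 * u ^ 2 / (lam i ^ 2 * u ^ 2 + 1) * (⟪nv i, nv j⟫ * y j)
        = 2 * lam i * u / (lam i ^ 2 * u ^ 2 + 1) * (u * (lam j * y j)) := by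
      by_cases hij : i = j
      · subst hij
        rw [real_inner_self_eq_norm_sq, hnv_unit]
        ring
      · rw [hhoff i j hij]
        exact diagonal_weight_identity (hsq i j hij)
    linear_combination (α j)⁻¹ * key
end

section
/- For every integer n ≥ 2 there exist δ > 0, a unit vector m ∈ ℝ^{n+1}, and continuous maps a_1, …, a_n, b_1, …, b_n from ℝ to the unit sphere S^n ⊂ ℝ^{n+1} such that: (1) for all i ≠ j, the functions u ↦ ⟨a_i(u), a_j(u)⟩, u ↦ ⟨a_i(u), b_j(u)⟩ and u ↦ ⟨b_i(u), b_j(u)⟩ are constant (all edge lengths of the cross-polytope are constant during the flexion); (2) for every i, the function u ↦ ⟨a_i(u), b_i(u)⟩ is non-constant (the deformation is a genuine flexion); (3) for every u ∈ ℝ and every partition [n] = A ⊔ B, the n vectors {a_i(u) : i ∈ A} ∪ {b_j(u) : j ∈ B} are linearly independent; (4) ⟨a_i(0), m⟩ = ⟨b_i(0), m⟩ = 0 for all i (at u = 0 the cross-polytope lies in the equatorial great sphere); (5) for every u ∈ (0, δ) all the numbers ⟨a_i(u), m⟩ and ⟨b_i(u), m⟩ are positive, and for every u ∈ (−δ, 0)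 they are all negative (for 0 < u < δ the cross-polytope lies in the open upper hemisphere and for −δ < u < 0 in the open lower hemisphere); (6) for every u ∈ (−δ, δ) and all distinct partitions (A, B) ≠ (A′, B′) of [n], the spherical simplex spanned by {a_i(u) : i ∈ A} ∪ {b_j(u) : j ∈ B} intersects the spherical simplex spanned by {a_i(u) : i ∈ A′} ∪ {b_j(u) : j ∈ B′} exactly in the spherical simplex spanned by {a_i(u) : i ∈ A ∩ A′} ∪ {b_j(u) : j ∈ B ∩ B′} (the empty set if there are no common vertices); i.e., the polyhedral surface is embedded for |u| < δ. -/
open scoped RealInnerProductSpace BigOperators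

/-- The spherical simplex spanned by a finite family of vectors: the set of unit
vectors that are nonnegative linear combinations of the family. -/
def sphericalSimplex {E : Type*} [NormedAddCommGroup E] [InnerProductSpace ℝ E]
    {ι : Type*} [Fintype ι] (v : ι → E) : Set E :=
  {x | ‖x‖ = 1 ∧ ∃ t : ι → ℝ, (∀ i, 0 ≤ t i) ∧ x = ∑ i, t i • v i}

/-- The only relation `∑ (α i • a i + β i • b i) = 0` in which `α i` and `β i` never have the same
sign is the trivial one. Equivalently, the piecewise linear map
`y ↦ ∑ (y i)⁺ • a i + (y i)⁻ • b i` is injective. -/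
def SignedIndependent {E ι : Type*} [AddCommGroup E] [Module ℝ E] [Fintype ι] (a b : ι → E) :
    Prop :=
  ∀ α β : ι → ℝ, (∀ i, α i * β i ≤ 0) → ∑ i, (α i • a i + β i • b i) = 0 →
    ∀ i, α i = 0 ∧ β i = 0

lemma sum_subtype_of_eq_zero {ι M : Type*} [Fintype ι] [AddCommMonoid M] {p : ι → Prop}
    [DecidablePred p] (f : ι → M) (hf : ∀ i, ¬p i → f i = 0) :
    ∑ i : {i // p i}, f i = ∑ i, f i := by
  rw [← Fintype.sum_subtype_add_sum_subtype p f,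
    Finset.sum_eq_zero (s := (Finset.univ : Finset {i // ¬p i})) fun i _ => hf i i.2, add_zero]

namespace SignedIndependent

section Module

variable {E ι : Type*} [AddCommGroup E] [Module ℝ E] [Fintype ι] {a b : ι → E}

lemma linearIndependent [DecidableEq ι] (h : SignedIndependent a b) (A : Finset ι) :
    LinearIndependent ℝ (fun i => if i ∈ A then a i else b i) := by
  rw [Fintype.linearIndependent_iff]
  intro g hg i
  have := h (fun i => if i ∈ A then g i else 0) (fun i => if i ∈ A then 0 else g i)
    (fun i => by split_ifs <;> simp)
    (by
      rw [← hg]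
      refine Finset.sum_congr rfl fun i _ => ?_
      split_ifs <;> simp) i
  by_cases hi : i ∈ A <;> simpa [hi] using this

lemma smul (h : SignedIndependent a b) {s : ι → ℝ} (hs : ∀ i, 0 < s i) :
    SignedIndependent (fun i => s i • a i) (fun i => s i • b i) := by
  intro α β hαβ hsum i
  have := h (fun i => α i * s i) (fun i => β i * s i)
    (fun i => by
      have : α i * s i * (β i * s i) = α i * β i * (s i * s i) := by ring
      rw [this]
      exact mul_nonpos_of_nonpos_of_nonneg (hαβ i) (mul_self_nonneg _))
    (by simpa [mul_smul] using hsum) i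
  simpa [(hs i).ne'] using this

lemma map {F : Type*} [AddCommGroup F] [Module ℝ F] (h : SignedIndependent a b) (T : E →ₗ[ℝ] F)
    (hT : Function.Injective T) : SignedIndependent (fun i => T (a i)) (fun i => T (b i)) := by
  intro α β hαβ hsum
  refine h α β hαβ (hT ?_)
  simpa using hsum

end Module

lemma sphericalSimplex_inter {E ι : Type*} [NormedAddCommGroup E] [InnerProductSpace ℝ E]
    [Fintype ι] [DecidableEq ι] {a b : ι → E} (h : SignedIndependent a b) (A A' : Finset ι) :
    sphericalSimplex (fun i => if i ∈ A then a i else b i) ∩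
        sphericalSimplex (fun i => if i ∈ A' then a i else b i) =
      sphericalSimplex (fun i : {i : ι // (i ∈ A ∧ i ∈ A') ∨ (i ∉ A ∧ i ∉ A')} =>
        if (i : ι) ∈ A then a i else b i) := by
  ext x
  constructor
  · rintro ⟨⟨hx, t, ht, hxt⟩, -, t', ht', hxt'⟩
    refine ⟨hx, fun i => t i, fun i => ht i, ?_⟩
    have key := h (fun i => (if i ∈ A then t i else 0) - (if i ∈ A' then t' i else 0))
      (fun i => (if i ∈ A then 0 else t i) - (if i ∈ A' then 0 else t' i))
      (fun i => by
        have := mul_nonneg (ht i) (ht' i)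
        split_ifs <;> simp <;> linarith)
      (by
        have : x - x = 0 := sub_self x
        nth_rewrite 1 [hxt] at this
        rw [hxt', ← Finset.sum_sub_distrib] at this
        rw [← this]
        refine Finset.sum_congr rfl fun i _ => ?_
        by_cases h₁ : i ∈ A <;> by_cases h₂ : i ∈ A' <;> simp [h₁, h₂, sub_smul] <;> abel)
    have hzero : ∀ i, ¬((i ∈ A ∧ i ∈ A') ∨ (i ∉ A ∧ i ∉ A')) → t i = 0 := by
      intro i hi
      have := key i
      by_cases h1 : i ∈ A <;> by_cases h2 : i ∈ A' <;> simp_all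
    rw [hxt]
    refine (sum_subtype_of_eq_zero (fun i => t i • if i ∈ A then a i else b i) ?_).symm
    intro i hi
    simp [hzero i hi]
  · rintro ⟨hx, t, ht, hxt⟩
    have extend : ∀ B : Finset ι,
        (∀ i : {i : ι // (i ∈ A ∧ i ∈ A') ∨ (i ∉ A ∧ i ∉ A')}, (i : ι) ∈ B ↔ (i : ι) ∈ A) →
        x ∈ sphericalSimplex (fun i => if i ∈ B then a i else b i) := by
      intro B hB
      refine ⟨hx, fun i => if hi : (i ∈ A ∧ i ∈ A') ∨ (i ∉ A ∧ i ∉ A') then t ⟨i, hi⟩ else 0,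
        fun i => ?_, ?_⟩
      · beta_reduce
        split_ifs
        exacts [ht _, le_rfl]
      · rw [hxt, ← sum_subtype_of_eq_zero
          (p := fun i => (i ∈ A ∧ i ∈ A') ∨ (i ∉ A ∧ i ∉ A')) _ fun i hi => by simp [hi]]
        refine Finset.sum_congr rfl fun i _ => ?_
        simp [i.2, hB i]
    exact ⟨extend A fun _ => Iff.rfl, extend A' fun i => by rcases i.2 with h | h <;> tauto⟩

end SignedIndependent

namespace FlexibleCrossPolytope

variable {n : ℕ}

/-- The `k`-th standard basis vector of the equatorial hyperplane, extended by `0` to `k ≥ n`. -/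
noncomputable def axis (n k : ℕ) : EuclideanSpace ℝ (Fin (n + 1)) :=
  if h : k < n then EuclideanSpace.single ⟨k, by omega⟩ 1 else 0

/-- The unit normal of the equatorial hyperplane. -/
noncomputable def pole (n : ℕ) : EuclideanSpace ℝ (Fin (n + 1)) :=
  EuclideanSpace.single (Fin.last n) 1

/-- The sum of the first `j + 1` axes. -/
noncomputable def axisSum (n j : ℕ) : EuclideanSpace ℝ (Fin (n + 1)) :=
  ∑ k ∈ Finset.range (j + 1), axis n k

lemma inner_axis_axis (i j : ℕ) : ⟪axis n i, axis n j⟫ = if i = j ∧ i < n then (1 : ℝ) else 0 := by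
  unfold axis
  by_cases hi : i < n <;> by_cases hj : j < n <;> simp [hi, hj, EuclideanSpace.inner_single_left]
  omega

lemma inner_pole_axis (j : ℕ) : ⟪pole n, axis n j⟫ = 0 := by
  unfold axis pole
  by_cases hj : j < n <;> simp [hj, EuclideanSpace.inner_single_left, Fin.ext_iff]
  omega

lemma inner_pole_pole : ⟪pole n, pole n⟫ = 1 := by
  simp [pole]

lemma inner_axisSum_axis {i : ℕ} (hi : i < n) (k : ℕ) :
    ⟪axisSum n i, axis n k⟫ = if k ≤ i then (1 : ℝ) else 0 := by
  simp only [axisSum, sum_inner, inner_axis_axis]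
  by_cases hk : k ≤ i
  · rw [Finset.sum_eq_single k]
    · simp [hk, hk.trans_lt hi]
    · intro l _ hl
      simp [hl]
    · intro h
      simp at h
      omega
  · rw [if_neg hk]
    refine Finset.sum_eq_zero fun l hl => if_neg ?_
    simp at hl
    omega

lemma inner_axisSum_axisSum {i j : ℕ} (hij : i ≤ j) (hj : j < n) :
    ⟪axisSum n i, axisSum n j⟫ = (i : ℝ) + 1 := by
  rw [real_inner_comm]
  conv_lhs => rw [axisSum.eq_1 n i]
  rw [inner_sum, Finset.sum_congr rfl fun k hk => ?_, Finset.sum_const]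
  rotate_left
  · exact 1
  · rw [inner_axisSum_axis hj, if_pos]
    simp at hk
    omega
  · simp

lemma inner_pole_axisSum (j : ℕ) : ⟪pole n, axisSum n j⟫ = 0 := by
  simp [axisSum, inner_sum, inner_pole_axis]

/-- The vertices `a j` before normalization, in a frame in which they do not move. -/
noncomputable def fixedVertex (n j : ℕ) : EuclideanSpace ℝ (Fin (n + 1)) :=
  axis n (j + 1) - axis n j

/-- The vertices `b j` before normalization, at time `0`. -/
noncomputable def restVertex (n j : ℕ) : EuclideanSpace ℝ (Fin (n + 1)) :=
  axis n (j + 1) + axis n j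

/-- The mirror normal: the moving vertex `b j` is the reflection of `restVertex n j` in the
hyperplane orthogonal to this vector. -/
noncomputable def mirror (n : ℕ) (u : ℝ) (j : ℕ) : EuclideanSpace ℝ (Fin (n + 1)) :=
  pole n - u • axisSum n j

/-- The coefficient `2 / ‖mirror n u j‖ ^ 2` of the reflection. -/
noncomputable def mirrorCoeff (u : ℝ) (j : ℕ) : ℝ := 2 / (1 + (j + 1) * u ^ 2)

/-- The vertices `b j` before normalization, in the frame in which the `a j` do not move. -/
noncomputable def movingVertex (n : ℕ) (u : ℝ) (j : ℕ) : EuclideanSpace ℝ (Fin (n + 1)) :=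
  restVertex n j + (u * mirrorCoeff u j) • mirror n u j

lemma mirrorCoeff_mul (u : ℝ) (j : ℕ) : mirrorCoeff u j * (1 + (j + 1) * u ^ 2) = 2 := by
  have : 0 < 1 + ((j : ℝ) + 1) * u ^ 2 := by positivity
  exact div_mul_cancel₀ _ this.ne'

lemma mirrorCoeff_pos (u : ℝ) (j : ℕ) : 0 < mirrorCoeff u j := by
  unfold mirrorCoeff
  positivity

lemma mirrorCoeff_le (u : ℝ) (j : ℕ) : mirrorCoeff u j ≤ 2 := by
  have h := mirrorCoeff_mul u j
  have : 0 ≤ mirrorCoeff u j * ((j + 1) * u ^ 2) :=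
    mul_nonneg (mirrorCoeff_pos u j).le (by positivity)
  linarith

lemma inner_mirror_fixedVertex (u : ℝ) {i j : ℕ} (hi : i < n) :
    ⟪mirror n u i, fixedVertex n j⟫ = if i = j then u else 0 := by
  simp only [mirror, fixedVertex, inner_sub_left, inner_sub_right, real_inner_smul_left,
    inner_pole_axis, inner_axisSum_axis hi]
  split_ifs <;> first | omega | ring

lemma inner_mirror_restVertex (u : ℝ) {i j : ℕ} (hi : i < n) :
    ⟪mirror n u i, restVertex n j⟫ = if i < j then 0 else if i = j then -u else -(2 * u) := by
  simp only [mirror, restVertex, inner_sub_left, inner_add_right, real_inner_smul_left,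
    inner_pole_axis, inner_axisSum_axis hi]
  split_ifs <;> first | omega | ring

lemma inner_mirror_mirror (u : ℝ) {i j : ℕ} (hij : i ≤ j) (hj : j < n) :
    ⟪mirror n u i, mirror n u j⟫ = 1 + (i + 1) * u ^ 2 := by
  simp only [mirror, inner_sub_left, inner_sub_right, real_inner_smul_left, real_inner_smul_right,
    inner_pole_pole, inner_axisSum_axisSum hij hj, inner_pole_axisSum,
    real_inner_comm (pole n) (axisSum n _)]
  ring

lemma inner_fixedVertex_movingVertex (u : ℝ) {i j : ℕ} (hj : j < n) :
    ⟪fixedVertex n i, movingVertex n u j⟫ =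
      ⟪fixedVertex n i, restVertex n j⟫ + if j = i then mirrorCoeff u j * u ^ 2 else 0 := by
  rw [movingVertex, inner_add_right, real_inner_smul_right, real_inner_comm _ (fixedVertex n i),
    real_inner_comm (mirror n u j), inner_mirror_fixedVertex u hj]
  split_ifs <;> ring

lemma inner_movingVertex_movingVertex (u : ℝ) {i j : ℕ} (hij : i ≤ j) (hj : j < n) :
    ⟪movingVertex n u i, movingVertex n u j⟫ = ⟪restVertex n i, restVertex n j⟫ := by
  have h := mirrorCoeff_mul u i
  simp only [movingVertex, inner_add_right, inner_add_left, real_inner_smul_right,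
    real_inner_smul_left, real_inner_comm (mirror n u j) (restVertex n i),
    inner_mirror_restVertex u hj, inner_mirror_restVertex u (hij.trans_lt hj),
    inner_mirror_mirror u hij hj]
  rcases hij.lt_or_eq with hlt | rfl
  · simp only [hlt, hlt.not_gt, hlt.ne', if_true, if_false]
    linear_combination u ^ 2 * mirrorCoeff u j * h
  · simp only [lt_irrefl, if_true, if_false]
    linear_combination u ^ 2 * mirrorCoeff u i * h

lemma inner_axis_fixedVertex {k : ℕ} (hk : k < n) (j : ℕ) :
    ⟪axis n k, fixedVertex n j⟫ = (if j + 1 = k then 1 else 0) - if j = k then 1 else 0 := by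
  simp [fixedVertex, inner_sub_right, inner_axis_axis, hk, eq_comm]

lemma inner_axis_restVertex {k : ℕ} (hk : k < n) (j : ℕ) :
    ⟪axis n k, restVertex n j⟫ = (if j + 1 = k then 1 else 0) + if j = k then 1 else 0 := by
  simp [restVertex, inner_add_right, inner_axis_axis, hk, eq_comm]

lemma inner_axis_movingVertex {k j : ℕ} (hk : k < n) (hj : j < n) (u : ℝ) :
    ⟪axis n k, movingVertex n u j⟫ = (if j + 1 = k then 1 else 0) + (if j = k then 1 else 0) -
      if k ≤ j then u ^ 2 * mirrorCoeff u j else 0 := by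
  rw [movingVertex, inner_add_right, inner_axis_restVertex hk, real_inner_smul_right, mirror,
    inner_sub_right, real_inner_smul_right, real_inner_comm, inner_pole_axis, real_inner_comm,
    inner_axisSum_axis hj]
  split_ifs <;> first | omega | ring

lemma abs_sub_eq_of_mul_nonpos {x y : ℝ} (h : x * y ≤ 0) : |x - y| = |x| + |y| := by
  rcases mul_nonpos_iff.1 h with ⟨hx, hy⟩ | ⟨hx, hy⟩
  · rw [abs_of_nonneg hx, abs_of_nonpos hy, abs_of_nonneg (by linarith)]
    ring
  · rw [abs_of_nonpos hx, abs_of_nonneg hy, abs_of_nonpos (by linarith)]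
    ring

/-- The coordinates of a relation between the vertices form a triangular system, up to an error
that is quadratic in `u`. -/
lemma abs_add_abs_le_of_relation {u : ℝ} {α β : ℕ → ℝ} (hαβ : ∀ j, α j * β j ≤ 0)
    (h : ∑ j ∈ Finset.range n, (α j • fixedVertex n j + β j • movingVertex n u j) = 0)
    {k : ℕ} (hk : k < n) :
    |α k| + |β k| ≤
      (k + 1) * (2 * u ^ 2 * ∑ j ∈ Finset.range n, (|α j| + |β j|)) := by
  set S := ∑ j ∈ Finset.range n, (|α j| + |β j|) with hS
  let P : ℕ → ℝ := fun k =>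
    ∑ j ∈ Finset.range n, β j * if k ≤ j then u ^ 2 * mirrorCoeff u j else 0
  have hP : ∀ k, |P k| ≤ 2 * u ^ 2 * S := by
    intro k
    refine (Finset.abs_sum_le_sum_abs _ _).trans ?_
    rw [hS, Finset.mul_sum]
    refine Finset.sum_le_sum fun j _ => ?_
    rw [abs_mul, mul_comm]
    have hc : |if k ≤ j then u ^ 2 * mirrorCoeff u j else 0| ≤ 2 * u ^ 2 := by
      have := mirrorCoeff_le u j
      have := mirrorCoeff_pos u j
      split_ifs
      · rw [abs_of_nonneg (by positivity)]
        nlinarith [sq_nonneg u]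
      · simp
        positivity
    have := abs_nonneg (α j)
    gcongr
    linarith
  have coord : ∀ k, k < n →
      α k - β k = (∑ j ∈ Finset.range n, if j + 1 = k then α j + β j else 0) - P k := by
    intro k hk
    have h0 := congrArg (fun x => ⟪axis n k, x⟫) h
    simp only [inner_sum, inner_zero_right, inner_add_right, real_inner_smul_right,
      inner_axis_fixedVertex hk] at h0
    have h1 : ∑ j ∈ Finset.range n, (if j = k then α j - β j else 0) = α k - β k := by
      simp [hk]
    rw [← h1, ← sub_eq_zero, ← Finset.sum_sub_distrib, ← Finset.sum_sub_distrib, ← neg_eq_zero,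
      ← Finset.sum_neg_distrib]
    refine Eq.trans ?_ h0
    refine Finset.sum_congr rfl fun j hj => ?_
    rw [inner_axis_movingVertex hk (Finset.mem_range.1 hj)]
    split_ifs <;> ring
  induction k with
  | zero =>
    rw [← abs_sub_eq_of_mul_nonpos (hαβ 0), coord 0 hk]
    simpa using hP 0
  | succ k ih =>
    have ih := ih (by omega)
    have hE : (∑ j ∈ Finset.range n, if j + 1 = k + 1 then α j + β j else 0) = α k + β k := by
      simp [show k < n by omega]
    rw [← abs_sub_eq_of_mul_nonpos (hαβ _), coord _ hk, hE]
    calc |α k + β k - P (k + 1)| ≤ |α k + β k| + |P (k + 1)| := abs_sub _ _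
      _ ≤ (|α k| + |β k|) + |P (k + 1)| := by gcongr; exact abs_add_le _ _
      _ ≤ _ := by
        push_cast
        linarith [hP (k + 1)]

lemma signedIndependent_vertices {u : ℝ} (hu : 4 * (n : ℝ) ^ 2 * u ^ 2 ≤ 1) :
    SignedIndependent (fun i : Fin n => fixedVertex n i) (fun i : Fin n => movingVertex n u i) := by
  intro α β hαβ hsum
  let α' : ℕ → ℝ := fun j => if h : j < n then α ⟨j, h⟩ else 0
  let β' : ℕ → ℝ := fun j => if h : j < n then β ⟨j, h⟩ else 0
  have hαβ' : ∀ j, α' j * β' j ≤ 0 := by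
    intro j
    by_cases hj : j < n <;> simp [α', β', hj, hαβ]
  have hsum' :
      ∑ j ∈ Finset.range n, (α' j • fixedVertex n j + β' j • movingVertex n u j) = 0 := by
    rw [← Fin.sum_univ_eq_sum_range (fun j => α' j • fixedVertex n j + β' j • movingVertex n u j),
      ← hsum]
    simp [α', β']
  set S := ∑ j ∈ Finset.range n, (|α' j| + |β' j|) with hS
  have hS0 : 0 ≤ S := by positivity
  have key : ∀ k, k < n → |α' k| + |β' k| ≤ n * (2 * u ^ 2 * S) := by
    intro k hk
    refine (abs_add_abs_le_of_relation hαβ' hsum' hk).trans ?_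
    rw [← hS]
    have : (k : ℝ) + 1 ≤ n := by exact_mod_cast hk
    gcongr
  have hle : S ≤ n * (n * (2 * u ^ 2 * S)) := by
    have := Finset.sum_le_card_nsmul (Finset.range n) (fun j => |α' j| + |β' j|) _
      fun k hk => key k (Finset.mem_range.1 hk)
    simpa using this
  have hzero : S = 0 := by nlinarith [mul_le_mul_of_nonneg_right hu hS0]
  intro i
  have hi := key i i.2
  rw [hzero] at hi
  have h1 := abs_nonneg (α' i)
  have h2 := abs_nonneg (β' i)
  have h3 : α' i = 0 := abs_eq_zero.1 (by linarith)
  have h4 : β' i = 0 := abs_eq_zero.1 (by linarith)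
  simpa [α', β'] using And.intro h3 h4

/-- The direction in which the equatorial hyperplane is tilted. -/
noncomputable def tilt (n : ℕ) : EuclideanSpace ℝ (Fin (n + 1)) :=
  ∑ k ∈ Finset.range n, (((k : ℝ) - n) / (4 * n)) • axis n k

lemma inner_tilt_axis {k : ℕ} (hk : k ≤ n) :
    ⟪tilt n, axis n k⟫ = ((k : ℝ) - n) / (4 * n) := by
  simp only [tilt, sum_inner, real_inner_smul_left, inner_axis_axis]
  rcases hk.lt_or_eq with hk | rfl
  · rw [Finset.sum_eq_single k (fun l _ hl => by simp [hl]) (fun h => by simp at h; omega)]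
    simp [hk]
  · rw [Finset.sum_eq_zero fun l hl => by simp at hl; simp [hl.ne]]
    simp

lemma inner_pole_tilt : ⟪pole n, tilt n⟫ = 0 := by
  simp [tilt, inner_sum, real_inner_smul_right, inner_pole_axis]

lemma inner_tilt_fixedVertex {j : ℕ} (hj : j < n) :
    ⟪tilt n, fixedVertex n j⟫ = 1 / (4 * n) := by
  rw [fixedVertex, inner_sub_right, inner_tilt_axis hj, inner_tilt_axis hj.le]
  push_cast
  ring

lemma le_inner_tilt_restVertex {j : ℕ} (hj : j < n) :
    -(1 / 2) ≤ ⟪tilt n, restVertex n j⟫ := by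
  have hn : (0 : ℝ) < n := by exact_mod_cast (Nat.zero_le j).trans_lt hj
  rw [restVertex, inner_add_right, inner_tilt_axis hj, inner_tilt_axis hj.le, ← add_div,
    le_div_iff₀ (by positivity)]
  push_cast
  linarith [(Nat.cast_nonneg j : (0 : ℝ) ≤ j)]

lemma inner_tilt_axisSum_nonpos {j : ℕ} (hj : j < n) : ⟪tilt n, axisSum n j⟫ ≤ 0 := by
  rw [axisSum, inner_sum]
  refine Finset.sum_nonpos fun k hk => ?_
  have hk : k ≤ n := by
    simp at hk
    omega
  rw [inner_tilt_axis hk]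
  exact div_nonpos_of_nonpos_of_nonneg (sub_nonpos.2 (by exact_mod_cast hk)) (by positivity)

lemma inner_tilt_tilt_le : ⟪tilt n, tilt n⟫ ≤ n := by
  have hsum : ⟪tilt n, tilt n⟫ = ∑ k ∈ Finset.range n,
      ⟪(((k : ℝ) - n) / (4 * n)) • axis n k, tilt n⟫ := by
    rw [← sum_inner]
    rfl
  rw [hsum]
  have h : ∀ k ∈ Finset.range n,
      ⟪(((k : ℝ) - n) / (4 * n)) • axis n k, tilt n⟫ ≤ 1 := by
    intro k hk
    have hk : k < n := Finset.mem_range.1 hk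
    have hk' : (k : ℝ) ≤ n := by exact_mod_cast hk.le
    have hn : (0 : ℝ) < n := by exact_mod_cast (Nat.zero_le k).trans_lt hk
    rw [real_inner_smul_left, real_inner_comm, inner_tilt_axis hk.le, ← sq, sq_le_one_iff_abs_le_one,
      abs_div, div_le_one (by positivity), abs_of_nonpos (by linarith), abs_of_pos (by positivity)]
    linarith [(Nat.cast_nonneg k : (0 : ℝ) ≤ k)]
  simpa using Finset.sum_le_card_nsmul _ _ _ h

/-- The axis of the half-turn that returns the tilted frame to the standard one. -/
noncomputable def turnAxis (n : ℕ) (u : ℝ) : EuclideanSpace ℝ (Fin (n + 1)) :=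
  pole n + u • tilt n

/-- The half-turn about `turnAxis n u`. It fixes the pole for `u = 0`, and moves it to first order
by `2 * u • tilt n`. -/
noncomputable def turn (n : ℕ) (u : ℝ) :
    EuclideanSpace ℝ (Fin (n + 1)) ≃ₗᵢ[ℝ] EuclideanSpace ℝ (Fin (n + 1)) :=
  (ℝ ∙ turnAxis n u).reflection

lemma norm_turnAxis_sq (u : ℝ) : ‖turnAxis n u‖ ^ 2 = 1 + u ^ 2 * ⟪tilt n, tilt n⟫ := by
  rw [← real_inner_self_eq_norm_sq, turnAxis, inner_add_left, inner_add_right, inner_add_right,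
    real_inner_smul_left, real_inner_smul_left, real_inner_smul_right, real_inner_smul_right,
    inner_pole_pole, real_inner_comm (pole n), inner_pole_tilt]
  ring

lemma norm_turnAxis_sq_pos (u : ℝ) : 0 < ‖turnAxis n u‖ ^ 2 := by
  have : 0 ≤ ⟪tilt n, tilt n⟫ := real_inner_self_nonneg
  rw [norm_turnAxis_sq]
  positivity

lemma turn_apply (u : ℝ) (x : EuclideanSpace ℝ (Fin (n + 1))) :
    turn n u x = (2 * (⟪turnAxis n u, x⟫ / ‖turnAxis n u‖ ^ 2)) • turnAxis n u - x := by
  rw [turn, Submodule.reflection_singleton_apply, two_mul, add_smul, two_smul]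
  rfl

lemma continuous_turnAxis : Continuous (turnAxis n) := by
  unfold turnAxis
  fun_prop

lemma continuous_turn {f : ℝ → EuclideanSpace ℝ (Fin (n + 1))} (hf : Continuous f) :
    Continuous fun u => turn n u (f u) := by
  simp only [turn_apply]
  have := continuous_turnAxis (n := n)
  have : Continuous fun u => ⟪turnAxis n u, f u⟫ / ‖turnAxis n u‖ ^ 2 :=
    (by fun_prop : Continuous fun u => ⟪turnAxis n u, f u⟫).div (by fun_prop)
      fun u => (norm_turnAxis_sq_pos u).ne'
  fun_prop

lemma inner_turn_pole (u : ℝ) (x : EuclideanSpace ℝ (Fin (n + 1))) :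
    ⟪turn n u x, pole n⟫ =
      2 * (⟪pole n, x⟫ + u * ⟪tilt n, x⟫) / ‖turnAxis n u‖ ^ 2 - ⟪pole n, x⟫ := by
  have h : ⟪turnAxis n u, pole n⟫ = 1 := by
    rw [turnAxis, inner_add_left, real_inner_smul_left, inner_pole_pole, real_inner_comm,
      inner_pole_tilt]
    ring
  rw [turn_apply, inner_sub_left, real_inner_smul_left, h, real_inner_comm (pole n) x, turnAxis,
    inner_add_left, real_inner_smul_left]
  ring

lemma inner_pole_fixedVertex (j : ℕ) : ⟪pole n, fixedVertex n j⟫ = 0 := by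
  simp [fixedVertex, inner_sub_right, inner_pole_axis]

lemma inner_pole_movingVertex (u : ℝ) (j : ℕ) :
    ⟪pole n, movingVertex n u j⟫ = u * mirrorCoeff u j := by
  simp only [movingVertex, restVertex, mirror, inner_add_right, inner_sub_right,
    real_inner_smul_right, inner_pole_axis, inner_pole_pole, inner_pole_axisSum]
  ring

lemma inner_tilt_movingVertex (u : ℝ) (j : ℕ) :
    ⟪tilt n, movingVertex n u j⟫ =
      ⟪tilt n, restVertex n j⟫ - u ^ 2 * mirrorCoeff u j * ⟪tilt n, axisSum n j⟫ := by
  rw [movingVertex, inner_add_right, real_inner_smul_right, mirror, inner_sub_right,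
    real_inner_smul_right, real_inner_comm (pole n), inner_pole_tilt]
  ring

lemma mul_inner_turn_fixedVertex_pos {u : ℝ} (hu : u ≠ 0) {j : ℕ} (hj : j < n) :
    0 < u * ⟪turn n u (fixedVertex n j), pole n⟫ := by
  have hn : (0 : ℝ) < n := by exact_mod_cast (Nat.zero_le j).trans_lt hj
  have hq := norm_turnAxis_sq_pos (n := n) u
  rw [inner_turn_pole, inner_pole_fixedVertex, inner_tilt_fixedVertex hj]
  have : u * (2 * (0 + u * (1 / (4 * n))) / ‖turnAxis n u‖ ^ 2 - 0) =
      u ^ 2 * (2 * (1 / (4 * n)) / ‖turnAxis n u‖ ^ 2) := by ring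
  rw [this]
  positivity

lemma mul_inner_turn_movingVertex_pos {u : ℝ} (hu : u ≠ 0) (hun : 4 * (n : ℝ) ^ 2 * u ^ 2 ≤ 1)
    {j : ℕ} (hj : j < n) : 0 < u * ⟪turn n u (movingVertex n u j), pole n⟫ := by
  have hn : (1 : ℝ) ≤ n := by exact_mod_cast (Nat.zero_le j).trans_lt hj
  have hnu : 4 * (n * u ^ 2) ≤ 1 := by nlinarith [mul_nonneg (sub_nonneg.2 hn) (sq_nonneg u)]
  have hq := norm_turnAxis_sq_pos (n := n) u
  have hq' : ‖turnAxis n u‖ ^ 2 ≤ 5 / 4 := by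
    rw [norm_turnAxis_sq]
    nlinarith [mul_le_mul_of_nonneg_left (inner_tilt_tilt_le (n := n)) (sq_nonneg u)]
  have hd := mirrorCoeff_pos u j
  have hd' : 8 / 5 ≤ mirrorCoeff u j := by
    have : (j : ℝ) + 1 ≤ n := by exact_mod_cast hj
    unfold mirrorCoeff
    rw [div_le_div_iff₀ (by norm_num) (by positivity)]
    nlinarith [mul_le_mul_of_nonneg_right this (sq_nonneg u)]
  have hr := le_inner_tilt_restVertex hj
  have hs := inner_tilt_axisSum_nonpos hj
  rw [inner_turn_pole, inner_pole_movingVertex, inner_tilt_movingVertex]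
  set q := ‖turnAxis n u‖ ^ 2
  set d := mirrorCoeff u j
  set r := ⟪tilt n, restVertex n j⟫
  set s := ⟪tilt n, axisSum n j⟫
  have : u * (2 * (u * d + u * (r - u ^ 2 * d * s)) / q - u * d) =
      u ^ 2 / q * (2 * r + d * (2 - q) + 2 * (u ^ 2 * d * -s)) := by
    field_simp
    ring
  rw [this]
  have h1 : 0 ≤ u ^ 2 * d * -s := mul_nonneg (by positivity) (by linarith)
  have h2 : 8 / 5 * (3 / 4) ≤ d * (2 - q) := by
    apply mul_le_mul <;> linarith
  have : 0 < u ^ 2 := by positivity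
  exact mul_pos (by positivity) (by linarith)

lemma inner_turn_zero_pole (x : EuclideanSpace ℝ (Fin (n + 1))) :
    ⟪turn n 0 x, pole n⟫ = ⟪pole n, x⟫ := by
  rw [inner_turn_pole, norm_turnAxis_sq]
  ring

lemma norm_fixedVertex (j : ℕ) : ‖fixedVertex n j‖ = ‖restVertex n j‖ := by
  have h : ⟪axis n (j + 1), axis n j⟫ = 0 := by
    simp [inner_axis_axis]
  rw [fixedVertex, restVertex, ← sq_eq_sq₀ (norm_nonneg _) (norm_nonneg _), norm_sub_sq_real,
    norm_add_sq_real, h]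
  ring

lemma norm_movingVertex (u : ℝ) {j : ℕ} (hj : j < n) :
    ‖movingVertex n u j‖ = ‖restVertex n j‖ := by
  rw [norm_eq_sqrt_real_inner, norm_eq_sqrt_real_inner,
    inner_movingVertex_movingVertex u le_rfl hj]

lemma norm_restVertex_pos {j : ℕ} (hj : j < n) : 0 < ‖restVertex n j‖ := by
  rw [norm_pos_iff]
  intro h
  simpa [h] using inner_axis_restVertex hj j

lemma continuous_movingVertex (j : ℕ) : Continuous fun u => movingVertex n u j := by
  have : Continuous fun u => mirrorCoeff u j := by
    unfold mirrorCoeff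
    exact continuous_const.div (by fun_prop) fun u => by positivity
  unfold movingVertex mirror
  fun_prop

/-- The vertices `a j` of the flexible cross-polytope. -/
noncomputable def vertexA (j : Fin n) (u : ℝ) : EuclideanSpace ℝ (Fin (n + 1)) :=
  ‖restVertex n j‖⁻¹ • turn n u (fixedVertex n j)

/-- The vertices `b j` of the flexible cross-polytope. -/
noncomputable def vertexB (j : Fin n) (u : ℝ) : EuclideanSpace ℝ (Fin (n + 1)) :=
  ‖restVertex n j‖⁻¹ • turn n u (movingVertex n u j)

lemma continuous_vertexA (j : Fin n) : Continuous (vertexA j) := by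
  unfold vertexA
  have := continuous_turn (n := n) (continuous_const (y := fixedVertex n j))
  fun_prop

lemma continuous_vertexB (j : Fin n) : Continuous (vertexB j) := by
  unfold vertexB
  have := continuous_turn (continuous_movingVertex (n := n) j)
  fun_prop

lemma norm_vertexA (j : Fin n) (u : ℝ) : ‖vertexA j u‖ = 1 := by
  rw [vertexA, norm_smul, norm_inv, norm_norm, LinearIsometryEquiv.norm_map,
    norm_fixedVertex, inv_mul_cancel₀ (norm_restVertex_pos j.2).ne']

lemma norm_vertexB (j : Fin n) (u : ℝ) : ‖vertexB j u‖ = 1 := by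
  rw [vertexB, norm_smul, norm_inv, norm_norm, LinearIsometryEquiv.norm_map,
    norm_movingVertex u j.2, inv_mul_cancel₀ (norm_restVertex_pos j.2).ne']

lemma inner_vertexA_vertexA (i j : Fin n) (u v : ℝ) :
    ⟪vertexA i u, vertexA j u⟫ = ⟪vertexA i v, vertexA j v⟫ := by
  simp [vertexA, real_inner_smul_left, real_inner_smul_right]

lemma inner_vertexA_vertexB (i j : Fin n) (u : ℝ) :
    ⟪vertexA i u, vertexB j u⟫ = ‖restVertex n i‖⁻¹ * (‖restVertex n j‖⁻¹ *
      (⟪fixedVertex n i, restVertex n j⟫ + if j = i then mirrorCoeff u j * u ^ 2 else 0)) := by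
  rw [vertexA, vertexB, real_inner_smul_left, real_inner_smul_right,
    LinearIsometryEquiv.inner_map_map, inner_fixedVertex_movingVertex u j.2]
  simp [Fin.ext_iff]

lemma inner_vertexB_vertexB (i j : Fin n) (u v : ℝ) :
    ⟪vertexB i u, vertexB j u⟫ = ⟪vertexB i v, vertexB j v⟫ := by
  have key : ⟪movingVertex n u i, movingVertex n u j⟫ =
      ⟪movingVertex n v i, movingVertex n v j⟫ := by
    rcases le_total (i : ℕ) j with h | h
    · rw [inner_movingVertex_movingVertex u h j.2, inner_movingVertex_movingVertex v h j.2]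
    · rw [real_inner_comm, real_inner_comm (movingVertex n v j),
        inner_movingVertex_movingVertex u h i.2, inner_movingVertex_movingVertex v h i.2]
  simp [vertexB, real_inner_smul_left, real_inner_smul_right, key]

lemma inner_vertexA_vertexB_self_ne (i : Fin n) {u : ℝ} (hu : u ≠ 0) :
    ⟪vertexA i u, vertexB i u⟫ ≠ ⟪vertexA i 0, vertexB i 0⟫ := by
  have h := (norm_restVertex_pos i.2).ne'
  have h' := (mirrorCoeff_pos u i).ne'
  rw [inner_vertexA_vertexB, inner_vertexA_vertexB]
  simp [h, h', hu]

lemma signedIndependent_vertexA_vertexB {u : ℝ} (hu : 4 * (n : ℝ) ^ 2 * u ^ 2 ≤ 1) :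
    SignedIndependent (fun i : Fin n => vertexA i u) (fun i : Fin n => vertexB i u) :=
  ((signedIndependent_vertices hu).map (turn n u).toLinearEquiv.toLinearMap
    (turn n u).injective).smul fun i => inv_pos.2 (norm_restVertex_pos i.2)

lemma inner_vertexA_zero_pole (i : Fin n) : ⟪vertexA i 0, pole n⟫ = 0 := by
  rw [vertexA, real_inner_smul_left, inner_turn_zero_pole, inner_pole_fixedVertex, mul_zero]

lemma inner_vertexB_zero_pole (i : Fin n) : ⟪vertexB i 0, pole n⟫ = 0 := by
  rw [vertexB, real_inner_smul_left, inner_turn_zero_pole, inner_pole_movingVertex, zero_mul, mul_zero]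

lemma mul_inner_vertexA_pole_pos (i : Fin n) {u : ℝ} (hu : u ≠ 0) :
    0 < u * ⟪vertexA i u, pole n⟫ := by
  rw [vertexA, real_inner_smul_left, mul_left_comm]
  exact mul_pos (inv_pos.2 (norm_restVertex_pos i.2)) (mul_inner_turn_fixedVertex_pos hu i.2)

lemma mul_inner_vertexB_pole_pos (i : Fin n) {u : ℝ} (hu : u ≠ 0)
    (hun : 4 * (n : ℝ) ^ 2 * u ^ 2 ≤ 1) : 0 < u * ⟪vertexB i u, pole n⟫ := by
  rw [vertexB, real_inner_smul_left, mul_left_comm]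
  exact mul_pos (inv_pos.2 (norm_restVertex_pos i.2)) (mul_inner_turn_movingVertex_pos hu hun i.2)

end FlexibleCrossPolytope

open FlexibleCrossPolytope in
/-- for every `n ≥ 2` there is an embedded flexible cross-polytope in the
sphere `Sⁿ` which at `u = 0` lies in the equatorial great sphere, lies in the open upper
hemisphere for `0 < u < δ` and in the open lower hemisphere for `-δ < u < 0`, whose edge
lengths are constant, whose diagonals genuinely vary, and which is embedded for `|u| < δ`. -/
theorem exists_embedded_flexible_cross_polytope (n : ℕ) (hn : 2 ≤ n) :
    ∃ δ : ℝ, 0 < δ ∧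
    ∃ (m : EuclideanSpace ℝ (Fin (n + 1)))
      (a b : Fin n → ℝ → EuclideanSpace ℝ (Fin (n + 1))),
      ‖m‖ = 1 ∧
      (∀ i, Continuous (a i)) ∧ (∀ i, Continuous (b i)) ∧
      (∀ (i : Fin n) (u : ℝ), ‖a i u‖ = 1) ∧ (∀ (i : Fin n) (u : ℝ), ‖b i u‖ = 1) ∧
      -- (1) all edge lengths are constant during the flexion
      (∀ i j : Fin n, i ≠ j → ∀ u : ℝ,
        ⟪a i u, a j u⟫ = ⟪a i 0, a j 0⟫ ∧
        ⟪a i u, b j u⟫ = ⟪a i 0, b j 0⟫ ∧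
        ⟪b i u, b j u⟫ = ⟪b i 0, b j 0⟫) ∧
      -- (2) the deformation is a genuine flexion
      (∀ i : Fin n, ¬ (∀ u v : ℝ, ⟪a i u, b i u⟫ = ⟪a i v, b i v⟫)) ∧
      -- (3) nondegeneracy of every facet
      (∀ (u : ℝ) (A : Finset (Fin n)),
        LinearIndependent ℝ (fun i : Fin n => if i ∈ A then a i u else b i u)) ∧
      -- (4) at u = 0 the cross-polytope lies in the equatorial great sphere
      (∀ i : Fin n, ⟪a i 0, m⟫ = 0 ∧ ⟪b i 0, m⟫ = 0) ∧
      -- (5) hemisphere conditions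
      (∀ u : ℝ, 0 < u → u < δ → ∀ i : Fin n, 0 < ⟪a i u, m⟫ ∧ 0 < ⟪b i u, m⟫) ∧
      (∀ u : ℝ, -δ < u → u < 0 → ∀ i : Fin n, ⟪a i u, m⟫ < 0 ∧ ⟪b i u, m⟫ < 0) ∧
      -- (6) embeddedness for |u| < δ: facets intersect along common faces
      (∀ u : ℝ, -δ < u → u < δ → ∀ A A' : Finset (Fin n), A ≠ A' →
        sphericalSimplex (fun i : Fin n => if i ∈ A then a i u else b i u) ∩
          sphericalSimplex (fun i : Fin n => if i ∈ A' then a i u else b i u) =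
        sphericalSimplex (fun i : {i : Fin n // (i ∈ A ∧ i ∈ A') ∨ (i ∉ A ∧ i ∉ A')} =>
          if (i : Fin n) ∈ A then a i u else b i u)) := by
  have hn' : (0 : ℝ) < n := by exact_mod_cast (by omega : 0 < n)
  set δ : ℝ := 1 / (2 * n) with hδ
  have hδ0 : 0 < δ := by positivity
  have hsmall : ∀ u : ℝ, -δ ≤ u → u ≤ δ → 4 * (n : ℝ) ^ 2 * u ^ 2 ≤ 1 := by
    intro u h1 h2
    have h3 : u ^ 2 ≤ δ ^ 2 := sq_le_sq' h1 h2
    have h4 : 4 * (n : ℝ) ^ 2 * δ ^ 2 = 1 := by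
      rw [hδ]
      field_simp
      norm_num
    rw [← h4]
    gcongr
  let τ : ℝ → ℝ := fun u => max (-δ) (min u δ)
  have hτ : Continuous τ := by fun_prop
  have hτ_eq : ∀ u : ℝ, -δ ≤ u → u ≤ δ → τ u = u := by
    intro u h1 h2
    simp [τ, h1, h2]
  have hτ_small : ∀ u, 4 * (n : ℝ) ^ 2 * τ u ^ 2 ≤ 1 := fun u =>
    hsmall _ (le_max_left _ _) (max_le (by linarith) (min_le_right _ _))
  have hτ0 : τ 0 = 0 := hτ_eq 0 (by linarith) hδ0.le
  refine ⟨δ, hδ0, pole n, fun i u => vertexA i (τ u), fun i u => vertexB i (τ u), by simp [pole],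
    fun i => (continuous_vertexA i).comp hτ, fun i => (continuous_vertexB i).comp hτ,
    fun i u => norm_vertexA i _, fun i u => norm_vertexB i _, fun i j hij u =>
      ⟨inner_vertexA_vertexA i j _ _, ?_, inner_vertexB_vertexB i j _ _⟩, ?_,
    fun u A => (signedIndependent_vertexA_vertexB (hτ_small u)).linearIndependent A, ?_, ?_, ?_,
    fun u _ _ A A' _ =>
      (signedIndependent_vertexA_vertexB (hτ_small u)).sphericalSimplex_inter A A'⟩
  · simp only [inner_vertexA_vertexB, if_neg hij.symm]
  · intro i h
    have := h δ 0
    simp only [hτ0, hτ_eq δ (by linarith) le_rfl] at this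
    exact inner_vertexA_vertexB_self_ne i hδ0.ne' this
  · intro i
    simp only [hτ0]
    exact ⟨inner_vertexA_zero_pole i, inner_vertexB_zero_pole i⟩
  · intro u h1 h2 i
    simp only [hτ_eq u (by linarith) h2.le]
    exact ⟨(mul_pos_iff_of_pos_left h1).1 (mul_inner_vertexA_pole_pos i h1.ne'),
      (mul_pos_iff_of_pos_left h1).1
        (mul_inner_vertexB_pole_pos i h1.ne' (hsmall u (by linarith) h2.le))⟩
  · intro u h1 h2 i
    simp only [hτ_eq u h1.le (by linarith)]
    exact ⟨neg_of_mul_pos_right (mul_inner_vertexA_pole_pos i h2.ne) h2.le,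
      neg_of_mul_pos_right
        (mul_inner_vertexB_pole_pos i h2.ne (hsmall u h1.le (by linarith))) h2.le⟩
end
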